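/- Let ℓ ≥ 2 and μ > 0, and suppose p = ω(n^{−1/ℓ}). Let G be an n-vertex graph with minimum degree δ(G) ≥ (1 − 1/(ℓ+1) + μ)·n, where 1 − 1/(ℓ+1) is the minimum degree threshold for the ℓth power of a Hamilton cycle. Then the random sparsification G_p contains the ℓth power of a Hamilton cycle with high probability. -/

import Mathlib

/-- `G` is a `k`-uniform hypergraph on vertex set `Fin n` (graphs: `k = 2`). -/
def IsHG (k n : ℕ) (G : Finset (Finset (Fin n))) : Prop := ∀ e ∈ G, e.card = k

/-- Minimum `d`-degree of `G` is at least `m` (as a real number). -/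
def MinDegGE {n : ℕ} (G : Finset (Finset (Fin n))) (d : ℕ) (m : ℝ) : Prop :=
  ∀ S : Finset (Fin n), S.card = d → m ≤ ((G.filter (fun e => S ⊆ e)).card : ℝ)

open Classical in
/-- Probability that the random sparsification of `G` (each edge kept
independently with probability `p`) satisfies `Q`. -/
noncomputable def sparsProb {α : Type*} [DecidableEq α] (G : Finset α) (p : ℝ)
    (Q : Finset α → Prop) : ℝ :=
  ∑ E ∈ G.powerset, if Q E then p ^ E.card * (1 - p) ^ (G.card - E.card) else 0

/-- The edge set `E` on `Fin n` contains the `ℓ`-th power of a Hamilton cycle: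
a cyclic ordering of all vertices such that any two vertices at cyclic
distance at most `ℓ` are adjacent. -/
def HasPowHamCycle (ℓ n : ℕ) (E : Finset (Finset (Fin n))) : Prop :=
  ∃ f : ℕ → Fin n, (∀ i, f (i + n) = f i) ∧ Set.InjOn f (Set.Iio n) ∧
    (∀ v : Fin n, ∃ i < n, f i = v) ∧
    ∀ i j : ℕ, 1 ≤ j → j ≤ ℓ → ({f i, f (i + j)} : Finset (Fin n)) ∈ E

section RandomSubset

variable {α : Type*}

/-- Expectation of `f` over a random subset of `G` containing each element independently with
probability `p`. -/
noncomputable def subsetExp (G : Finset α) (p : ℝ) (f : Finset α → ℝ) : ℝ :=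
  ∑ E ∈ G.powerset, p ^ E.card * (1 - p) ^ (G.card - E.card) * f E

lemma subsetExp_add (G : Finset α) (p : ℝ) (f g : Finset α → ℝ) :
    subsetExp G p (fun E => f E + g E) = subsetExp G p f + subsetExp G p g := by
  simp only [subsetExp, mul_add, Finset.sum_add_distrib]

lemma subsetExp_const_mul (G : Finset α) (p c : ℝ) (f : Finset α → ℝ) :
    subsetExp G p (fun E => c * f E) = c * subsetExp G p f := by
  simp only [subsetExp, Finset.mul_sum]
  exact Finset.sum_congr rfl fun _ _ => by ring

lemma subsetExp_sum {ι : Type*} (s : Finset ι) (G : Finset α) (p : ℝ)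
    (f : ι → Finset α → ℝ) :
    subsetExp G p (fun E => ∑ i ∈ s, f i E) = ∑ i ∈ s, subsetExp G p (f i) := by
  simp only [subsetExp, Finset.mul_sum]
  exact Finset.sum_comm

lemma subsetExp_congr {G : Finset α} {p : ℝ} {f g : Finset α → ℝ}
    (h : ∀ E ⊆ G, f E = g E) : subsetExp G p f = subsetExp G p g :=
  Finset.sum_congr rfl fun E hE => by rw [h E (Finset.mem_powerset.1 hE)]

lemma subsetExp_mono {G : Finset α} {p : ℝ} (h0 : 0 ≤ p) (h1 : p ≤ 1) {f g : Finset α → ℝ}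
    (h : ∀ E ⊆ G, f E ≤ g E) : subsetExp G p f ≤ subsetExp G p g := by
  refine Finset.sum_le_sum fun E hE => ?_
  have : 0 ≤ 1 - p := by linarith
  exact mul_le_mul_of_nonneg_left (h E (Finset.mem_powerset.1 hE)) (by positivity)

lemma subsetExp_empty (p : ℝ) (f : Finset α → ℝ) : subsetExp ∅ p f = f ∅ := by
  simp [subsetExp]

variable [DecidableEq α]

lemma subsetExp_insert {G : Finset α} {a : α} (ha : a ∉ G) (p : ℝ) (f : Finset α → ℝ) :
    subsetExp (insert a G) p f =
      (1 - p) * subsetExp G p f + p * subsetExp G p (fun E => f (insert a E)) := by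
  unfold subsetExp
  rw [Finset.sum_powerset_insert ha, Finset.mul_sum, Finset.mul_sum]
  congr 1
  · refine Finset.sum_congr rfl fun E hE => ?_
    have hc := Finset.card_le_card (Finset.mem_powerset.1 hE)
    rw [Finset.card_insert_of_notMem ha, Nat.succ_sub hc, pow_succ]
    ring
  · refine Finset.sum_congr rfl fun E hE => ?_
    have haE : a ∉ E := fun h => ha (Finset.mem_powerset.1 hE h)
    rw [Finset.card_insert_of_notMem ha, Finset.card_insert_of_notMem haE, Nat.succ_sub_succ,
      pow_succ]
    ring

lemma subsetExp_const (G : Finset α) (p c : ℝ) : subsetExp G p (fun _ => c) = c := by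
  induction G using Finset.induction_on with
  | empty => simp [subsetExp_empty]
  | insert a G ha ih => rw [subsetExp_insert ha, ih]; ring

/-- The union of independent random subsets is a random subset. -/
lemma subsetExp_union (G : Finset α) {p p₁ p₂ : ℝ} (hp : (1 - p₁) * (1 - p₂) = 1 - p)
    (f : Finset α → ℝ) :
    subsetExp G p₁ (fun W => subsetExp G p₂ (fun W' => f (W ∪ W'))) = subsetExp G p f := by
  induction G using Finset.induction_on generalizing f with
  | empty => simp [subsetExp_empty]
  | insert a G ha ih =>
    have e1 := ih f
    have e2 := ih (fun E => f (insert a E))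
    simp only [subsetExp_insert ha, subsetExp_add, subsetExp_const_mul, Finset.insert_union,
      Finset.union_insert, Finset.insert_idem]
    rw [e1, e2]
    linear_combination (subsetExp G p f - subsetExp G p (fun E => f (insert a E))) * hp

open Classical in
lemma subsetExp_superset {G T : Finset α} (hT : T ⊆ G) (p : ℝ) :
    subsetExp G p (fun E => if T ⊆ E then 1 else 0) = p ^ T.card := by
  induction G using Finset.induction_on generalizing T with
  | empty => simp [subsetExp_empty, Finset.subset_empty.1 hT]
  | insert a G ha ih =>
    rw [subsetExp_insert ha]
    by_cases haT : a ∈ T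
    · have h1 : subsetExp G p (fun E => if T ⊆ E then (1 : ℝ) else 0) = 0 := by
        rw [subsetExp_congr (g := fun _ => 0), subsetExp_const]
        intro E hE
        rw [if_neg]
        exact fun h => ha (hE (h haT))
      have h2 := ih (T := T.erase a) (by
        intro x hx
        have := hT (Finset.mem_of_mem_erase hx)
        exact (Finset.mem_insert.1 this).resolve_left (Finset.ne_of_mem_erase hx))
      simp only [Finset.subset_insert_iff] at h2 ⊢
      rw [h1, h2, ← Finset.card_erase_add_one haT, pow_succ]
      ring
    · have hTG : T ⊆ G := (Finset.subset_insert_iff_of_notMem haT).1 hT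
      simp only [Finset.subset_insert_iff_of_notMem haT, ih hTG]
      ring

open Classical in
/-- Second moment bound for the event that a random set contains one of the sets `T ω`. -/
lemma second_moment_bound {Ω : Type*} (s : Finset Ω) (w : Ω → ℝ) (hw : ∀ ω ∈ s, 0 ≤ w ω)
    (G : Finset α) (T : Ω → Finset α) (hT : ∀ ω ∈ s, T ω ⊆ G) {p δ : ℝ} (hp0 : 0 < p)
    (hp1 : p ≤ 1) (hδ : 0 ≤ δ)
    (H : ∀ ω ∈ s, ∑ ω' ∈ s, w ω' * (p⁻¹) ^ (T ω ∩ T ω').card ≤ 1 + δ) :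
    (∑ ω ∈ s, w ω) / (1 + δ) ≤
      subsetExp G p (fun W => if ∃ ω ∈ s, T ω ⊆ W then 1 else 0) := by
  set I : Finset α → ℝ := fun W => if ∃ ω ∈ s, T ω ⊆ W then 1 else 0
  set X : Finset α → ℝ := fun W =>
    ∑ ω ∈ s, w ω * (p⁻¹) ^ (T ω).card * (if T ω ⊆ W then 1 else 0) with hX
  have hXI : ∀ W, X W * I W = X W := by
    intro W
    by_cases h : ∃ ω ∈ s, T ω ⊆ W
    · simp [I, if_pos h]
    · have : X W = 0 := Finset.sum_eq_zero fun ω hω => by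
        rw [if_neg (fun h' => h ⟨ω, hω, h'⟩), mul_zero]
      rw [this, zero_mul]
  have hEX : subsetExp G p X = ∑ ω ∈ s, w ω := by
    rw [hX, subsetExp_sum]
    refine Finset.sum_congr rfl fun ω hω => ?_
    rw [subsetExp_const_mul, subsetExp_superset (hT ω hω), mul_assoc, ← mul_pow,
      inv_mul_cancel₀ hp0.ne', one_pow, mul_one]
  have hEX2 : subsetExp G p (fun W => X W * X W) ≤ (1 + δ) * ∑ ω ∈ s, w ω := by
    have h1 : ∀ W, X W * X W = ∑ ω ∈ s, ∑ ω' ∈ s,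
        (w ω * w ω' * (p⁻¹) ^ ((T ω).card + (T ω').card)) *
          (if T ω ∪ T ω' ⊆ W then 1 else 0) := by
      intro W
      rw [hX, Finset.sum_mul_sum]
      refine Finset.sum_congr rfl fun ω _ => Finset.sum_congr rfl fun ω' _ => ?_
      by_cases h1 : T ω ⊆ W <;> by_cases h2 : T ω' ⊆ W <;>
        simp [h1, h2, Finset.union_subset_iff, pow_add]
      ring
    simp only [h1, subsetExp_sum, subsetExp_const_mul]
    rw [Finset.mul_sum]
    refine Finset.sum_le_sum fun ω hω => ?_
    calc _ = w ω * ∑ ω' ∈ s, w ω' * (p⁻¹) ^ (T ω ∩ T ω').card := by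
          rw [Finset.mul_sum]
          refine Finset.sum_congr rfl fun ω' hω' => ?_
          rw [subsetExp_superset (Finset.union_subset (hT ω hω) (hT ω' hω')),
            ← Finset.card_union_add_card_inter, pow_add]
          have : (p⁻¹) ^ (T ω ∪ T ω').card * p ^ (T ω ∪ T ω').card = 1 := by
            rw [← mul_pow, inv_mul_cancel₀ hp0.ne', one_pow]
          linear_combination (w ω * w ω' * (p⁻¹) ^ (T ω ∩ T ω').card) * this
      _ ≤ _ := by
          rw [mul_comm (1 + δ)]
          exact mul_le_mul_of_nonneg_left (H ω hω) (hw ω hω)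
  have hsq : 0 ≤ subsetExp G p (fun W => (X W - (1 + δ)) ^ 2 * I W) := by
    rw [← subsetExp_const G p 0]
    refine subsetExp_mono hp0.le hp1 fun W _ => ?_
    have : 0 ≤ I W := by simp only [I]; split_ifs <;> norm_num
    positivity
  have hexp : subsetExp G p (fun W => (X W - (1 + δ)) ^ 2 * I W) =
      subsetExp G p (fun W => X W * X W) + (-2 * (1 + δ)) * subsetExp G p X
        + (1 + δ) ^ 2 * subsetExp G p I := by
    rw [← subsetExp_const_mul, ← subsetExp_const_mul, ← subsetExp_add, ← subsetExp_add]
    refine subsetExp_congr fun W _ => ?_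
    have := hXI W
    linear_combination (X W - 2 * (1 + δ)) * this
  rw [hexp, hEX] at hsq
  rw [div_le_iff₀ (by linarith)]
  have : 0 ≤ (1 + δ) * ((1 + δ) * subsetExp G p I - ∑ ω ∈ s, w ω) := by nlinarith
  have := nonneg_of_mul_nonneg_right this (by linarith)
  linarith

end RandomSubset

section Fragmentation

variable {α Ω : Type*} [DecidableEq α] [Fintype Ω]

lemma sum_powerset_pow_filter_subset (A B : Finset α) (q : ℝ) :
    ∑ T ∈ A.powerset, (if T ⊆ B then q ^ T.card else 0) = (1 + q) ^ (A ∩ B).card := by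
  rw [← Finset.sum_filter]
  have : A.powerset.filter (· ⊆ B) = (A ∩ B).powerset := by
    ext T
    rw [Finset.mem_filter, Finset.mem_powerset, Finset.mem_powerset, Finset.subset_inter_iff]
  rw [this, add_comm, ← Finset.sum_pow_mul_eq_add_pow]
  simp

open Classical in
/-- Every member `S ω` of a family has, relative to a random set `W`, a fragment
`S (r ω W) \ W ⊆ S ω` of some member of the family which is small on average. -/
lemma exists_small_fragments (w : Ω → ℝ) (hw : ∀ ω, 0 ≤ w ω) (hw1 : ∑ ω, w ω = 1)
    (G : Finset α) (S : Ω → Finset α) (hS : ∀ ω, S ω ⊆ G) {p δ : ℝ} (hp0 : 0 < p)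
    (hp1 : p ≤ 1) (m : ℕ)
    (H : ∀ ω, ∑ ω', w ω' * (1 + 2 / p) ^ (S ω ∩ S ω').card ≤ δ * 2 ^ m) :
    ∃ r : Ω → Finset α → Ω, (∀ ω W, S (r ω W) \ W ⊆ S ω) ∧
      subsetExp G p (fun W => ∑ ω, w ω * (if m ≤ (S (r ω W) \ W).card then 1 else 0)) ≤ δ := by
  have hne : Nonempty Ω := by
    by_contra h
    rw [not_nonempty_iff] at h
    simp at hw1
  have h1p : 0 ≤ 1 - p := by linarith
  have hbest : ∀ ω W, ∃ ω', S ω' ⊆ S ω ∪ W ∧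
      ∀ ω'', S ω'' ⊆ S ω ∪ W → (S ω' \ W).card ≤ (S ω'' \ W).card := by
    intro ω W
    obtain ⟨ω', h1, h2⟩ := Finset.exists_min_image
      (Finset.univ.filter fun ω' => S ω' ⊆ S ω ∪ W) (fun ω' => (S ω' \ W).card)
      ⟨ω, by simp⟩
    exact ⟨ω', by simpa using h1, fun ω'' h => h2 ω'' (by simpa using h)⟩
  choose r hr hmin using hbest
  have hhat : ∀ Z : Finset α, ∃ ω, (∃ ω', S ω' ⊆ Z) → S ω ⊆ Z := by
    intro Z
    by_cases h : ∃ ω', S ω' ⊆ Z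
    · exact ⟨h.choose, fun _ => h.choose_spec⟩
    · exact ⟨hne.some, fun h' => absurd h' h⟩
  choose hat hhat using hhat
  have hsub : ∀ ω W, S (r ω W) \ W ⊆ S ω := by
    intro ω W x hx
    rw [Finset.mem_sdiff] at hx
    exact (Finset.mem_union.1 (hr ω W hx.1)).resolve_right hx.2
  refine ⟨r, hsub, ?_⟩
  set T : Ω → Finset α → Finset α := fun ω W => S (r ω W) \ W with hT
  have hThat : ∀ ω W, T ω W ⊆ S (hat (W ∪ T ω W)) := by
    intro ω W
    set Z := W ∪ T ω W with hZ
    have hZs : S (hat Z) ⊆ Z := hhat Z ⟨r ω W, by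
      intro x hx
      by_cases hxW : x ∈ W <;> simp [hZ, hT, hxW, hx]⟩
    have hcand : S (hat Z) ⊆ S ω ∪ W := by
      refine hZs.trans ?_
      rw [hZ, Finset.union_comm]
      exact Finset.union_subset_union_left (hsub ω W)
    have hsd : S (hat Z) \ W ⊆ T ω W := by
      intro x hx
      rw [Finset.mem_sdiff] at hx
      exact (Finset.mem_union.1 (hZs hx.1)).resolve_left hx.2
    rw [← Finset.eq_of_subset_of_card_le hsd (hmin ω W _ hcand)]
    exact Finset.sdiff_subset
  set μ : Finset α → ℝ := fun W => p ^ W.card * (1 - p) ^ (G.card - W.card) with hμ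
  have hμ0 : ∀ W, 0 ≤ μ W := fun W => by positivity
  have hμsum : ∑ Z ∈ G.powerset, μ Z = 1 := by
    have := subsetExp_const G p 1
    simpa [subsetExp] using this
  have hround : ∀ ω, ∑ W ∈ G.powerset, μ W * (if m ≤ (T ω W).card then 1 else 0) ≤
      ∑ Z ∈ G.powerset, μ Z * ((2 ^ m)⁻¹ * (1 + 2 / p) ^ (S (hat Z) ∩ S ω).card) := by
    intro ω
    set h : Finset α × Finset α → ℝ := fun x => μ x.1 *
      ((2 ^ m)⁻¹ * if x.2 ⊆ S (hat x.1) ∧ x.2 ⊆ S ω then (2 / p) ^ x.2.card else 0) with hh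
    have hh0 : ∀ x, 0 ≤ h x := by
      intro x
      simp only [hh]
      have := hμ0 x.1
      split_ifs <;> positivity
    have step1 : ∀ W ∈ G.powerset, μ W * (if m ≤ (T ω W).card then 1 else 0) ≤
        h (W ∪ T ω W, T ω W) := by
      intro W hW
      rw [Finset.mem_powerset] at hW
      by_cases hm : m ≤ (T ω W).card
      swap
      · rw [if_neg hm, mul_zero]; exact hh0 _
      rw [if_pos hm, mul_one]
      simp only [hh]
      rw [if_pos ⟨hThat ω W, hsub ω W⟩]
      have hdis : Disjoint W (T ω W) := Finset.disjoint_sdiff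
      have hle : W.card + (T ω W).card ≤ G.card := by
        rw [← Finset.card_union_of_disjoint hdis]
        exact Finset.card_le_card (Finset.union_subset hW ((hsub ω W).trans (hS ω)))
      simp only [hμ, Finset.card_union_of_disjoint hdis]
      set t := (T ω W).card
      obtain ⟨c, hc⟩ := Nat.exists_eq_add_of_le hle
      have e1 : G.card - W.card = t + c := by omega
      have e2 : G.card - (W.card + t) = c := by omega
      rw [e1, e2, div_pow]
      obtain ⟨d, hd⟩ := Nat.exists_eq_add_of_le hm
      have hpt : p ^ t ≠ 0 := (pow_pos hp0 t).ne'
      have : p ^ (W.card + t) * (1 - p) ^ c * ((2 ^ m)⁻¹ * (2 ^ t / p ^ t)) =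
          p ^ W.card * (1 - p) ^ c * 2 ^ d := by
        rw [hd, pow_add, pow_add, ← hd]
        field_simp
        rw [hd, pow_add]
        field_simp
      rw [this, pow_add]
      have h3 : (1 - p) ^ t ≤ 1 := pow_le_one₀ h1p (by linarith)
      have h4 : (1 : ℝ) ≤ 2 ^ d := one_le_pow₀ (by norm_num)
      have h5 : 0 ≤ p ^ W.card * (1 - p) ^ c := by positivity
      nlinarith [mul_le_mul_of_nonneg_left (h3.trans h4) h5]
    calc _ ≤ ∑ W ∈ G.powerset, h (W ∪ T ω W, T ω W) := Finset.sum_le_sum step1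
      _ = ∑ x ∈ G.powerset.image (fun W => (W ∪ T ω W, T ω W)), h x := by
          rw [Finset.sum_image]
          intro W _ W' _ he
          have h1 : W ∪ T ω W = W' ∪ T ω W' := congrArg Prod.fst he
          have h2 : T ω W = T ω W' := congrArg Prod.snd he
          have d1 : Disjoint W (T ω W) := Finset.disjoint_sdiff
          have d2 : Disjoint W' (T ω W') := Finset.disjoint_sdiff
          rw [← Finset.union_sdiff_cancel_right d1, ← Finset.union_sdiff_cancel_right d2, h1, h2]
      _ ≤ ∑ x ∈ G.powerset ×ˢ G.powerset, h x := by
          refine Finset.sum_le_sum_of_subset_of_nonneg ?_ fun x _ _ => hh0 x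
          intro x hx
          obtain ⟨W, hW, rfl⟩ := Finset.mem_image.1 hx
          have hT' := (hsub ω W).trans (hS ω)
          simp only [Finset.mem_product, Finset.mem_powerset] at hW ⊢
          exact ⟨Finset.union_subset hW hT', hT'⟩
      _ = ∑ Z ∈ G.powerset, ∑ T ∈ G.powerset, h (Z, T) := Finset.sum_product _ _ _
      _ ≤ _ := by
          refine Finset.sum_le_sum fun Z _ => ?_
          simp only [hh, ← Finset.mul_sum]
          refine mul_le_mul_of_nonneg_left (mul_le_mul_of_nonneg_left ?_ (by positivity)) (hμ0 Z)
          rw [← sum_powerset_pow_filter_subset, ← Finset.sum_filter, ← Finset.sum_filter]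
          refine le_of_eq (Finset.sum_congr ?_ fun _ _ => rfl)
          ext T
          simp only [Finset.mem_filter, Finset.mem_powerset]
          exact ⟨fun h => h.2, fun h => ⟨h.2.trans (hS ω), h⟩⟩
  rw [subsetExp_sum]
  calc _ = ∑ ω, w ω * ∑ W ∈ G.powerset, μ W * (if m ≤ (T ω W).card then 1 else 0) := by
        refine Finset.sum_congr rfl fun ω _ => ?_
        rw [subsetExp_const_mul]
        rfl
    _ ≤ ∑ ω, w ω *
        ∑ Z ∈ G.powerset, μ Z * ((2 ^ m)⁻¹ * (1 + 2 / p) ^ (S (hat Z) ∩ S ω).card) :=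
        Finset.sum_le_sum fun ω _ => mul_le_mul_of_nonneg_left (hround ω) (hw ω)
    _ = ∑ Z ∈ G.powerset, μ Z *
        ((2 ^ m)⁻¹ * ∑ ω, w ω * (1 + 2 / p) ^ (S (hat Z) ∩ S ω).card) := by
        simp only [Finset.mul_sum]
        rw [Finset.sum_comm]
        exact Finset.sum_congr rfl fun _ _ => Finset.sum_congr rfl fun _ _ => by ring
    _ ≤ ∑ Z ∈ G.powerset, μ Z * δ := by
        refine Finset.sum_le_sum fun Z _ => mul_le_mul_of_nonneg_left ?_ (hμ0 Z)
        have h2 : (0 : ℝ) < 2 ^ m := by positivity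
        rw [inv_mul_le_iff₀ h2, mul_comm _ δ]
        exact H _
    _ = δ := by rw [← Finset.sum_mul, hμsum, one_mul]

open Classical in
lemma sparsProb_eq_subsetExp (G : Finset α) (p : ℝ) (Q : Finset α → Prop) :
    sparsProb G p Q = subsetExp G p (fun E => if Q E then 1 else 0) := by
  unfold sparsProb subsetExp
  refine Finset.sum_congr rfl fun E _ => ?_
  by_cases h : Q E
  · simp only [if_pos h, mul_one]
  · simp only [if_neg h, mul_zero]

lemma sparsProb_mono (G : Finset α) {p : ℝ} (h0 : 0 ≤ p) (h1 : p ≤ 1) {Q R : Finset α → Prop}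
    (h : ∀ E ⊆ G, Q E → R E) : sparsProb G p Q ≤ sparsProb G p R := by
  classical
  rw [sparsProb_eq_subsetExp, sparsProb_eq_subsetExp]
  refine subsetExp_mono h0 h1 fun E hE => ?_
  by_cases hQ : Q E
  · rw [if_pos hQ, if_pos (h E hE hQ)]
  · rw [if_neg hQ]; split_ifs <;> norm_num

/-- Two-round exposure: a family with well-spread pairwise intersections has a member inside a
random set with probability close to one. -/
theorem sparsProb_exists_subset_ge (w : Ω → ℝ) (hw : ∀ ω, 0 ≤ w ω) (hw1 : ∑ ω, w ω = 1)
    (G : Finset α) (S : Ω → Finset α) (hS : ∀ ω, S ω ⊆ G) {p δ₁ δ₂ : ℝ} (hp0 : 0 < p)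
    (hp1 : p ≤ 1) (hδ₂ : 0 ≤ δ₂) (m : ℕ)
    (H₁ : ∀ ω, ∑ ω', w ω' * (1 + 4 / p) ^ (S ω ∩ S ω').card ≤ δ₁ * 2 ^ m)
    (H₂ : ∀ ω, ∀ A ⊆ S ω, A.card < m →
      ∑ ω', w ω' * (1 + 4 / p) ^ (A ∩ S ω').card ≤ 1 + δ₂) :
    (1 - δ₁) / (1 + δ₂) ≤ sparsProb G p (fun E => ∃ ω, S ω ⊆ E) := by
  classical
  obtain ⟨r, hr, hbad⟩ := exists_small_fragments w hw hw1 G S hS (p := p / 2) (δ := δ₁)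
    (by positivity) (by linarith) m (by
      intro ω
      have : 2 / (p / 2) = 4 / p := by field_simp; norm_num
      rw [this]
      exact H₁ ω)
  set p₂ : ℝ := (p / 2) / (1 - p / 2) with hp₂
  have hd : 0 < 1 - p / 2 := by linarith
  have hp₂0 : 0 < p₂ := by positivity
  have hp₂1 : p₂ ≤ 1 := by rw [hp₂, div_le_one hd]; linarith
  have hp₂p : p₂⁻¹ ≤ 1 + 4 / p := by
    rw [hp₂, inv_div, div_le_iff₀ (by positivity)]
    field_simp
    nlinarith
  have hun : (1 - p / 2) * (1 - p₂) = 1 - p := by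
    rw [mul_sub, hp₂, mul_div_cancel₀ _ hd.ne']
    ring
  rw [sparsProb_eq_subsetExp, ← subsetExp_union G hun]
  have key : ∀ W ⊆ G, (1 + δ₂)⁻¹ *
      (1 + (-1) * ∑ ω, w ω * (if m ≤ (S (r ω W) \ W).card then 1 else 0)) ≤
      subsetExp G p₂ (fun W' => if ∃ ω, S ω ⊆ W ∪ W' then 1 else 0) := by
    intro W _
    have h1 := second_moment_bound
      (Finset.univ.filter fun ω => ¬ m ≤ (S (r ω W) \ W).card) w (fun ω _ => hw ω) G
      (fun ω => S (r ω W) \ W) (fun ω _ => (hr ω W).trans (hS ω)) hp₂0 hp₂1 hδ₂ (by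
        intro ω hω
        rw [Finset.mem_filter] at hω
        refine le_trans ?_ (H₂ ω _ (hr ω W) (not_le.1 hω.2))
        refine le_trans (Finset.sum_le_sum_of_subset_of_nonneg (Finset.filter_subset _ _)
          fun i _ _ => mul_nonneg (hw i) (by positivity)) ?_
        refine Finset.sum_le_sum fun ω' _ => mul_le_mul_of_nonneg_left ?_ (hw ω')
        have h4 : 1 ≤ 1 + 4 / p := by
          have : 0 ≤ 4 / p := by positivity
          linarith
        calc p₂⁻¹ ^ _ ≤ (1 + 4 / p) ^ _ := pow_le_pow_left₀ (by positivity) hp₂p _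
          _ ≤ _ := pow_le_pow_right₀ h4
            (Finset.card_le_card (Finset.inter_subset_inter_left (hr ω' W))))
    refine le_trans (le_of_eq ?_) (h1.trans (subsetExp_mono hp₂0.le hp₂1 fun W' _ => ?_))
    · rw [div_eq_inv_mul, Finset.sum_filter]
      congr 1
      rw [neg_one_mul, ← sub_eq_add_neg]
      nth_rewrite 1 [← hw1]
      rw [← Finset.sum_sub_distrib]
      refine Finset.sum_congr rfl fun ω _ => ?_
      split_ifs <;> simp
    · by_cases h : ∃ ω ∈ Finset.univ.filter fun ω => ¬ m ≤ (S (r ω W) \ W).card,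
        S (r ω W) \ W ⊆ W'
      · obtain ⟨ω, hω, h2⟩ := h
        rw [if_pos ⟨ω, hω, h2⟩, if_pos ⟨r ω W, sdiff_le_iff.1 h2⟩]
      · rw [if_neg h]; split_ifs <;> norm_num
  refine le_trans ?_ ((subsetExp_mono (p := p / 2) (by positivity) (by linarith) key).trans
    (le_of_eq (by congr!)))
  rw [subsetExp_const_mul, subsetExp_add, subsetExp_const_mul, subsetExp_const, div_eq_inv_mul]
  exact mul_le_mul_of_nonneg_left (by linarith) (by positivity)

end Fragmentation

section Components

variable {n ℓ : ℕ}

/-- The vertices covered by a set of pairs `(x, d)`, which encode the edges `x, x + (d + 1)`. -/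
def edgeVerts (C : Finset (ZMod n × Fin ℓ)) : Finset (ZMod n) :=
  C.image (fun a => a.1) ∪ C.image (fun a => a.1 + ((a.2 : ℕ) + 1 : ℕ))

lemma mem_edgeVerts {C : Finset (ZMod n × Fin ℓ)} {y : ZMod n} :
    y ∈ edgeVerts C ↔ ∃ a ∈ C, y = a.1 ∨ y = a.1 + ((a.2 : ℕ) + 1 : ℕ) := by
  simp only [edgeVerts, Finset.mem_union, Finset.mem_image]
  constructor
  · rintro (⟨a, ha, rfl⟩ | ⟨a, ha, rfl⟩)
    · exact ⟨a, ha, Or.inl rfl⟩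
    · exact ⟨a, ha, Or.inr rfl⟩
  · rintro ⟨a, ha, rfl | rfl⟩
    · exact Or.inl ⟨a, ha, rfl⟩
    · exact Or.inr ⟨a, ha, rfl⟩

lemma fst_mem_edgeVerts {C : Finset (ZMod n × Fin ℓ)} {a : ZMod n × Fin ℓ} (ha : a ∈ C) :
    a.1 ∈ edgeVerts C := mem_edgeVerts.2 ⟨a, ha, Or.inl rfl⟩

lemma snd_mem_edgeVerts {C : Finset (ZMod n × Fin ℓ)} {a : ZMod n × Fin ℓ} (ha : a ∈ C) :
    a.1 + ((a.2 : ℕ) + 1 : ℕ) ∈ edgeVerts C := mem_edgeVerts.2 ⟨a, ha, Or.inr rfl⟩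

lemma edgeVerts_mono {C C' : Finset (ZMod n × Fin ℓ)} (h : C ⊆ C') :
    edgeVerts C ⊆ edgeVerts C' := fun y hy => by
  obtain ⟨a, ha, h'⟩ := mem_edgeVerts.1 hy
  exact mem_edgeVerts.2 ⟨a, h ha, h'⟩

/-- Edges of `I` meeting the vertex set of `C` belong to `C`. -/
def EdgeClosed (I C : Finset (ZMod n × Fin ℓ)) : Prop :=
  ∀ a ∈ I, (a.1 ∈ edgeVerts C ∨ a.1 + ((a.2 : ℕ) + 1 : ℕ) ∈ edgeVerts C) → a ∈ C

/-- `C` is a connected set of edges containing `e`. -/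
def EdgeConn (e : ZMod n × Fin ℓ) (C : Finset (ZMod n × Fin ℓ)) : Prop :=
  e ∈ C ∧ ∀ C' ⊆ C, e ∈ C' → EdgeClosed C C' → C' = C

lemma exists_component (e : ZMod n × Fin ℓ) (I : Finset (ZMod n × Fin ℓ)) (he : e ∈ I) :
    ∃ C ⊆ I, EdgeConn e C ∧ EdgeClosed I C := by
  classical
  obtain ⟨C, hC, hmin⟩ := Finset.exists_min_image
    (I.powerset.filter fun C => e ∈ C ∧ EdgeClosed I C) Finset.card
    ⟨I, by
      rw [Finset.mem_filter]
      exact ⟨Finset.mem_powerset_self I, he, fun a ha _ => ha⟩⟩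
  simp only [Finset.mem_filter, Finset.mem_powerset] at hC hmin
  refine ⟨C, hC.1, ⟨hC.2.1, fun C' hC' he' hcl => ?_⟩, hC.2.2⟩
  refine Finset.eq_of_subset_of_card_le hC' (hmin C' ⟨hC'.trans hC.1, he', fun a ha h => ?_⟩)
  exact hcl a (hC.2.2 a ha (h.imp (fun h => edgeVerts_mono hC' h)
    (fun h => edgeVerts_mono hC' h))) h

/-- Displacements of length at most `ℓ`. -/
def nearSet (n ℓ : ℕ) : Finset (ZMod n) :=
  (Finset.univ : Finset (Fin ℓ)).image (fun d : Fin ℓ => (((d : ℕ) + 1 : ℕ) : ZMod n)) ∪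
    (Finset.univ : Finset (Fin ℓ)).image (fun d : Fin ℓ => -(((d : ℕ) + 1 : ℕ) : ZMod n))

lemma card_nearSet_le : (nearSet n ℓ).card ≤ 2 * ℓ := by
  refine (Finset.card_union_le _ _).trans ?_
  have h1 := Finset.card_image_le (s := (Finset.univ : Finset (Fin ℓ)))
    (f := fun d : Fin ℓ => (((d : ℕ) + 1 : ℕ) : ZMod n))
  have h2 := Finset.card_image_le (s := (Finset.univ : Finset (Fin ℓ)))
    (f := fun d : Fin ℓ => -(((d : ℕ) + 1 : ℕ) : ZMod n))
  rw [Finset.card_univ, Fintype.card_fin] at h1 h2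
  omega

lemma neg_mem_nearSet {x : ZMod n} (h : x ∈ nearSet n ℓ) : -x ∈ nearSet n ℓ := by
  simp only [nearSet, Finset.mem_union, Finset.mem_image] at h ⊢
  rcases h with ⟨d, hd, rfl⟩ | ⟨d, hd, rfl⟩
  · exact Or.inr ⟨d, hd, rfl⟩
  · exact Or.inl ⟨d, hd, (neg_neg _).symm⟩

lemma EdgeConn.exists_step {e : ZMod n × Fin ℓ} {C : Finset (ZMod n × Fin ℓ)}
    (hC : EdgeConn e C) {U : Finset (ZMod n)} (heU : e.1 ∈ U) (hU : U ⊂ edgeVerts C) :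
    ∃ u ∈ U, ∃ y ∈ edgeVerts C, y ∉ U ∧ ∃ a ∈ C,
      (a.1 = u ∧ a.1 + ((a.2 : ℕ) + 1 : ℕ) = y) ∨ (a.1 = y ∧ a.1 + ((a.2 : ℕ) + 1 : ℕ) = u) := by
  by_contra hcon
  push Not at hcon
  have hiff : ∀ a ∈ C, (a.1 ∈ U ↔ a.1 + ((a.2 : ℕ) + 1 : ℕ) ∈ U) := by
    intro a ha
    constructor
    · intro h
      by_contra h'
      exact (hcon _ h _ (snd_mem_edgeVerts ha) h' a ha).1 rfl rfl
    · intro h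
      by_contra h'
      exact (hcon _ h _ (fst_mem_edgeVerts ha) h' a ha).2 rfl rfl
  have hsub : ∀ y ∈ edgeVerts (C.filter fun a => a.1 ∈ U), y ∈ U := by
    intro y hy
    obtain ⟨a, ha, h⟩ := mem_edgeVerts.1 hy
    rw [Finset.mem_filter] at ha
    rcases h with rfl | rfl
    · exact ha.2
    · exact (hiff a ha.1).1 ha.2
  have := hC.2 (C.filter fun a => a.1 ∈ U) (Finset.filter_subset _ _)
    (by simp [hC.1, heU]) (by
      intro a ha h
      rw [Finset.mem_filter]
      refine ⟨ha, ?_⟩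
      rcases h with h | h
      · exact hsub _ h
      · exact (hiff a ha).2 (hsub _ h))
  rw [this] at hsub
  exact hU.2 hsub

lemma card_le_mul_edgeVerts (C : Finset (ZMod n × Fin ℓ)) :
    C.card ≤ ℓ * (edgeVerts C).card := by
  have : C ⊆ edgeVerts C ×ˢ Finset.univ := fun a ha => by
    simpa using fst_mem_edgeVerts ha
  have := Finset.card_le_card this
  rw [Finset.card_product, Finset.card_univ, Fintype.card_fin] at this
  linarith

variable [NeZero n]

open Classical in
/-- Maps on the vertex set `U` (extended by zero) sending the edges of `C` inside `U` to near
pairs. -/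
noncomputable def placements (C : Finset (ZMod n × Fin ℓ)) (U : Finset (ZMod n)) :
    Finset (ZMod n → ZMod n) :=
  Finset.univ.filter fun f => (∀ x ∉ U, f x = 0) ∧ ∀ a ∈ C, a.1 ∈ U →
    a.1 + ((a.2 : ℕ) + 1 : ℕ) ∈ U → f (a.1 + ((a.2 : ℕ) + 1 : ℕ)) - f a.1 ∈ nearSet n ℓ

lemma mem_placements {C : Finset (ZMod n × Fin ℓ)} {U : Finset (ZMod n)} {f : ZMod n → ZMod n} :
    f ∈ placements C U ↔ (∀ x ∉ U, f x = 0) ∧ ∀ a ∈ C, a.1 ∈ U →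
    a.1 + ((a.2 : ℕ) + 1 : ℕ) ∈ U → f (a.1 + ((a.2 : ℕ) + 1 : ℕ)) - f a.1 ∈ nearSet n ℓ := by
  simp [placements]

lemma EdgeConn.exists_growth {e : ZMod n × Fin ℓ} {C : Finset (ZMod n × Fin ℓ)}
    (hC : EdgeConn e C) (j : ℕ) (hj : j + 1 ≤ (edgeVerts C).card) :
    ∃ U ⊆ edgeVerts C, e.1 ∈ U ∧ U.card = j + 1 ∧
      (∀ u ∈ U, ∃ t : ℤ, |t| ≤ (ℓ * j : ℕ) ∧ u = e.1 + t) ∧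
      (placements C U).card ≤ n * (2 * ℓ) ^ j := by
  induction j with
  | zero =>
    refine ⟨{e.1}, by simpa using fst_mem_edgeVerts hC.1, by simp, by simp, ?_, ?_⟩
    · intro u hu
      exact ⟨0, by simp, by simpa using hu⟩
    · have : (placements C {e.1}).card ≤ (Finset.univ : Finset (ZMod n)).card := by
        refine Finset.card_le_card_of_injOn (fun f => f e.1) (fun _ _ => Finset.mem_univ _) ?_
        intro f hf g hg h
        have hf := (mem_placements.1 hf).1
        have hg := (mem_placements.1 hg).1
        funext x
        by_cases hx : x = e.1
        · rw [hx]; exact h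
        · rw [hf x (by simpa using hx), hg x (by simpa using hx)]
      rw [Finset.card_univ, ZMod.card] at this
      simpa using this
  | succ j ih =>
    obtain ⟨U, hUs, heU, hUc, hwin, hN⟩ := ih (by omega)
    have hss : U ⊂ edgeVerts C := by
      refine hUs.ssubset_of_ne fun h => ?_
      rw [← h] at hj
      omega
    obtain ⟨u, hu, y, hyC, hyU, a, ha, hau⟩ := hC.exists_step heU hss
    have hdiff : ∃ t : ℤ, |t| ≤ (ℓ : ℤ) ∧ y = u + t := by
      have h2 := a.2.2
      rcases hau with ⟨h1, h3⟩ | ⟨h1, h3⟩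
      · refine ⟨((a.2 : ℕ) + 1 : ℕ), ?_, ?_⟩
        · rw [abs_of_nonneg (by positivity)]; omega
        · rw [← h3, ← h1]; push_cast; ring
      · refine ⟨-((a.2 : ℕ) + 1 : ℕ), ?_, ?_⟩
        · rw [abs_neg, abs_of_nonneg (by positivity)]; omega
        · rw [← h3, ← h1]; push_cast; ring
    refine ⟨insert y U, Finset.insert_subset hyC hUs, Finset.mem_insert_of_mem heU,
      by rw [Finset.card_insert_of_notMem hyU, hUc], ?_, ?_⟩
    · intro z hz
      rw [Finset.mem_insert] at hz
      rcases hz with rfl | hz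
      · obtain ⟨t, ht, rfl⟩ := hdiff
        obtain ⟨t', ht', rfl⟩ := hwin u hu
        refine ⟨t' + t, ?_, by push_cast; ring⟩
        refine (abs_add_le _ _).trans ?_
        push_cast at ht' ⊢
        linarith [mul_add (ℓ : ℤ) j 1]
      · obtain ⟨t, ht, rfl⟩ := hwin z hz
        refine ⟨t, ht.trans ?_, rfl⟩
        exact_mod_cast Nat.mul_le_mul_left ℓ (by omega : j ≤ j + 1)
    · have : (placements C (insert y U)).card ≤ (placements C U ×ˢ nearSet n ℓ).card := by
        refine Finset.card_le_card_of_injOn (fun f => (fun x => if x ∈ U then f x else 0,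
          f y - f u)) ?_ ?_
        · intro f hf
          obtain ⟨hf1, hf2⟩ := mem_placements.1 hf
          simp only [Finset.coe_product, Set.mem_prod, Finset.mem_coe]
          constructor
          · refine mem_placements.2 ⟨fun x hx => by simp [hx], fun b hb h1 h2 => ?_⟩
            rw [if_pos h1, if_pos h2]
            exact hf2 b hb (Finset.mem_insert_of_mem h1) (Finset.mem_insert_of_mem h2)
          · rcases hau with ⟨h1, h3⟩ | ⟨h1, h3⟩
            · have := hf2 a ha (h1 ▸ Finset.mem_insert_of_mem hu)
                (h3 ▸ Finset.mem_insert_self _ _)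
              rwa [h1, ← h1, h3, h1] at this
            · have := hf2 a ha (h1 ▸ Finset.mem_insert_self _ _)
                (h3 ▸ Finset.mem_insert_of_mem hu)
              rw [h3, h1] at this
              have := neg_mem_nearSet this
              rwa [neg_sub] at this
        · intro f hf g hg h
          have hf := (mem_placements.1 hf).1
          have hg := (mem_placements.1 hg).1
          have h1 := congrArg Prod.fst h
          have h2 : f y - f u = g y - g u := congrArg Prod.snd h
          have hU : ∀ x ∈ U, f x = g x := fun x hx => by
            have := congrFun h1 x
            simpa [hx] using this
          funext x
          by_cases hx : x ∈ U
          · exact hU x hx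
          by_cases hxy : x = y
          · rw [hxy]
            rw [hU u hu] at h2
            exact sub_left_injective h2
          · have : x ∉ insert y U := by simp [hx, hxy]
            rw [hf x this, hg x this]
      rw [Finset.card_product] at this
      calc _ ≤ _ := this
        _ ≤ (n * (2 * ℓ) ^ j) * (2 * ℓ) := Nat.mul_le_mul hN card_nearSet_le
        _ = _ := by ring

lemma EdgeConn.growth_full {e : ZMod n × Fin ℓ} {C : Finset (ZMod n × Fin ℓ)}
    (hC : EdgeConn e C) {v : ℕ} (hv : (edgeVerts C).card = v) :
    (∀ u ∈ edgeVerts C, ∃ t : ℤ, |t| ≤ (ℓ * v : ℕ) ∧ u = e.1 + t) ∧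
      (placements C (edgeVerts C)).card ≤ n * (2 * ℓ) ^ (v - 1) := by
  have hpos : 0 < (edgeVerts C).card := Finset.card_pos.2 ⟨_, fst_mem_edgeVerts hC.1⟩
  obtain ⟨U, hU, -, hc, hw, hN⟩ := hC.exists_growth (v - 1) (by omega)
  have : U = edgeVerts C := Finset.eq_of_subset_of_card_le hU (by omega)
  subst this
  refine ⟨fun u hu => ?_, hN⟩
  obtain ⟨t, ht, h⟩ := hw u hu
  refine ⟨t, ht.trans ?_, h⟩
  exact_mod_cast Nat.mul_le_mul_left ℓ (by omega)

open Classical in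
/-- The number of connected edge sets through a given edge with `v` vertices. -/
lemma card_edgeConn_le (e : ZMod n × Fin ℓ) (v : ℕ) (hv : 1 ≤ v) (hℓ : 1 ≤ ℓ) :
    ((Finset.univ : Finset (Finset (ZMod n × Fin ℓ))).filter
      fun C => EdgeConn e C ∧ (edgeVerts C).card = v).card ≤ (2 ^ (3 * ℓ ^ 2)) ^ v := by
  set W : Finset (ZMod n × Fin ℓ) :=
    ((Finset.Icc (-((ℓ * v : ℕ) : ℤ)) (ℓ * v : ℕ)).image (fun t : ℤ => e.1 + (t : ZMod n))) ×ˢ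
      Finset.univ with hW
  have hWc : W.card ≤ 3 * ℓ ^ 2 * v := by
    rw [hW, Finset.card_product, Finset.card_univ, Fintype.card_fin]
    have h1 := Finset.card_image_le (s := Finset.Icc (-((ℓ * v : ℕ) : ℤ)) (ℓ * v : ℕ))
      (f := fun t : ℤ => e.1 + (t : ZMod n))
    have h2 : (Finset.Icc (-((ℓ * v : ℕ) : ℤ)) (ℓ * v : ℕ)).card = 2 * (ℓ * v) + 1 := by
      rw [Int.card_Icc]; omega
    have h3 : 1 ≤ ℓ * v := Nat.mul_pos hℓ hv
    calc _ ≤ (3 * (ℓ * v)) * ℓ := Nat.mul_le_mul_right _ (by omega)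
      _ = _ := by ring
  rw [← pow_mul]
  refine le_trans ?_ (Nat.pow_le_pow_right (by norm_num) hWc)
  rw [← Finset.card_powerset]
  refine Finset.card_le_card fun C hC => ?_
  rw [Finset.mem_filter] at hC
  rw [Finset.mem_powerset]
  intro a ha
  obtain ⟨t, ht, h⟩ := (hC.2.1.growth_full hC.2.2).1 _ (fst_mem_edgeVerts ha)
  rw [hW, Finset.mem_product]
  refine ⟨Finset.mem_image.2 ⟨t, ?_, h.symm⟩, Finset.mem_univ _⟩
  rw [Finset.mem_Icc]
  exact abs_le.1 ht

/-- A set of few edges has an initial and a final vertex, which improves the trivial bound. -/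
lemma card_le_of_edgeVerts_small {C : Finset (ZMod n × Fin ℓ)} {v : ℕ}
    (hv : (edgeVerts C).card = v) (hv2 : 2 ≤ v) (hn : ℓ * v < n) :
    C.card ≤ ℓ * (v - 2) + 1 := by
  classical
  set U := edgeVerts C with hU
  have hUne : U.Nonempty := Finset.card_pos.1 (by omega)
  have hx0 : ∃ x₀ ∈ U, ∀ d : Fin ℓ, x₀ + ((d : ℕ) + 1 : ℕ) ∉ U := by
    by_contra hcon
    push Not at hcon
    rcases Nat.eq_zero_or_pos ℓ with h0 | hpos
    · subst h0
      obtain ⟨x, hx⟩ := hUne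
      obtain ⟨d, _⟩ := hcon x hx
      exact d.elim0
    set Y := (U ×ˢ (Finset.univ : Finset (Fin ℓ))).image fun a => a.1 + ((a.2 : ℕ) : ZMod n)
      with hY
    have hYc : Y.card ≤ ℓ * v := by
      refine Finset.card_image_le.trans ?_
      rw [Finset.card_product, hv, Finset.card_univ, Fintype.card_fin, mul_comm]
    have hstep : ∀ y ∈ Y, y + 1 ∈ Y := by
      intro y hy
      obtain ⟨⟨u, d⟩, hud, rfl⟩ := Finset.mem_image.1 hy
      have hu : u ∈ U := (Finset.mem_product.1 hud).1
      by_cases hd : (d : ℕ) + 1 < ℓ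
      · refine Finset.mem_image.2 ⟨(u, ⟨d + 1, hd⟩), by simpa using hu, ?_⟩
        push_cast; ring
      · obtain ⟨d', hd'⟩ := hcon u hu
        have h1 := d.2
        have h2 := d'.2
        refine Finset.mem_image.2 ⟨(_, ⟨ℓ - (d' + 1), by omega⟩),
          Finset.mem_product.2 ⟨hd', Finset.mem_univ _⟩, ?_⟩
        have h3 : (d : ℕ) + 1 = ℓ := by omega
        have h4 : ((d' : ℕ) + 1) + (ℓ - (d' + 1)) = d + 1 := by omega
        simp only [add_assoc]
        congr 1
        exact_mod_cast congrArg (Nat.cast (R := ZMod n)) h4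
    obtain ⟨x, hx⟩ := hUne
    have hxY : x ∈ Y := Finset.mem_image.2 ⟨(x, ⟨0, hpos⟩), by simpa using hx, by simp⟩
    have hall : ∀ t : ℕ, x + t ∈ Y := by
      intro t
      induction t with
      | zero => simpa using hxY
      | succ t ih => have := hstep _ ih; push_cast; rwa [← add_assoc]
    have huniv : Y = Finset.univ := by
      refine Finset.eq_univ_of_forall fun z => ?_
      have := hall (z - x).val
      rwa [ZMod.natCast_zmod_val, add_sub_cancel] at this
    have : Y.card = n := by rw [huniv, Finset.card_univ, ZMod.card]
    omega
  obtain ⟨x₀, hx₀, hfin⟩ := hx0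
  obtain ⟨z, hz, hzx⟩ := Finset.exists_mem_ne (by omega : 1 < U.card) x₀
  have hex : ∃ t : ℕ, 1 ≤ t ∧ x₀ - t ∈ U := by
    refine ⟨(x₀ - z).val, ?_, ?_⟩
    · rw [Nat.one_le_iff_ne_zero, Ne, ZMod.val_eq_zero, sub_eq_zero]
      exact fun h => hzx h.symm
    · rwa [ZMod.natCast_zmod_val, sub_sub_cancel]
  set t := Nat.find hex with ht
  obtain ⟨ht1, htU⟩ := Nat.find_spec hex
  have htmin : ∀ s : ℕ, 1 ≤ s → x₀ - (s : ZMod n) ∈ U → t ≤ s :=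
    fun s h1 h2 => Nat.find_min' hex ⟨h1, h2⟩
  rw [← ht] at ht1 htU
  set x₁ := x₀ - (t : ZMod n) with hx₁
  have htn : t < n := by
    have h1 := htmin (x₀ - z).val (by
      rw [Nat.one_le_iff_ne_zero, Ne, ZMod.val_eq_zero, sub_eq_zero]
      exact fun h => hzx h.symm) (by rwa [ZMod.natCast_zmod_val, sub_sub_cancel])
    exact h1.trans_lt (ZMod.val_lt _)
  have hne : x₁ ≠ x₀ := by
    intro h
    rw [hx₁, sub_eq_self] at h
    rw [ZMod.natCast_eq_zero_iff] at h
    exact absurd (Nat.le_of_dvd ht1 h) (not_le.2 htn)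
  have hx1 : ∀ d : Fin ℓ, x₁ + ((d : ℕ) + 1 : ℕ) ∈ U → (d : ℕ) + 1 = t := by
    intro d hd
    by_contra hdt
    rcases lt_or_gt_of_ne hdt with h | h
    · have := htmin (t - (d + 1)) (by omega) (by
        rw [Nat.cast_sub h.le, ← sub_add]; exact hd)
      omega
    · refine hfin ⟨d + 1 - t - 1, by have := d.2; omega⟩ ?_
      convert hd using 1
      have : d + 1 - t - 1 + 1 = (d : ℕ) + 1 - t := by omega
      simp only [this]
      rw [Nat.cast_sub h.le, hx₁]
      ring
  have hcard : C.card = ∑ x ∈ U, (C.filter fun a => a.1 = x).card :=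
    Finset.card_eq_sum_card_fiberwise fun a ha => fst_mem_edgeVerts ha
  have hfib : ∀ x, (C.filter fun a => a.1 = x).card ≤ ℓ := by
    intro x
    have : (C.filter fun a => a.1 = x).card ≤ (Finset.univ : Finset (Fin ℓ)).card := by
      refine Finset.card_le_card_of_injOn (fun a => a.2) (fun _ _ => Finset.mem_univ _) ?_
      intro a ha b hb h
      simp only [Finset.coe_filter, Set.mem_ofPred_eq] at ha hb
      exact Prod.ext (ha.2.trans hb.2.symm) h
    simpa using this
  have hfib0 : (C.filter fun a => a.1 = x₀).card = 0 := by
    rw [Finset.card_eq_zero, Finset.filter_eq_empty_iff]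
    intro a ha h
    exact hfin a.2 (h ▸ snd_mem_edgeVerts ha)
  have hfib1 : (C.filter fun a => a.1 = x₁).card ≤ 1 := by
    rw [Finset.card_le_one]
    intro a ha b hb
    simp only [Finset.mem_filter] at ha hb
    have h1 := hx1 a.2 (ha.2 ▸ snd_mem_edgeVerts ha.1)
    have h2 := hx1 b.2 (hb.2 ▸ snd_mem_edgeVerts hb.1)
    exact Prod.ext (ha.2.trans hb.2.symm) (Fin.ext (by omega))
  have hx₁' : x₁ ∈ U.erase x₀ := Finset.mem_erase.2 ⟨hne, htU⟩
  rw [hcard, ← Finset.add_sum_erase _ _ hx₀, ← Finset.add_sum_erase _ _ hx₁', hfib0]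
  have h3 : ∑ x ∈ (U.erase x₀).erase x₁, (C.filter fun a => a.1 = x).card ≤
      ((U.erase x₀).erase x₁).card • ℓ := Finset.sum_le_card_nsmul _ _ _ fun x _ => hfib x
  rw [Finset.card_erase_of_mem hx₁', Finset.card_erase_of_mem hx₀, hv, smul_eq_mul, mul_comm] at h3
  have : v - 1 - 1 = v - 2 := by omega
  rw [this] at h3
  omega

end Components

section SpreadRecursion

variable {n ℓ : ℕ} [NeZero n]

/-- Upper bound for the probability that all edges of `C` are mapped to near pairs. -/
noncomputable def placeWeight (K : ℝ) (C : Finset (ZMod n × Fin ℓ)) : ℝ :=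
  (placements C (edgeVerts C)).card * (K / n) ^ (edgeVerts C).card

lemma placeWeight_nonneg {K : ℝ} (hK : 0 ≤ K) (C : Finset (ZMod n × Fin ℓ)) :
    0 ≤ placeWeight K C := by
  unfold placeWeight; positivity

lemma placeWeight_empty (K : ℝ) : placeWeight K (∅ : Finset (ZMod n × Fin ℓ)) = 1 := by
  have h : edgeVerts (∅ : Finset (ZMod n × Fin ℓ)) = ∅ := by simp [edgeVerts]
  have h2 : placements (∅ : Finset (ZMod n × Fin ℓ)) ∅ = {fun _ => 0} := by
    ext f
    simp [mem_placements, funext_iff]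
  simp [placeWeight, h, h2]

open Classical in
lemma sum_forall_near_le {Ω : Type*} [Fintype Ω] (w : Ω → ℝ) (hw : ∀ ω, 0 ≤ w ω)
    (σ : Ω → ZMod n → ZMod n) {K : ℝ}
    (hσ : ∀ (X : Finset (ZMod n)) (g : ZMod n → ZMod n),
      ∑ ω, w ω * (if ∀ x ∈ X, σ ω x = g x then 1 else 0) ≤ (K / n) ^ X.card)
    (I : Finset (ZMod n × Fin ℓ)) :
    ∑ ω, w ω * (if ∀ a ∈ I, σ ω (a.1 + ((a.2 : ℕ) + 1 : ℕ)) - σ ω a.1 ∈ nearSet n ℓ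
      then 1 else 0) ≤ placeWeight K I := by
  calc _ ≤ ∑ ω, ∑ f ∈ placements I (edgeVerts I),
        w ω * (if ∀ x ∈ edgeVerts I, σ ω x = f x then 1 else 0) := by
        refine Finset.sum_le_sum fun ω _ => ?_
        rw [← Finset.mul_sum]
        refine mul_le_mul_of_nonneg_left ?_ (hw ω)
        have hnn : ∀ f ∈ placements I (edgeVerts I),
            (0 : ℝ) ≤ if ∀ x ∈ edgeVerts I, σ ω x = f x then 1 else 0 := fun f _ => by
          split_ifs <;> norm_num
        split_ifs with h
        swap
        · exact Finset.sum_nonneg hnn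
        set f : ZMod n → ZMod n := fun x => if x ∈ edgeVerts I then σ ω x else 0 with hf
        have hfm : f ∈ placements I (edgeVerts I) := by
          refine mem_placements.2 ⟨fun x hx => by simp [hf, hx], fun a ha h1 h2 => ?_⟩
          simp only [hf, if_pos h1, if_pos h2]
          exact h a ha
        refine le_trans (le_of_eq ?_) (Finset.single_le_sum hnn hfm)
        rw [if_pos fun x hx => by simp [hf, hx]]
    _ = ∑ f ∈ placements I (edgeVerts I), ∑ ω,
        w ω * (if ∀ x ∈ edgeVerts I, σ ω x = f x then 1 else 0) := Finset.sum_comm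
    _ ≤ ∑ f ∈ placements I (edgeVerts I), (K / n) ^ (edgeVerts I).card :=
        Finset.sum_le_sum fun f _ => hσ _ f
    _ = _ := by rw [Finset.sum_const, nsmul_eq_mul, placeWeight]

lemma placeWeight_le_mul {K : ℝ} (hK : 0 ≤ K) {I C : Finset (ZMod n × Fin ℓ)} (hCI : C ⊆ I)
    (hC : EdgeClosed I C) : placeWeight K I ≤ placeWeight K C * placeWeight K (I \ C) := by
  classical
  have hdis : Disjoint (edgeVerts C) (edgeVerts (I \ C)) := by
    rw [Finset.disjoint_left]
    intro y hy hy'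
    obtain ⟨a, ha, h⟩ := mem_edgeVerts.1 hy'
    rw [Finset.mem_sdiff] at ha
    refine ha.2 (hC a ha.1 ?_)
    rcases h with rfl | rfl
    · exact Or.inl hy
    · exact Or.inr hy
  have hun : edgeVerts I = edgeVerts C ∪ edgeVerts (I \ C) := by
    ext y
    simp only [Finset.mem_union, mem_edgeVerts]
    constructor
    · rintro ⟨a, ha, h⟩
      by_cases haC : a ∈ C
      · exact Or.inl ⟨a, haC, h⟩
      · exact Or.inr ⟨a, Finset.mem_sdiff.2 ⟨ha, haC⟩, h⟩
    · rintro (⟨a, ha, h⟩ | ⟨a, ha, h⟩)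
      · exact ⟨a, hCI ha, h⟩
      · exact ⟨a, (Finset.mem_sdiff.1 ha).1, h⟩
  have hcard : (placements I (edgeVerts I)).card ≤
      (placements C (edgeVerts C)).card * (placements (I \ C) (edgeVerts (I \ C))).card := by
    rw [← Finset.card_product]
    have hrestr : ∀ J ⊆ I, ∀ f ∈ placements I (edgeVerts I),
        (fun x => if x ∈ edgeVerts J then f x else 0) ∈ placements J (edgeVerts J) := by
      intro J hJ f hf
      refine mem_placements.2 ⟨fun x hx => by simp [hx], fun a ha h1 h2 => ?_⟩
      rw [if_pos h1, if_pos h2]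
      exact (mem_placements.1 hf).2 a (hJ ha) (edgeVerts_mono hJ h1) (edgeVerts_mono hJ h2)
    refine Finset.card_le_card_of_injOn (fun f => (fun x => if x ∈ edgeVerts C then f x else 0,
      fun x => if x ∈ edgeVerts (I \ C) then f x else 0)) ?_ ?_
    · intro f hf
      exact Finset.mem_coe.2 (Finset.mem_product.2
        ⟨hrestr C hCI f hf, hrestr _ Finset.sdiff_subset f hf⟩)
    · intro f hf g hg h
      have h1 := congrArg Prod.fst h
      have h2 := congrArg Prod.snd h
      funext x
      by_cases hx : x ∈ edgeVerts I
      · rw [hun, Finset.mem_union] at hx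
        rcases hx with hx | hx
        · simpa [hx] using congrFun h1 x
        · simpa [hx] using congrFun h2 x
      · rw [(mem_placements.1 hf).1 x hx, (mem_placements.1 hg).1 x hx]
  unfold placeWeight
  rw [hun, Finset.card_union_of_disjoint hdis, ← hun, pow_add]
  have h1 : ((placements I (edgeVerts I)).card : ℝ) ≤
      (placements C (edgeVerts C)).card * (placements (I \ C) (edgeVerts (I \ C))).card := by
    exact_mod_cast hcard
  calc _ ≤ ((placements C (edgeVerts C)).card *
        (placements (I \ C) (edgeVerts (I \ C))).card : ℝ) *
        ((K / n) ^ (edgeVerts C).card * (K / n) ^ (edgeVerts (I \ C)).card) :=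
        mul_le_mul_of_nonneg_right h1 (by positivity)
    _ = _ := by ring

open Classical in
lemma sum_powerset_placeWeight_le {K q η : ℝ} (hK : 0 ≤ K) (hq : 0 ≤ q) (hη : 0 ≤ η)
    (H : ∀ e : ZMod n × Fin ℓ, ∑ C ∈ (Finset.univ : Finset (Finset (ZMod n × Fin ℓ))).filter
      (EdgeConn e), q ^ C.card * placeWeight K C ≤ η)
    (A : Finset (ZMod n × Fin ℓ)) :
    ∑ I ∈ A.powerset, q ^ I.card * placeWeight K I ≤ (1 + η) ^ A.card := by
  induction A using Finset.induction_on with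
  | empty => simp [placeWeight_empty]
  | insert e A he ih =>
    set g : Finset (ZMod n × Fin ℓ) → ℝ := fun I => q ^ I.card * placeWeight K I with hg
    have hg0 : ∀ I, 0 ≤ g I := fun I => mul_nonneg (by positivity) (placeWeight_nonneg hK I)
    have hcomp : ∀ I : Finset (ZMod n × Fin ℓ), ∃ C ⊆ insert e I,
        EdgeConn e C ∧ EdgeClosed (insert e I) C := fun I =>
      exists_component e (insert e I) (Finset.mem_insert_self _ _)
    choose C hCs hCc hCcl using hcomp
    have hgmul : ∀ I, g (insert e I) ≤ g (C I) * g (insert e I \ C I) := by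
      intro I
      have h1 := placeWeight_le_mul hK (hCs I) (hCcl I)
      have h2 : (insert e I).card = (C I).card + (insert e I \ C I).card := by
        rw [Finset.card_sdiff_of_subset (hCs I)]
        have := Finset.card_le_card (hCs I)
        omega
      simp only [hg]
      rw [h2, pow_add]
      calc _ ≤ q ^ (C I).card * q ^ (insert e I \ C I).card *
            (placeWeight K (C I) * placeWeight K (insert e I \ C I)) :=
            mul_le_mul_of_nonneg_left h1 (by positivity)
        _ = _ := by ring
    have hsecond : ∑ I ∈ A.powerset, g (insert e I) ≤ η * ∑ I ∈ A.powerset, g I := by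
      calc _ ≤ ∑ I ∈ A.powerset, g (C I) * g (insert e I \ C I) :=
            Finset.sum_le_sum fun I _ => hgmul I
        _ = ∑ x ∈ A.powerset.image (fun I => (C I, insert e I \ C I)), g x.1 * g x.2 := by
            rw [Finset.sum_image]
            intro I hI J hJ h
            have h1 : C I = C J := congrArg Prod.fst h
            have h2 : insert e I \ C I = insert e J \ C J := congrArg Prod.snd h
            have heI : e ∉ I := fun h => he (Finset.mem_powerset.1 hI h)
            have heJ : e ∉ J := fun h => he (Finset.mem_powerset.1 hJ h)
            rw [← Finset.erase_insert heI, ← Finset.erase_insert heJ,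
              ← Finset.union_sdiff_of_subset (hCs I), ← Finset.union_sdiff_of_subset (hCs J),
              h1, ← h2, h1]
        _ ≤ ∑ x ∈ (Finset.univ.filter (EdgeConn e)) ×ˢ A.powerset, g x.1 * g x.2 := by
            refine Finset.sum_le_sum_of_subset_of_nonneg ?_
              fun x _ _ => mul_nonneg (hg0 _) (hg0 _)
            intro x hx
            obtain ⟨I, hI, rfl⟩ := Finset.mem_image.1 hx
            rw [Finset.mem_product, Finset.mem_filter, Finset.mem_powerset]
            refine ⟨⟨Finset.mem_univ _, hCc I⟩, fun a ha => ?_⟩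
            rw [Finset.mem_sdiff, Finset.mem_insert] at ha
            rcases ha.1 with rfl | h
            · exact absurd (hCc I).1 ha.2
            · exact Finset.mem_powerset.1 hI h
        _ = (∑ D ∈ Finset.univ.filter (EdgeConn e), g D) * ∑ I ∈ A.powerset, g I := by
            rw [Finset.sum_product, Finset.sum_mul_sum]
        _ ≤ _ := mul_le_mul_of_nonneg_right (H e) (Finset.sum_nonneg fun I _ => hg0 I)
    rw [Finset.sum_powerset_insert he, Finset.card_insert_of_notMem he, pow_succ]
    calc _ ≤ (∑ I ∈ A.powerset, g I) + η * ∑ I ∈ A.powerset, g I := add_le_add le_rfl hsecond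
      _ = (∑ I ∈ A.powerset, g I) * (1 + η) := by ring
      _ ≤ _ := mul_le_mul_of_nonneg_right ih (by linarith)

open Classical in
lemma sum_edgeConn_placeWeight_le (hℓ : 1 ≤ ℓ) (hn : ℓ < n) {K q B r : ℝ} (hK : 0 ≤ K)
    (hq : 1 ≤ q) (hB : B = 2 ^ (3 * ℓ ^ 2) * (2 * ℓ) * K) (hr : r = B * q ^ ℓ / n)
    (hr4 : r ≤ 1 / 4) (e : ZMod n × Fin ℓ) :
    ∑ C ∈ (Finset.univ : Finset (Finset (ZMod n × Fin ℓ))).filter (EdgeConn e),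
      q ^ C.card * placeWeight K C ≤ 2 * (B ^ 2 * q + ℓ ^ 2) / n := by
  have hn0 : (0 : ℝ) < n := by exact_mod_cast (by omega : 0 < n)
  have hB0 : 0 ≤ B := by rw [hB]; positivity
  have hr0 : 0 ≤ r := by rw [hr]; positivity
  have hV2 : ∀ C, EdgeConn e C → 2 ≤ (edgeVerts C).card := by
    intro C hC
    refine Finset.one_lt_card.2 ⟨_, fst_mem_edgeVerts hC.1, _, snd_mem_edgeVerts hC.1, ?_⟩
    intro h
    rw [eq_comm, add_eq_left, ZMod.natCast_eq_zero_iff] at h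
    have := Nat.le_of_dvd (by omega) h
    have := e.2.2
    omega
  rw [← Finset.sum_fiberwise_of_maps_to (t := Finset.Ico 2 (n + 1))
    (g := fun C => (edgeVerts C).card) (by
      intro C hC
      rw [Finset.mem_filter] at hC
      rw [Finset.mem_Ico]
      refine ⟨hV2 C hC.2, ?_⟩
      have := Finset.card_le_univ (edgeVerts C)
      rw [ZMod.card] at this
      omega)]
  have hterm : ∀ v ∈ Finset.Ico 2 (n + 1),
      ∑ C ∈ (Finset.univ.filter (EdgeConn e)).filter (fun C => (edgeVerts C).card = v),
        q ^ C.card * placeWeight K C ≤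
      (B ^ 2 * q + ℓ ^ 2) / n * (1 / 2) ^ (v - 2) := by
    intro v hv
    rw [Finset.mem_Ico] at hv
    obtain ⟨j, rfl⟩ := Nat.exists_eq_add_of_le hv.1
    set v := 2 + j with hvj
    set E : ℕ := if ℓ * v < n then ℓ * j + 1 else ℓ * v with hE
    have hone : ∀ C ∈ (Finset.univ.filter (EdgeConn e)).filter
        (fun C => (edgeVerts C).card = v), q ^ C.card * placeWeight K C ≤
        q ^ E * (n * (2 * ℓ) ^ v * (K / n) ^ v) := by
      intro C hC
      simp only [Finset.mem_filter, Finset.mem_univ, true_and] at hC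
      obtain ⟨hC, hCv⟩ := hC
      refine mul_le_mul (pow_le_pow_right₀ hq ?_) ?_ (placeWeight_nonneg hK C) (by positivity)
      · rw [hE]
        split_ifs with h
        · have := card_le_of_edgeVerts_small hCv hv.1 h
          rwa [hvj, Nat.add_sub_cancel_left] at this
        · rw [← hCv]; exact card_le_mul_edgeVerts C
      · rw [placeWeight, hCv]
        refine mul_le_mul_of_nonneg_right ?_ (by positivity)
        have h1 : (placements C (edgeVerts C)).card ≤ n * (2 * ℓ) ^ v :=
          ((hC.growth_full hCv).2).trans
            (Nat.mul_le_mul_left _ (Nat.pow_le_pow_right (by omega) (by omega)))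
        exact_mod_cast h1
    refine (Finset.sum_le_card_nsmul _ _ _ hone).trans ?_
    rw [nsmul_eq_mul]
    have hcount : ((((Finset.univ.filter (EdgeConn e)).filter
        (fun C => (edgeVerts C).card = v)).card : ℕ) : ℝ) ≤ (2 ^ (3 * ℓ ^ 2)) ^ v := by
      have := card_edgeConn_le e v (by omega) hℓ
      rw [Finset.filter_filter]
      exact_mod_cast this
    refine (mul_le_mul_of_nonneg_right hcount (by positivity)).trans ?_
    have hBn : (2 ^ (3 * ℓ ^ 2) : ℝ) ^ v * (q ^ E * (n * (2 * ℓ) ^ v * (K / n) ^ v)) =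
        n * (B / n) ^ v * q ^ E := by
      rw [hB, mul_div_assoc, mul_pow, mul_pow]; ring
    rw [hBn, hvj, Nat.add_sub_cancel_left]
    have hrj : r ^ j ≤ (1 / 2) ^ j := pow_le_pow_left₀ hr0 (by linarith) j
    by_cases hcase : ℓ * v < n
    · rw [hE, if_pos hcase]
      have : n * (B / n) ^ (2 + j) * q ^ (ℓ * j + 1) = B ^ 2 * q / n * r ^ j := by
        rw [hr, pow_add, pow_add, pow_mul, div_pow, div_pow, div_pow, mul_pow]
        field_simp
      rw [this]
      refine mul_le_mul ?_ hrj (by positivity) (by positivity)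
      exact div_le_div_of_nonneg_right (by nlinarith [sq_nonneg (ℓ : ℝ)]) hn0.le
    · rw [hE, if_neg hcase]
      have h1 : n * (B / n) ^ (2 + j) * q ^ (ℓ * (2 + j)) = n * r ^ (2 + j) := by
        rw [hr, pow_mul, div_pow, div_pow, mul_pow]
        ring
      rw [h1]
      have hv2 : ∀ j : ℕ, (2 + j) ^ 2 ≤ 8 * 2 ^ j := by
        intro j
        induction j with
        | zero => norm_num
        | succ j ih =>
          rw [pow_succ 2 j]
          rcases Nat.lt_or_ge j 1 with h | h
          · interval_cases j; norm_num
          · nlinarith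
      have hv2' : ((2 + j : ℕ) : ℝ) ^ 2 ≤ 8 * 2 ^ j := by exact_mod_cast hv2 j
      have hnv : (n : ℝ) ≤ ℓ * (2 + j : ℕ) := by exact_mod_cast not_lt.1 hcase
      have hnn : (n : ℝ) * n ≤ ℓ ^ 2 * (8 * 2 ^ j) := by
        calc (n : ℝ) * n ≤ (ℓ * (2 + j : ℕ)) * (ℓ * (2 + j : ℕ)) :=
              mul_le_mul hnv hnv hn0.le (by positivity)
          _ = ℓ ^ 2 * ((2 + j : ℕ) : ℝ) ^ 2 := by ring
          _ ≤ _ := mul_le_mul_of_nonneg_left hv2' (by positivity)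
      have h4 : r ^ (2 + j) ≤ (1 / 16) * ((1 / 2) ^ j * (1 / 2) ^ j) := by
        rw [pow_add, ← mul_pow]
        refine mul_le_mul ?_ (pow_le_pow_left₀ hr0 (by linarith) j) (by positivity) (by norm_num)
        nlinarith
      have h5 : (n : ℝ) * r ^ (2 + j) * n ≤ (B ^ 2 * q + ℓ ^ 2) * (1 / 2) ^ j := by
        calc (n : ℝ) * r ^ (2 + j) * n = n * n * r ^ (2 + j) := by ring
          _ ≤ ℓ ^ 2 * (8 * 2 ^ j) * ((1 / 16) * ((1 / 2) ^ j * (1 / 2) ^ j)) :=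
              mul_le_mul hnn h4 (by positivity) (by positivity)
          _ = (2 * (1 / 2)) ^ j * (ℓ ^ 2 / 2 * (1 / 2) ^ j) := by rw [mul_pow]; ring
          _ = ℓ ^ 2 / 2 * (1 / 2) ^ j := by norm_num
          _ ≤ _ := mul_le_mul_of_nonneg_right (by
              have : 0 ≤ B ^ 2 * q := by positivity
              nlinarith [sq_nonneg (ℓ : ℝ)]) (by positivity)
      rw [div_mul_eq_mul_div, le_div_iff₀ hn0]
      exact h5
  refine (Finset.sum_le_sum hterm).trans ?_
  rw [← Finset.mul_sum, Finset.sum_Ico_eq_sum_range]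
  have hgeo : ∑ j ∈ Finset.range (n + 1 - 2), (1 / 2 : ℝ) ^ (2 + j - 2) ≤ 2 := by
    have : ∀ j, 2 + j - 2 = j := fun j => by omega
    simp only [this]
    have := sum_geometric_two_le (n + 1 - 2)
    simpa using this
  calc _ ≤ (B ^ 2 * q + ℓ ^ 2) / n * 2 := mul_le_mul_of_nonneg_left hgeo (by positivity)
    _ = _ := by ring

open Classical in
/-- Exponential moment bound for the number of edges mapped to near pairs by a spread random
map. -/
theorem sum_pow_card_near_le (hℓ : 1 ≤ ℓ) (hn : ℓ < n) {Ω : Type*} [Fintype Ω] (w : Ω → ℝ)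
    (hw : ∀ ω, 0 ≤ w ω) (σ : Ω → ZMod n → ZMod n) {K q B : ℝ} (hK : 0 ≤ K) (hq : 1 ≤ q)
    (hσ : ∀ (X : Finset (ZMod n)) (g : ZMod n → ZMod n),
      ∑ ω, w ω * (if ∀ x ∈ X, σ ω x = g x then 1 else 0) ≤ (K / n) ^ X.card)
    (hB : B = 2 ^ (3 * ℓ ^ 2) * (2 * ℓ) * K) (hr4 : B * q ^ ℓ / n ≤ 1 / 4)
    (A : Finset (ZMod n × Fin ℓ)) :
    ∑ ω, w ω * (1 + q) ^ (A.filter fun a =>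
      σ ω (a.1 + ((a.2 : ℕ) + 1 : ℕ)) - σ ω a.1 ∈ nearSet n ℓ).card ≤
      (1 + 2 * (B ^ 2 * q + ℓ ^ 2) / n) ^ A.card := by
  refine le_trans ?_ (sum_powerset_placeWeight_le hK (by linarith : 0 ≤ q) (by positivity)
    (sum_edgeConn_placeWeight_le hℓ hn hK hq hB rfl hr4) A)
  calc _ = ∑ ω, w ω * ∑ I ∈ A.powerset, q ^ I.card * (if ∀ a ∈ I,
        σ ω (a.1 + ((a.2 : ℕ) + 1 : ℕ)) - σ ω a.1 ∈ nearSet n ℓ then 1 else 0) := by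
        refine Finset.sum_congr rfl fun ω _ => ?_
        congr 1
        have := sum_powerset_pow_filter_subset A (A.filter fun a =>
          σ ω (a.1 + ((a.2 : ℕ) + 1 : ℕ)) - σ ω a.1 ∈ nearSet n ℓ) q
        rw [Finset.inter_eq_right.2 (Finset.filter_subset _ _)] at this
        rw [← this]
        refine Finset.sum_congr rfl fun I hI => ?_
        have hiff : I ⊆ (A.filter fun a =>
            σ ω (a.1 + ((a.2 : ℕ) + 1 : ℕ)) - σ ω a.1 ∈ nearSet n ℓ) ↔
            ∀ a ∈ I, σ ω (a.1 + ((a.2 : ℕ) + 1 : ℕ)) - σ ω a.1 ∈ nearSet n ℓ :=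
          ⟨fun h a ha => (Finset.mem_filter.1 (h ha)).2,
            fun h a ha => Finset.mem_filter.2 ⟨Finset.mem_powerset.1 hI ha, h a ha⟩⟩
        by_cases h : I ⊆ (A.filter fun a =>
            σ ω (a.1 + ((a.2 : ℕ) + 1 : ℕ)) - σ ω a.1 ∈ nearSet n ℓ)
        · rw [if_pos h, if_pos (hiff.1 h), mul_one]
        · rw [if_neg h, if_neg (fun h' => h (hiff.2 h')), mul_zero]
    _ = ∑ I ∈ A.powerset, q ^ I.card * ∑ ω, w ω * (if ∀ a ∈ I,
        σ ω (a.1 + ((a.2 : ℕ) + 1 : ℕ)) - σ ω a.1 ∈ nearSet n ℓ then 1 else 0) := by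
        simp only [Finset.mul_sum]
        rw [Finset.sum_comm]
        exact Finset.sum_congr rfl fun _ _ => Finset.sum_congr rfl fun _ _ => by ring
    _ ≤ _ := Finset.sum_le_sum fun I _ =>
        mul_le_mul_of_nonneg_left (sum_forall_near_le w hw σ hσ I) (by positivity)

end SpreadRecursion

section SpreadEmbedding

/-- The edges of the `ℓ`-th power of the cycle traced by `φ`. -/
noncomputable def powEdges {n : ℕ} {V : Type*} [DecidableEq V] (ℓ : ℕ) [NeZero n]
    (φ : ZMod n ≃ V) : Finset (Finset V) :=
  (Finset.univ : Finset (ZMod n × Fin ℓ)).image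
    fun a => {φ a.1, φ (a.1 + ((a.2 : ℕ) + 1 : ℕ))}

lemma mem_nearSet_of_pair_eq {n ℓ : ℕ} {x y i : ZMod n} {d : Fin ℓ}
    (h : (x = i ∧ y = i + ((d : ℕ) + 1 : ℕ)) ∨ (x = i + ((d : ℕ) + 1 : ℕ) ∧ y = i)) :
    y - x ∈ nearSet n ℓ := by
  rw [nearSet, Finset.mem_union, Finset.mem_image, Finset.mem_image]
  rcases h with ⟨rfl, rfl⟩ | ⟨rfl, rfl⟩
  · exact Or.inl ⟨d, Finset.mem_univ _, by simp⟩
  · exact Or.inr ⟨d, Finset.mem_univ _, by simp⟩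

open Classical in
lemma sum_pow_card_inter_powEdges_le {n ℓ : ℕ} [NeZero n] (hℓ : 1 ≤ ℓ) (hn : ℓ < n)
    {V Ω : Type*} [DecidableEq V] [Fintype Ω] (w : Ω → ℝ)
    (hw : ∀ ω, 0 ≤ w ω) (φ : Ω → ZMod n ≃ V) {K q B : ℝ} (hK : 0 ≤ K) (hq : 1 ≤ q)
    (hφ : ∀ (X : Finset V) (g : V → ZMod n),
      ∑ ω, w ω * (if ∀ x ∈ X, φ ω (g x) = x then 1 else 0) ≤ (K / n) ^ X.card)
    (hB : B = 2 ^ (3 * ℓ ^ 2) * (2 * ℓ) * K) (hr4 : B * q ^ ℓ / n ≤ 1 / 4)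
    (ω₀ : Ω) (A : Finset (Finset V)) (hA : A ⊆ powEdges ℓ (φ ω₀)) :
    ∑ ω, w ω * (1 + q) ^ (A ∩ powEdges ℓ (φ ω)).card ≤
      (1 + 2 * (B ^ 2 * q + ℓ ^ 2) / n) ^ A.card := by
  have hℓ0 : Nonempty (Fin ℓ) := ⟨⟨0, hℓ⟩⟩
  set edge : ZMod n × Fin ℓ → Finset V :=
    fun a => {φ ω₀ a.1, φ ω₀ (a.1 + ((a.2 : ℕ) + 1 : ℕ))} with hedge
  have hrep : ∀ e : Finset V, ∃ a, e ∈ A → edge a = e := by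
    intro e
    by_cases he : e ∈ A
    · obtain ⟨a, -, ha⟩ := Finset.mem_image.1 (hA he)
      exact ⟨a, fun _ => ha⟩
    · exact ⟨(0, hℓ0.some), fun h => absurd h he⟩
  choose rep hrep using hrep
  have hinj : Set.InjOn rep A := fun e he e' he' h => by
    rw [← hrep e he, ← hrep e' he', h]
  set σ : Ω → ZMod n → ZMod n := fun ω x => (φ ω).symm (φ ω₀ x) with hσ
  have hspread : ∀ (X : Finset (ZMod n)) (g : ZMod n → ZMod n),
      ∑ ω, w ω * (if ∀ x ∈ X, σ ω x = g x then 1 else 0) ≤ (K / n) ^ X.card := by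
    intro X g
    have := hφ (X.map (φ ω₀).toEmbedding) (fun v => g ((φ ω₀).symm v))
    rw [Finset.card_map] at this
    refine le_trans (le_of_eq (Finset.sum_congr rfl fun ω _ => ?_)) this
    congr 1
    refine if_congr ?_ rfl rfl
    simp only [Finset.mem_map, forall_exists_index, and_imp, hσ, Equiv.symm_apply_eq]
    constructor
    · rintro h _ x hx rfl
      simpa using (h x hx).symm
    · intro h x hx
      have := h _ x hx rfl
      simpa using this.symm
  have hmain := sum_pow_card_near_le hℓ hn w hw σ hK hq hspread hB hr4 (A.image rep)
  rw [Finset.card_image_of_injOn hinj] at hmain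
  refine le_trans (Finset.sum_le_sum fun ω _ => mul_le_mul_of_nonneg_left
    (pow_le_pow_right₀ (by linarith) ?_) (hw ω)) hmain
  refine Finset.card_le_card_of_injOn rep ?_ (hinj.mono (by simp))
  intro e he
  rw [Finset.mem_coe, Finset.mem_inter] at he
  rw [Finset.mem_coe, Finset.mem_filter]
  refine ⟨Finset.mem_image_of_mem _ he.1, ?_⟩
  obtain ⟨b, -, hb⟩ := Finset.mem_image.1 he.2
  have h2 := (hrep e he.1).trans hb.symm
  simp only [hedge, Finset.ext_iff, Finset.mem_insert, Finset.mem_singleton] at h2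
  set a := rep e
  refine mem_nearSet_of_pair_eq (i := b.1) (d := b.2) ?_
  simp only [hσ, Equiv.symm_apply_eq]
  have h3 := (h2 (φ ω₀ a.1)).1 (Or.inl rfl)
  have h4 := (h2 (φ ω₀ (a.1 + ((a.2 : ℕ) + 1 : ℕ)))).1 (Or.inr rfl)
  have h5 := (h2 (φ ω b.1)).2 (Or.inl rfl)
  have h6 := (h2 (φ ω (b.1 + ((b.2 : ℕ) + 1 : ℕ)))).2 (Or.inr rfl)
  have hne : a.1 ≠ a.1 + ((a.2 : ℕ) + 1 : ℕ) := by
    intro h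
    rw [eq_comm, add_eq_left, ZMod.natCast_eq_zero_iff] at h
    have := Nat.le_of_dvd (by omega) h
    have := a.2.2
    omega
  have hne' := (φ ω₀).injective.ne hne
  rcases h3 with h3 | h3 <;> rcases h4 with h4 | h4
  · exact absurd (h3.trans h4.symm) hne'
  · exact Or.inl ⟨h3, h4⟩
  · exact Or.inr ⟨h3, h4⟩
  · exact absurd (h3.trans h4.symm) hne'

set_option maxHeartbeats 2000000 in
/-- A spread probability measure on Hamilton cycles yields a power of a Hamilton cycle in the random
sparsification. -/
theorem sparsProb_powEdges_ge {ℓ : ℕ} (hℓ : 2 ≤ ℓ) {K ε : ℝ} (hK : 0 ≤ K) (hε : 0 < ε) :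
    ∃ C₀ : ℝ, ∃ n₀ : ℕ, ∀ n : ℕ, n₀ ≤ n → ∀ [NeZero n], ∀ p : ℝ, 0 < p → p ≤ 1 →
      C₀ ≤ p * (n : ℝ) ^ ((1 : ℝ) / ℓ) → ∀ (V Ω : Type) [DecidableEq V] [Fintype Ω]
      (w : Ω → ℝ) (φ : Ω → ZMod n ≃ V), (∀ ω, 0 ≤ w ω) → ∑ ω, w ω = 1 →
      (∀ (X : Finset V) (g : V → ZMod n),
        ∑ ω, w ω * (open Classical in if ∀ x ∈ X, φ ω (g x) = x then 1 else 0) ≤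
          (K / n) ^ X.card) →
      ∀ G : Finset (Finset V), (∀ ω, powEdges ℓ (φ ω) ⊆ G) →
        1 - ε ≤ sparsProb G p (fun E => ∃ ω, powEdges ℓ (φ ω) ⊆ E) := by
  classical
  set B : ℝ := 2 ^ (3 * ℓ ^ 2) * (2 * ℓ) * K with hB
  have hB0 : 0 ≤ B := by positivity
  set δ : ℝ := ε / 2 with hδ
  have hδ0 : 0 < δ := by positivity
  set D : ℝ := 8 * (B ^ 2 + ℓ ^ 2) with hD
  have hℓ2 : (2 : ℝ) ≤ ℓ := by exact_mod_cast hℓ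
  have hD0 : 0 < D := by positivity
  set C₀ : ℝ := 4 + 16 * B + D * (4 * ℓ + 2 / δ + 2) with hC₀
  have hCpos : 4 ≤ C₀ := by
    have : 0 ≤ D * (4 * ℓ + 2 / δ + 2) := by positivity
    linarith
  refine ⟨C₀, max (ℓ + 1) (⌈16 / δ ^ 2⌉₊), ?_⟩
  intro n hn _ p hp0 hp1 hpC V Ω _ _ w φ hw hw1 hspread G hG
  have hnℓ : ℓ < n := le_trans (le_max_left _ _) hn
  have hnδ : 16 / δ ^ 2 ≤ n := (Nat.le_ceil _).trans (by exact_mod_cast (le_max_right _ _).trans hn)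
  have hn1 : (1 : ℝ) ≤ n := by exact_mod_cast (by omega : 1 ≤ n)
  have hn0 : (0 : ℝ) < n := by linarith
  set N : ℝ := (n : ℝ) ^ ((1 : ℝ) / ℓ) with hN
  have hN0 : 0 < N := by positivity
  have hNℓ : N ^ ℓ = n := by
    rw [hN, ← Real.rpow_natCast, ← Real.rpow_mul hn0.le, one_div,
      inv_mul_cancel₀ (by positivity), Real.rpow_one]
  have hNsq : N ≤ √n := by
    rw [hN, Real.sqrt_eq_rpow]
    exact Real.rpow_le_rpow_of_exponent_le hn1 (one_div_le_one_div_of_le (by norm_num) hℓ2)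
  set q : ℝ := 4 / p with hq
  have hq1 : 1 ≤ q := by rw [hq, le_div_iff₀ hp0]; linarith
  have hqN : q ≤ 4 * N / C₀ := by
    rw [hq, div_le_div_iff₀ hp0 (by linarith)]
    linarith
  have hr4 : B * q ^ ℓ / n ≤ 1 / 4 := by
    have h1 : q ^ ℓ ≤ (4 / C₀) ^ ℓ * n := by
      calc q ^ ℓ ≤ (4 * N / C₀) ^ ℓ := pow_le_pow_left₀ (by linarith) hqN ℓ
        _ = _ := by rw [← hNℓ, ← mul_pow]; ring
    have h2 : (4 / C₀) ^ ℓ ≤ 4 / C₀ :=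
      pow_le_of_le_one (by positivity) (by rw [div_le_one (by linarith)]; exact hCpos) (by omega)
    have h3 : B * (4 / C₀) ≤ 1 / 4 := by
      rw [mul_div_assoc', div_le_iff₀ (by linarith)]
      have : 0 ≤ D * (4 * ℓ + 2 / δ + 2) := by positivity
      linarith
    rw [div_le_iff₀ hn0]
    calc B * q ^ ℓ ≤ B * ((4 / C₀) * n) :=
          mul_le_mul_of_nonneg_left (h1.trans (mul_le_mul_of_nonneg_right h2 hn0.le)) hB0
      _ = (B * (4 / C₀)) * n := by ring
      _ ≤ _ := mul_le_mul_of_nonneg_right h3 hn0.le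
  set η : ℝ := 2 * (B ^ 2 * q + ℓ ^ 2) / n with hη
  have hη0 : 0 ≤ η := by positivity
  set κ : ℝ := D / C₀ with hκ
  have hκ0 : 0 < κ := by positivity
  have hs0 : 0 < √(n : ℝ) := Real.sqrt_pos.2 hn0
  have hss : √(n : ℝ) * √n = n := Real.mul_self_sqrt hn0.le
  have hηκ : η * √n ≤ κ := by
    have h1 : η ≤ (D / 4 * q) / n := by
      rw [hη]
      refine div_le_div_of_nonneg_right ?_ hn0.le
      have : (ℓ : ℝ) ^ 2 ≤ ℓ ^ 2 * q := le_mul_of_one_le_right (by positivity) hq1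
      rw [hD]; linarith
    have h2 : D / 4 * q ≤ κ * √n := by
      calc D / 4 * q ≤ D / 4 * (4 * √n / C₀) := by
            refine mul_le_mul_of_nonneg_left (hqN.trans ?_) (by positivity)
            exact div_le_div_of_nonneg_right (by linarith) (by linarith)
        _ = κ * √n := by rw [hκ]; ring
    calc η * √n ≤ (κ * √n) / n * √n :=
          mul_le_mul_of_nonneg_right (h1.trans (div_le_div_of_nonneg_right h2 hn0.le)) hs0.le
      _ = κ * (√n * √n) / n := by ring
      _ = κ := by rw [hss, mul_div_assoc, div_self hn0.ne', mul_one]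
  have hκbound : κ * (4 * ℓ + 2 / δ + 2) ≤ 1 := by
    rw [hκ, div_mul_eq_mul_div, div_le_one (by linarith)]
    linarith
  have hκ1 : κ * ℓ ≤ 1 / 4 := by
    have : 0 ≤ κ * (2 / δ + 2) := by positivity
    linarith [show κ * (4 * ℓ + 2 / δ + 2) = 4 * (κ * ℓ) + κ * (2 / δ + 2) by ring]
  have hκ2 : κ ≤ δ / 2 := by
    have h1 : 0 ≤ κ * (4 * ℓ + 2) := by positivity
    have h2 : κ * (2 / δ) ≤ 1 := by
      linarith [show κ * (4 * ℓ + 2 / δ + 2) = κ * (4 * ℓ + 2) + κ * (2 / δ) by ring]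
    rw [mul_div_assoc', div_le_one hδ0] at h2
    linarith
  have hκ3 : κ ≤ 1 / 2 := by
    have h1 : 0 ≤ κ * (4 * ℓ + 2 / δ) := by positivity
    linarith [show κ * (4 * ℓ + 2 / δ + 2) = κ * (4 * ℓ + 2 / δ) + 2 * κ by ring]
  have hexp : ∀ A : ℕ, (1 + η) ^ A ≤ Real.exp (η * A) := by
    intro A
    calc (1 + η) ^ A ≤ (Real.exp η) ^ A :=
          pow_le_pow_left₀ (by linarith) (by linarith [Real.add_one_le_exp η]) A
      _ = _ := by rw [← Real.exp_nat_mul, mul_comm]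
  have hΦ := fun ω₀ A hA =>
    (sum_pow_card_inter_powEdges_le (by omega) hnℓ w hw φ hK hq1 hspread hB hr4 ω₀ A hA).trans
      (hexp A.card)
  have hfinal : 1 - ε ≤ (1 - δ) / (1 + δ) := by
    rw [le_div_iff₀ (by linarith), hδ]
    linarith [mul_self_nonneg ε]
  refine hfinal.trans (sparsProb_exists_subset_ge w hw hw1 G (fun ω => powEdges ℓ (φ ω)) hG hp0
    hp1 hδ0.le ⌈√(n : ℝ)⌉₊ ?_ ?_)
  · intro ω
    refine (hΦ ω _ subset_rfl).trans ?_
    have hc : ((powEdges ℓ (φ ω)).card : ℝ) ≤ ℓ * n := by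
      have : (powEdges ℓ (φ ω)).card ≤ n * ℓ := by
        refine Finset.card_image_le.trans ?_
        simp [Finset.card_univ, ZMod.card]
      rw [mul_comm]
      exact_mod_cast this
    have h1 : η * (powEdges ℓ (φ ω)).card ≤ √n / 4 := by
      calc η * (powEdges ℓ (φ ω)).card ≤ η * (ℓ * n) := mul_le_mul_of_nonneg_left hc hη0
        _ = η * √n * ℓ * √n := by nth_rewrite 1 [← hss]; ring
        _ ≤ κ * ℓ * √n := by gcongr
        _ ≤ 1 / 4 * √n := mul_le_mul_of_nonneg_right hκ1 hs0.le
        _ = _ := by ring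
    have h2 : Real.exp (√n / 2) ≤ 2 ^ ⌈√(n : ℝ)⌉₊ := by
      have h3 : (2 : ℝ) ^ ⌈√(n : ℝ)⌉₊ = Real.exp (Real.log 2 * ⌈√(n : ℝ)⌉₊) := by
        rw [← Real.rpow_natCast, Real.rpow_def_of_pos (by norm_num)]
      rw [h3, Real.exp_le_exp]
      have h4 := Nat.le_ceil (√(n : ℝ))
      have h5 : (1 / 2 : ℝ) ≤ Real.log 2 := by linarith [Real.log_two_gt_d9]
      have h6 := mul_le_mul h5 h4 hs0.le (by linarith)
      linarith
    have h3 : 1 ≤ δ * Real.exp (√n / 4) := by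
      have h4 : √n / 4 ≤ Real.exp (√n / 4) := by linarith [Real.add_one_le_exp (√(n : ℝ) / 4)]
      have h5 : 4 / δ ≤ √n := by
        refine Real.le_sqrt_of_sq_le ?_
        rw [div_pow]; norm_num; exact hnδ
      have h6 : 1 ≤ δ * (√n / 4) := by
        rw [div_le_iff₀ hδ0] at h5
        linarith
      exact h6.trans (mul_le_mul_of_nonneg_left h4 hδ0.le)
    calc _ ≤ Real.exp (√n / 4) := Real.exp_le_exp.2 h1
      _ ≤ (δ * Real.exp (√n / 4)) * Real.exp (√n / 4) :=
          le_mul_of_one_le_left (Real.exp_pos _).le h3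
      _ = δ * Real.exp (√n / 2) := by rw [mul_assoc, ← Real.exp_add]; ring_nf
      _ ≤ _ := mul_le_mul_of_nonneg_left h2 hδ0.le
  · intro ω A hA hAm
    refine (hΦ ω A hA).trans ?_
    have h1 : (A.card : ℝ) ≤ √n := (Nat.lt_ceil.1 hAm).le
    have h2 : η * A.card ≤ κ := (mul_le_mul_of_nonneg_left h1 hη0).trans hηκ
    refine (Real.exp_le_exp.2 h2).trans ?_
    have h3 : 1 - κ ≤ Real.exp (-κ) := by linarith [Real.add_one_le_exp (-κ)]
    rw [Real.exp_neg] at h3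
    have h4 : Real.exp κ * (1 - κ) ≤ 1 := by
      rwa [mul_comm, ← le_div_iff₀ (Real.exp_pos κ), one_div]
    have h5 := mul_le_mul_of_nonneg_left (show 1 / 2 ≤ 1 - κ by linarith) (Real.exp_pos κ).le
    have h6 := mul_le_mul_of_nonneg_right (show Real.exp κ ≤ 2 by linarith) hκ0.le
    linarith

end SpreadEmbedding

section PowChain

variable {α : Type*} {G : SimpleGraph α} {ℓ : ℕ}

/-- In the list, any two entries at distance at most `ℓ` are adjacent. -/
def PowChain (G : SimpleGraph α) (ℓ : ℕ) : List α → Prop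
  | [] => True
  | x :: l => (∀ y ∈ l.take ℓ, G.Adj x y) ∧ PowChain G ℓ l

lemma PowChain.mono {ℓ' : ℕ} (h : ℓ' ≤ ℓ) : ∀ {L : List α}, PowChain G ℓ L → PowChain G ℓ' L
  | [], _ => trivial
  | _ :: _, hL => ⟨fun y hy => hL.1 y ((List.take_sublist_take_left h).subset hy),
      PowChain.mono h hL.2⟩

lemma powChain_zero : ∀ L : List α, PowChain G 0 L
  | [] => trivial
  | _ :: l => ⟨by simp, powChain_zero l⟩

lemma PowChain.right_of_append : ∀ {A B : List α}, PowChain G ℓ (A ++ B) → PowChain G ℓ B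
  | [], _, h => h
  | _ :: _, _, h => PowChain.right_of_append h.2

lemma PowChain.left_of_append : ∀ {A B : List α}, PowChain G ℓ (A ++ B) → PowChain G ℓ A
  | [], _, _ => trivial
  | _ :: A, B, h => ⟨fun y hy => h.1 y (((List.prefix_append A B).take ℓ).subset hy),
      PowChain.left_of_append h.2⟩

lemma PowChain.glue {E B : List α} (hE : ℓ ≤ E.length) (hEB : PowChain G ℓ (E ++ B)) :
    ∀ {A : List α}, PowChain G ℓ (A ++ E) → PowChain G ℓ (A ++ E ++ B)
  | [], _ => hEB
  | x :: A, h => by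
    refine ⟨fun y hy => h.1 y ?_, PowChain.glue hE hEB h.2⟩
    change y ∈ (A ++ E ++ B).take ℓ at hy
    rwa [List.take_append_of_le_length (by simp; omega)] at hy

lemma PowChain.snoc {x : α} : ∀ {L : List α}, PowChain G ℓ L →
    (∀ y ∈ L.reverse.take ℓ, G.Adj y x) → PowChain G ℓ (L ++ [x])
  | [], _, _ => ⟨by simp, trivial⟩
  | a :: L, h, hx => by
    refine ⟨fun y hy => ?_, PowChain.snoc h.2 fun y hy => hx y ?_⟩
    · change y ∈ (L ++ [x]).take ℓ at hy
      rw [List.take_append, List.mem_append] at hy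
      rcases hy with hy | hy
      · exact h.1 y hy
      · have hlt : L.length < ℓ := by
          by_contra hc
          simp [Nat.sub_eq_zero_of_le (not_lt.1 hc)] at hy
        obtain rfl : y = x := by simpa using List.mem_of_mem_take hy
        refine hx a ?_
        rw [List.take_of_length_le (by simp; omega)]
        simp
    · rw [List.reverse_cons]
      exact ((List.prefix_append _ _).take ℓ).subset hy

lemma PowChain.reverse : ∀ {L : List α}, PowChain G ℓ L → PowChain G ℓ L.reverse
  | [], _ => trivial
  | x :: L, h => by
    rw [List.reverse_cons]
    refine PowChain.snoc h.2.reverse fun y hy => (h.1 y ?_).symm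
    rwa [List.reverse_reverse] at hy

lemma powChain_iff_getElem {L : List α} : PowChain G ℓ L ↔
    ∀ i j (hij : i < j) (hj : j < L.length), j ≤ i + ℓ → G.Adj L[i] L[j] := by
  induction L with
  | nil => simp [PowChain]
  | cons x L ih =>
    rw [PowChain, ih]
    constructor
    · rintro ⟨h1, h2⟩ i j hij hj hle
      obtain ⟨j, rfl⟩ : ∃ j', j = j' + 1 := ⟨j - 1, by omega⟩
      rcases i with _ | i
      · refine h1 _ (List.mem_take_iff_getElem.2 ⟨j, ?_, rfl⟩)
        simp at hj; omega
      · simpa using h2 i j (by omega) (by simpa using hj) (by omega)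
    · intro h
      refine ⟨fun y hy => ?_, fun i j hij hj hle => ?_⟩
      · obtain ⟨j, hj, rfl⟩ := List.mem_take_iff_getElem.1 hy
        exact h 0 (j + 1) (by omega) (by simp; omega) (by omega)
      · exact h (i + 1) (j + 1) (by omega) (by simpa using hj) (by omega)

/-- A vertex adjacent to everything may be inserted between two blocks of an `ℓ`-chain to get an
`(ℓ+1)`-chain. -/
lemma PowChain.insert_hub {A B : List α} {h : α} (hA : A.length ≤ ℓ + 1) (hB : B.length ≤ ℓ + 1)
    (hAB : PowChain G ℓ (A ++ B)) (hh : ∀ y ∈ A ++ B, G.Adj h y) :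
    PowChain G (ℓ + 1) (A ++ h :: B) := by
  induction A with
  | nil =>
    refine ⟨fun y hy => hh y (List.mem_of_mem_take hy), ?_⟩
    rw [List.nil_append] at hAB
    rw [powChain_iff_getElem] at hAB ⊢
    exact fun i j hij hj _ => hAB i j hij hj (by omega)
  | cons x A ih =>
    refine ⟨fun y hy => ?_, ih (by simp at hA; omega) hAB.2 fun y hy =>
      hh y (by simp at hy ⊢; tauto)⟩
    simp only [List.length_cons] at hA
    change y ∈ (A ++ h :: B).take (ℓ + 1) at hy
    have hx : ∀ y ∈ (A ++ B).take ℓ, G.Adj x y := hAB.1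
    rw [List.take_append, List.mem_append] at hy
    rcases hy with hy | hy
    · refine hx y ?_
      rw [List.take_of_length_le (by omega)] at hy
      rw [List.take_append, List.mem_append, List.take_of_length_le (by omega)]
      exact Or.inl hy
    · rw [Nat.succ_sub (by omega), List.take_succ_cons, List.mem_cons] at hy
      rcases hy with rfl | hy
      · exact (hh x (by simp)).symm
      · refine hx y ?_
        rw [List.take_append, List.mem_append]
        exact Or.inr hy

lemma PowChain.interleave_hubs {Z : List α} (hZ : Z.length = ℓ + 1) :
    ∀ (M : ℕ) (hs A P : List α), hs.length = M + 1 → A.length = ℓ + 1 →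
      P.length = (ℓ + 1) * M → PowChain G ℓ (A ++ P ++ Z) →
      (∀ h ∈ hs, ∀ y ∈ A ++ P ++ Z, G.Adj h y) →
      ∃ T : List α, T.Perm (hs ++ P) ∧ PowChain G (ℓ + 1) (A ++ T ++ Z) := by
  intro M
  induction M with
  | zero =>
    intro hs A P hhs hA hP hc hh
    obtain ⟨h, rfl⟩ := List.length_eq_one_iff.1 hhs
    obtain rfl : P = [] := List.length_eq_zero_iff.1 (by simpa using hP)
    refine ⟨[h], by simp, ?_⟩
    simp only [List.append_nil] at hc hh
    simpa using hc.insert_hub hA.le hZ.le (hh h (by simp))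
  | succ M ih =>
    intro hs A P hhs hA hP hc hh
    obtain ⟨h, hs, rfl⟩ := List.exists_cons_of_length_eq_add_one hhs
    set B := P.take (ℓ + 1) with hB
    set P' := P.drop (ℓ + 1) with hP'
    have hPe : P = B ++ P' := (List.take_append_drop _ _).symm
    have hBl : B.length = ℓ + 1 := by rw [hB, List.length_take, hP, mul_add]; omega
    have hPl : P'.length = (ℓ + 1) * M := by rw [hP', List.length_drop, hP, mul_add]; omega
    rw [hPe] at hc hh
    have hc' : PowChain G ℓ (A ++ (B ++ P' ++ Z)) := by simpa using hc
    obtain ⟨T, hT, hT'⟩ := ih hs B P' (by simpa using hhs) hBl hPl hc'.right_of_append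
      fun x hx y hy => hh x (by simp [hx]) y (by simp at hy ⊢; tauto)
    have h1 : PowChain G (ℓ + 1) (A ++ h :: B) := by
      refine PowChain.insert_hub hA.le hBl.le ?_ fun y hy =>
        hh h (by simp) y (by simp at hy ⊢; tauto)
      exact PowChain.left_of_append (B := P' ++ Z) (by simpa using hc)
    refine ⟨h :: B ++ T, ?_, ?_⟩
    · rw [hPe]
      simp only [List.cons_append, List.perm_cons]
      refine (hT.append_left B).trans ?_
      rw [← List.append_assoc, ← List.append_assoc]
      exact List.perm_append_comm.append_right P'
    · have := PowChain.glue (A := A ++ [h]) (E := B) (B := T ++ Z) hBl.ge (by simpa using hT')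
        (by simpa using h1)
      simpa using this

end PowChain

section Families

open Classical

variable {α ι : Type*} {G : SimpleGraph α} {ℓ : ℕ}

/-- The vertices of `W` that are not adjacent to `v`. -/
noncomputable def nonNbrs (G : SimpleGraph α) (W : Finset α) (v : α) : Finset α :=
  W.filter fun w => ¬ G.Adj v w

lemma nonNbrs_subset (W : Finset α) (v : α) : nonNbrs G W v ⊆ W := Finset.filter_subset _ _

lemma nonNbrs_card_mono {W W' : Finset α} (h : W' ⊆ W) (v : α) :
    ((nonNbrs G W' v).card : ℝ) ≤ (nonNbrs G W v).card := by
  exact_mod_cast Finset.card_le_card (Finset.filter_subset_filter _ h)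

lemma exists_weight_ge (I : Finset ι) {w : ι → ℝ} (hw : ∀ i ∈ I, 0 ≤ w i) {W : Finset α}
    (hWne : W.Nonempty) {A : ι → Finset α} (hA : ∀ i ∈ I, A i ⊆ W) {n κ : ℝ} (hκ : 0 ≤ κ)
    (hW : (W.card : ℝ) ≤ n) (hcard : ∀ i ∈ I, κ * n ≤ (A i).card) :
    ∃ x ∈ W, κ * ∑ i ∈ I, w i ≤ ∑ i ∈ I with x ∈ A i, w i := by
  by_contra! hcon
  have h1 := Finset.sum_lt_sum_of_nonempty hWne hcon
  have h2 : ∑ x ∈ W, ∑ i ∈ I with x ∈ A i, w i = ∑ i ∈ I, (A i).card * w i := by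
    simp_rw [Finset.sum_filter]
    rw [Finset.sum_comm]
    refine Finset.sum_congr rfl fun i hi => ?_
    rw [← Finset.sum_filter, Finset.filter_mem_eq_inter, Finset.inter_eq_right.2 (hA i hi)]
    simp
  rw [h2, Finset.sum_const, nsmul_eq_mul] at h1
  have h3 : (κ * n) * ∑ i ∈ I, w i ≤ ∑ i ∈ I, (A i).card * w i := by
    rw [Finset.mul_sum]
    exact Finset.sum_le_sum fun i hi => mul_le_mul_of_nonneg_right (hcard i hi) (hw i hi)
  have h4 := mul_le_mul_of_nonneg_right hW (mul_nonneg hκ (Finset.sum_nonneg hw))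
  linarith

lemma card_sub_le_card_common_nbrs {W S : Finset α} (hS : S ⊆ W) {D : ℝ} (hD : 0 ≤ D) :
    ∀ (m : ℕ) (C : List α), C.length ≤ m → (∀ v ∈ C, ((nonNbrs G W v).card : ℝ) ≤ D) →
      (S.card : ℝ) - m * D ≤ (S.filter fun x => ∀ y ∈ C, G.Adj y x).card := by
  intro m C
  induction C generalizing m with
  | nil =>
    intro _ _
    simp only [List.not_mem_nil, false_implies, implies_true, Finset.filter_true]
    have : 0 ≤ m * D := by positivity
    linarith
  | cons y C ih =>
    intro hm hC
    obtain ⟨m, rfl⟩ : ∃ m', m = m' + 1 := ⟨m - 1, by simp at hm; omega⟩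
    have h1 := ih m (by simpa using hm) fun v hv => hC v (by simp [hv])
    have h2 : (S.filter fun x => ∀ z ∈ C, G.Adj z x) ⊆
        (S.filter fun x => ∀ z ∈ y :: C, G.Adj z x) ∪ nonNbrs G W y := by
      intro x hx
      simp only [Finset.mem_filter, nonNbrs, Finset.mem_union, List.forall_mem_cons] at hx ⊢
      by_cases h : G.Adj y x
      · exact Or.inl ⟨hx.1, h, hx.2⟩
      · exact Or.inr ⟨hS hx.1, h⟩
    have h3 : ((S.filter fun x => ∀ z ∈ C, G.Adj z x).card : ℝ) ≤
        (S.filter fun x => ∀ z ∈ y :: C, G.Adj z x).card + (nonNbrs G W y).card := by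
      exact_mod_cast (Finset.card_le_card h2).trans (Finset.card_union_le _ _)
    have h4 := hC y (by simp)
    push_cast
    linarith

/-- Greedily extend a chain inside many members of a family of sets at once. -/
lemma exists_chain_in_family {n κ D : ℝ} (hn : 0 < n) (hκ : 0 < κ) (hD : 0 ≤ D) {w : ι → ℝ}
    (hw : ∀ i, 0 ≤ w i) :
    ∀ (r : ℕ) (W : Finset α) (I : Finset ι) (A : ι → Finset α) (X : List α),
      (W.card : ℝ) ≤ n → 0 < ∑ i ∈ I, w i → (∀ i ∈ I, A i ⊆ W) →
      (∀ i ∈ I, ℓ * D + κ * n + r ≤ (A i).card) →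
      (∀ v ∈ W, ((nonNbrs G W v).card : ℝ) ≤ D) → (∀ v ∈ X, ((nonNbrs G W v).card : ℝ) ≤ D) →
      PowChain G ℓ X →
      ∃ z : List α, z.length = r ∧ z.Nodup ∧ (∀ x ∈ z, x ∈ W) ∧ PowChain G ℓ (X ++ z) ∧
        κ ^ r * ∑ i ∈ I, w i ≤ ∑ i ∈ I with ∀ x ∈ z, x ∈ A i, w i := by
  intro r
  induction r with
  | zero =>
    intro W I A X _ _ _ _ _ _ hX
    exact ⟨[], rfl, by simp, by simp, by simpa using hX, by simp⟩
  | succ r ih =>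
    intro W I A X hWn hpos hA hcard hWD hXD hX
    have hIne : I.Nonempty := Finset.nonempty_of_sum_ne_zero hpos.ne'
    obtain ⟨i₀, hi₀⟩ := hIne
    have hκn : 0 < κ * n := by positivity
    have hℓD : 0 ≤ ℓ * D := by positivity
    have hWne : W.Nonempty := by
      have h1 := hcard i₀ hi₀
      have h2 : (0 : ℝ) < (A i₀).card := by
        push_cast at h1
        linarith [(Nat.cast_nonneg r : (0 : ℝ) ≤ r)]
      exact (Finset.card_pos.1 (by exact_mod_cast h2)).mono (hA i₀ hi₀)
    set B : ι → Finset α := fun i => (A i).filter fun x => ∀ y ∈ X.reverse.take ℓ, G.Adj y x with hB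
    obtain ⟨x, hxW, hx⟩ := exists_weight_ge I (fun i _ => hw i) hWne (A := B)
      (fun i hi => (Finset.filter_subset _ _).trans (hA i hi)) hκ.le hWn (fun i hi => by
        have h1 := card_sub_le_card_common_nbrs (hA i hi) hD ℓ (X.reverse.take ℓ)
          (List.length_take_le _ _) fun v hv =>
            hXD v (List.mem_reverse.1 (List.mem_of_mem_take hv))
        have h2 := hcard i hi
        push_cast at h2
        linarith [(Nat.cast_nonneg r : (0 : ℝ) ≤ r)])
    set I' := I.filter fun i => x ∈ B i with hI'
    have hpos' : 0 < ∑ i ∈ I', w i := lt_of_lt_of_le (by positivity) hx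
    obtain ⟨i₁, hi₁⟩ := Finset.nonempty_of_sum_ne_zero hpos'.ne'
    have hxadj : ∀ y ∈ X.reverse.take ℓ, G.Adj y x :=
      (Finset.mem_filter.1 (Finset.mem_filter.1 hi₁).2).2
    obtain ⟨z, hz1, hz2, hz3, hz4, hz5⟩ := ih (W.erase x) I' (fun i => (A i).erase x) (X ++ [x])
      (le_trans (by exact_mod_cast Finset.card_le_card (Finset.erase_subset _ _)) hWn) hpos'
      (fun i hi => Finset.erase_subset_erase _ (hA i (Finset.mem_filter.1 hi).1))
      (fun i hi => by
        have h2 := hcard i (Finset.mem_filter.1 hi).1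
        have h3 : ((A i).card : ℝ) ≤ ((A i).erase x).card + 1 := by
          exact_mod_cast Nat.sub_le_iff_le_add.1 Finset.pred_card_le_card_erase
        push_cast at h2
        linarith)
      (fun v hv => (nonNbrs_card_mono (Finset.erase_subset _ _) v).trans
        (hWD v (Finset.mem_of_mem_erase hv)))
      (fun v hv => (nonNbrs_card_mono (Finset.erase_subset _ _) v).trans (by
        rcases List.mem_append.1 hv with hv | hv
        · exact hXD v hv
        · obtain rfl := List.mem_singleton.1 hv
          exact hWD v hxW))
      (hX.snoc hxadj)
    refine ⟨x :: z, by simp [hz1], List.nodup_cons.2 ⟨fun h => by simpa using hz3 x h, hz2⟩,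
      ?_, by simpa using hz4, ?_⟩
    · simp only [List.forall_mem_cons]
      exact ⟨hxW, fun y hy => Finset.mem_of_mem_erase (hz3 y hy)⟩
    · calc κ ^ (r + 1) * ∑ i ∈ I, w i = κ ^ r * (κ * ∑ i ∈ I, w i) := by ring
        _ ≤ κ ^ r * ∑ i ∈ I', w i := mul_le_mul_of_nonneg_left hx (by positivity)
        _ ≤ _ := hz5
        _ ≤ _ := by
          refine Finset.sum_le_sum_of_subset_of_nonneg ?_ fun i _ _ => hw i
          intro i hi
          simp only [Finset.mem_filter, hI', hB, List.forall_mem_cons] at hi ⊢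
          exact ⟨hi.1.1, hi.1.2.1, fun y hy => Finset.mem_of_mem_erase (hi.2 y hy)⟩

/-- Counting version of `exists_chain_in_family`. -/
lemma exists_chain_in_family_card {n κ D : ℝ} (hn : 0 < n) (hκ : 0 < κ) (hD : 0 ≤ D)
    (r : ℕ) {W : Finset α} {I : Finset ι} {A : ι → Finset α} {X : List α}
    (hW : (W.card : ℝ) ≤ n) (hI : I.Nonempty) (hA : ∀ i ∈ I, A i ⊆ W)
    (hcard : ∀ i ∈ I, ℓ * D + κ * n + r ≤ (A i).card)
    (hWD : ∀ v ∈ W, ((nonNbrs G W v).card : ℝ) ≤ D)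
    (hXD : ∀ v ∈ X, ((nonNbrs G W v).card : ℝ) ≤ D) (hX : PowChain G ℓ X) :
    ∃ z : List α, z.length = r ∧ z.Nodup ∧ (∀ x ∈ z, x ∈ W) ∧ PowChain G ℓ (X ++ z) ∧
      κ ^ r * I.card ≤ (I.filter fun i => ∀ x ∈ z, x ∈ A i).card := by
  obtain ⟨z, h1, h2, h3, h4, h5⟩ := exists_chain_in_family hn hκ hD (w := fun _ : ι => 1)
    (fun _ => zero_le_one) r W I A X hW (by simpa using hI) hA hcard hWD hXD hX
  exact ⟨z, h1, h2, h3, h4, by simpa using h5⟩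

/-- Many sets of linear size contain a common list of distinct elements. -/
lemma exists_common_list {n κ : ℝ} (hn : 0 < n) (hκ : 0 < κ) (r : ℕ) {W : Finset α}
    {I : Finset ι} {A : ι → Finset α} (hW : (W.card : ℝ) ≤ n) (hI : I.Nonempty)
    (hA : ∀ i ∈ I, A i ⊆ W) (hcard : ∀ i ∈ I, κ * n + r ≤ (A i).card) :
    ∃ z : List α, z.length = r ∧ z.Nodup ∧
      κ ^ r * I.card ≤ (I.filter fun i => ∀ x ∈ z, x ∈ A i).card := by
  have h : ∀ v : α, ((nonNbrs (⊥ : SimpleGraph α) W v).card : ℝ) ≤ W.card := fun v => by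
    exact_mod_cast Finset.card_le_card (nonNbrs_subset W v)
  obtain ⟨z, h1, h2, -, -, h5⟩ := exists_chain_in_family_card (G := ⊥) (ℓ := 0) (X := []) hn hκ
    (Nat.cast_nonneg W.card) r hW hI hA (by simpa using hcard) (fun v _ => h v) (by simp) trivial
  exact ⟨z, h1, h2, h5⟩

end Families

section Connecting

open Classical

lemma exists_common_hubs {α ι : Type} {n δ η : ℝ} (hn : 0 < n) (hδ : 0 < δ) (hη : 0 < η) {r : ℕ}
    (hr : r ≤ δ * η / 4 * n) {W : Finset α} {I : Finset ι} {A : ι → Finset α}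
    (hW : (W.card : ℝ) ≤ n) (hI : I.Nonempty) (hA : ∀ i ∈ I, A i ⊆ W)
    (hcard : ∀ i ∈ I, η * n ≤ (A i).card) {J : Finset (ι × α)}
    (hJ : J ⊆ (I ×ˢ W).filter fun j => j.2 ∈ A j.1)
    (hJcard : δ * ((I ×ˢ W).filter fun j => j.2 ∈ A j.1).card ≤ J.card) :
    ∃ hs : List α, hs.length = r ∧ hs.Nodup ∧ (δ * η / 4) ^ r * (δ * η / 2) * I.card ≤
      (I.filter fun i => ∀ h ∈ hs, (i, h) ∈ J).card := by
  set H : ι → Finset α := fun i => W.filter fun h => (i, h) ∈ J with hH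
  set I' := I.filter fun i => δ * η / 2 * n ≤ (H i).card with hI'
  have hprod : ∀ (P : ι × α → Prop) [DecidablePred P], ((((I ×ˢ W).filter P).card : ℕ) : ℝ) =
      ∑ i ∈ I, ((W.filter fun h => P (i, h)).card : ℝ) := by
    intro P _
    rw [Finset.card_filter, Finset.sum_product]
    push_cast
    exact Finset.sum_congr rfl fun i _ => by rw [Finset.card_filter]; push_cast; rfl
  have h1 : η * n * I.card ≤ ((I ×ˢ W).filter fun j => j.2 ∈ A j.1).card := by
    rw [hprod, mul_comm, ← nsmul_eq_mul, ← Finset.sum_const]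
    refine Finset.sum_le_sum fun i hi => (hcard i hi).trans (le_of_eq ?_)
    congr 2
    ext h
    simpa using fun hh => hA i hi hh
  have h2 : (J.card : ℝ) ≤ ∑ i ∈ I, ((H i).card : ℝ) := by
    refine le_trans ?_ (hprod fun j => j ∈ J).le
    exact_mod_cast Finset.card_le_card fun j hj =>
      Finset.mem_filter.2 ⟨(Finset.mem_filter.1 (hJ hj)).1, hj⟩
  have h3 : ∑ i ∈ I, ((H i).card : ℝ) ≤ n * I'.card + δ * η / 2 * n * I.card := by
    rw [mul_comm n, mul_comm (δ * η / 2 * n), ← nsmul_eq_mul, ← nsmul_eq_mul, ← Finset.sum_const,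
      ← Finset.sum_const, hI', Finset.sum_filter, ← Finset.sum_add_distrib]
    refine Finset.sum_le_sum fun i _ => ?_
    have h4 : ((H i).card : ℝ) ≤ n :=
      le_trans (by exact_mod_cast Finset.card_le_card (Finset.filter_subset _ _)) hW
    have h5 : 0 ≤ δ * η / 2 * n := by positivity
    split_ifs with h <;> linarith
  have h4 : δ * η / 2 * I.card ≤ I'.card := by
    have h5 := mul_le_mul_of_nonneg_left h1 hδ.le
    refine le_of_mul_le_mul_left ?_ hn
    linarith
  have hIpos : (0 : ℝ) < I.card := by exact_mod_cast hI.card_pos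
  have hI'ne : I'.Nonempty := by
    rw [← Finset.card_pos]
    have : (0 : ℝ) < I'.card := lt_of_lt_of_le (by positivity) h4
    exact_mod_cast this
  obtain ⟨z, hz1, hz2, hz3⟩ := exists_common_list hn (show 0 < δ * η / 4 by positivity) r hW hI'ne
    (A := H) (fun i _ => Finset.filter_subset _ _)
    (fun i hi => by linarith [(Finset.mem_filter.1 hi).2])
  refine ⟨z, hz1, hz2, ?_⟩
  calc (δ * η / 4) ^ r * (δ * η / 2) * I.card = (δ * η / 4) ^ r * (δ * η / 2 * I.card) := by ring
    _ ≤ (δ * η / 4) ^ r * I'.card := mul_le_mul_of_nonneg_left h4 (by positivity)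
    _ ≤ _ := hz3
    _ ≤ _ := by
      refine Nat.cast_le.2 (Finset.card_le_card fun i hi => ?_)
      simp only [Finset.mem_filter, hI', hH] at hi ⊢
      exact ⟨hi.1.1, fun h hh => (hi.2 h hh).2⟩

/-- The connecting lemma: two `ℓ`-chains can be joined by a short chain lying in a positive
proportion of the members of a family of large sets. -/
theorem exists_connecting_chain (ℓ : ℕ) : ∀ η : ℝ, 0 < η → ∃ δ : ℝ, 0 < δ ∧ ∃ n₀ : ℝ,
    ∀ (α ι : Type) (G : SimpleGraph α) (n D : ℝ) (W : Finset α) (I : Finset ι) (A : ι → Finset α)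
      (X Y : List α), n₀ ≤ n → 0 < n → 0 ≤ D → (W.card : ℝ) ≤ n → I.Nonempty → (∀ i ∈ I, A i ⊆ W) →
      (∀ i ∈ I, (ℓ + 1) * D + η * n ≤ (A i).card) →
      (∀ v ∈ W, ((nonNbrs G W v).card : ℝ) ≤ D) → (∀ v ∈ X, ((nonNbrs G W v).card : ℝ) ≤ D) →
      (∀ v ∈ Y, ((nonNbrs G W v).card : ℝ) ≤ D) → PowChain G ℓ X → PowChain G ℓ Y →
      ∃ z : List α, z.length = 2 * ℓ * (ℓ + 1) ∧ z.Nodup ∧ PowChain G ℓ (X ++ z ++ Y) ∧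
        δ * I.card ≤ (I.filter fun i => ∀ x ∈ z, x ∈ A i).card := by
  induction ℓ with
  | zero =>
    intro η hη
    refine ⟨1, one_pos, 0, fun α ι G n D W I A X Y _ _ _ _ _ _ _ _ _ _ _ _ =>
      ⟨[], by simp, by simp, powChain_zero _, by simp⟩⟩
  | succ ℓ ih =>
    intro η hη
    obtain ⟨δ', hδ', n₁, ih⟩ := ih (η / 2) (by positivity)
    set δ := δ' * (η / 2) ^ (2 * ℓ + 3) with hδ
    have hδ0 : 0 < δ := by positivity
    refine ⟨(δ * η / 4) ^ (2 * ℓ + 1) * (δ * η / 2), by positivity,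
      max n₁ (max ((2 * ℓ + 3) / (η / 2)) ((2 * ℓ + 1 : ℕ) / (δ * η / 4))), ?_⟩
    intro α ι G n D W I A X Y hnn hn hD hW hI hA hcard hWD hXD hYD hX hY
    have hn1 : n₁ ≤ n := (le_max_left _ _).trans hnn
    have hn2 : 2 * ℓ + 3 ≤ η / 2 * n := by
      have := ((le_max_left _ _).trans (le_max_right _ _)).trans hnn
      rwa [div_le_iff₀' (by positivity)] at this
    have hn3 : (2 * ℓ + 1 : ℕ) ≤ δ * η / 4 * n := by
      have := ((le_max_right _ _).trans (le_max_right _ _)).trans hnn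
      rwa [div_le_iff₀' (by positivity)] at this
    have hℓ0 : (0 : ℝ) ≤ ℓ := Nat.cast_nonneg ℓ
    have hℓD : 0 ≤ ((ℓ + 1 : ℕ) + 1 : ℝ) * D := by positivity
    push_cast at hcard hℓD
    set J := (I ×ˢ W).filter fun j => j.2 ∈ A j.1 with hJ
    have hJI : ∀ j ∈ J, j.1 ∈ I ∧ j.2 ∈ W ∧ j.2 ∈ A j.1 := fun j hj => by
      simpa [hJ, and_assoc] using hj
    set B : ι × α → Finset α := fun j => (A j.1).filter fun x => ∀ y ∈ [j.2], G.Adj y x with hB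
    have hBW : ∀ j ∈ J, B j ⊆ W := fun j hj =>
      (Finset.filter_subset _ _).trans (hA _ (hJI j hj).1)
    have hBcard : ∀ j ∈ J, (ℓ + 1) * D + η * n ≤ (B j).card := by
      intro j hj
      have h1 := card_sub_le_card_common_nbrs (G := G) (hA j.1 (hJI j hj).1) hD 1 [j.2] (by simp)
        (by simpa using hWD _ (hJI j hj).2.1)
      have h2 := hcard j.1 (hJI j hj).1
      push_cast at h1
      linarith
    have hJne : J.Nonempty := by
      obtain ⟨i, hi⟩ := hI
      have h1 := hcard i hi
      have h2 : 0 < η * n := by positivity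
      have h3 : (0 : ℝ) < (A i).card := by linarith
      obtain ⟨h, hh⟩ := Finset.card_pos.1 (by exact_mod_cast h3)
      exact ⟨(i, h), by simp [hJ, hi, hh, hA i hi hh]⟩
    obtain ⟨z, hz1, hz2, hz3, hz4, hz5⟩ := exists_chain_in_family_card (G := G) (ℓ := ℓ + 1) hn
      (half_pos hη) hD (ℓ + 2) (I := J) (A := B) hW hJne hBW
      (fun j hj => by have := hBcard j hj; push_cast; linarith) hWD hXD hX
    set J₁ := J.filter fun j => ∀ x ∈ z, x ∈ B j with hJ₁
    have hpos : ∀ {S T : Finset (ι × α)} {c : ℝ}, 0 < c → S.Nonempty → c * S.card ≤ T.card →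
        T.Nonempty := by
      intro S T c hc hS h
      have h1 : (0 : ℝ) < S.card := by exact_mod_cast hS.card_pos
      have h2 : (0 : ℝ) < T.card := lt_of_lt_of_le (by positivity) h
      exact Finset.card_pos.1 (by exact_mod_cast h2)
    have hJ₁ne : J₁.Nonempty := hpos (by positivity) hJne hz5
    have hJ₁J : J₁ ⊆ J := Finset.filter_subset _ _
    obtain ⟨y, hy1, hy2, hy3, hy4, hy5⟩ := exists_chain_in_family_card (G := G) (ℓ := ℓ + 1) hn
      (half_pos hη) hD (ℓ + 1) (W := W \ z.toFinset) (I := J₁) (A := fun j => B j \ z.toFinset)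
      (X := Y.reverse)
      (le_trans (by exact_mod_cast Finset.card_le_card Finset.sdiff_subset) hW) hJ₁ne
      (fun j hj => Finset.sdiff_subset_sdiff (hBW j (hJ₁J hj)) subset_rfl)
      (fun j hj => by
        have h1 := hBcard j (hJ₁J hj)
        have h2 : ((B j).card : ℝ) ≤ (B j \ z.toFinset).card + (ℓ + 2 : ℕ) := by
          have := Finset.le_card_sdiff z.toFinset (B j)
          have h3 := z.toFinset_card_le
          exact_mod_cast (show (B j).card ≤ (B j \ z.toFinset).card + (ℓ + 2) by omega)
        push_cast at h2 ⊢
        linarith)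
      (fun v hv => (nonNbrs_card_mono Finset.sdiff_subset v).trans
        (hWD v (Finset.mem_sdiff.1 hv).1))
      (fun v hv => (nonNbrs_card_mono Finset.sdiff_subset v).trans
        (hYD v (List.mem_reverse.1 hv))) hY.reverse
    set J₂ := J₁.filter fun j => ∀ x ∈ y, x ∈ B j \ z.toFinset with hJ₂
    have hJ₂ne : J₂.Nonempty := hpos (by positivity) hJ₁ne hy5
    have hJ₂J : J₂ ⊆ J := (Finset.filter_subset _ _).trans hJ₁J
    have hyY : PowChain G (ℓ + 1) (y.reverse ++ Y) := by simpa using hy4.reverse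
    obtain ⟨p, hp1, hp2, hp3, hp4⟩ := ih α (ι × α) G n D W J₂
      (fun j => (B j \ z.toFinset) \ y.toFinset) z y.reverse hn1 hn hD hW hJ₂ne
      (fun j hj => Finset.sdiff_subset.trans (Finset.sdiff_subset.trans (hBW j (hJ₂J hj))))
      (fun j hj => by
        have h1 := hBcard j (hJ₂J hj)
        have h2 : ((B j).card : ℝ) ≤ ((B j \ z.toFinset) \ y.toFinset).card + (2 * ℓ + 3 : ℕ) := by
          have h4 := Finset.le_card_sdiff z.toFinset (B j)
          have h3 := z.toFinset_card_le
          have h6 := Finset.le_card_sdiff y.toFinset (B j \ z.toFinset)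
          have h5 := y.toFinset_card_le
          exact_mod_cast (show (B j).card ≤ ((B j \ z.toFinset) \ y.toFinset).card + (2 * ℓ + 3)
            by omega)
        push_cast at h2 ⊢
        linarith)
      hWD (fun v hv => hWD v (hz3 v hv))
      (fun v hv => hWD v (Finset.mem_sdiff.1 (hy3 v (List.mem_reverse.1 hv))).1)
      (hz4.right_of_append.mono (Nat.le_succ ℓ)) (hyY.left_of_append.mono (Nat.le_succ ℓ))
    set J₃ := J₂.filter fun j => ∀ x ∈ p, x ∈ (B j \ z.toFinset) \ y.toFinset with hJ₃
    have hJ₃J : J₃ ⊆ J := (Finset.filter_subset _ _).trans hJ₂J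
    have hJ₃card : δ * J.card ≤ J₃.card := by
      calc δ * J.card = δ' * ((η / 2) ^ (ℓ + 1) * ((η / 2) ^ (ℓ + 2) * J.card)) := by
            rw [hδ]; ring
        _ ≤ δ' * ((η / 2) ^ (ℓ + 1) * J₁.card) := by gcongr
        _ ≤ δ' * J₂.card := by gcongr
        _ ≤ J₃.card := hp4
    obtain ⟨hs, hs1, hs2, hs3⟩ := exists_common_hubs hn hδ0 hη hn3 hW hI hA
      (fun i hi => by have := hcard i hi; linarith) hJ₃J hJ₃card
    set I' := I.filter fun i => ∀ h ∈ hs, (i, h) ∈ J₃ with hI'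
    have hI'ne : I'.Nonempty := by
      have h1 : (0 : ℝ) < I.card := by exact_mod_cast hI.card_pos
      have h2 : (0 : ℝ) < I'.card := lt_of_lt_of_le (by positivity) hs3
      exact Finset.card_pos.1 (by exact_mod_cast h2)
    have hmem : ∀ i ∈ I', ∀ h ∈ hs, i ∈ I ∧ h ∈ A i ∧ (∀ x ∈ z, x ∈ A i ∧ G.Adj h x) ∧
        (∀ x ∈ y, x ∈ A i ∧ G.Adj h x ∧ x ∉ z) ∧
        (∀ x ∈ p, x ∈ A i ∧ G.Adj h x ∧ x ∉ z ∧ x ∉ y) := by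
      intro i hi h hh
      rw [hI', Finset.mem_filter] at hi
      have h1 := hi.2 h hh
      have h2 := hJI _ (hJ₃J h1)
      simp only [hJ₃, hJ₂, hJ₁, Finset.mem_filter, Finset.mem_sdiff, hB, List.mem_singleton,
        forall_eq, List.mem_toFinset] at h1
      refine ⟨hi.1, h2.2.2, h1.1.1.2, fun x hx => ?_, fun x hx => ?_⟩
      · have := h1.1.2 x hx; tauto
      · have := h1.2 x hx; tauto
    obtain ⟨i₀, hi₀⟩ := hI'ne
    obtain ⟨h₀, hh₀⟩ : ∃ h, h ∈ hs := List.exists_mem_of_length_pos (by omega)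
    obtain ⟨x, A', rfl⟩ := List.exists_cons_of_length_eq_add_one hz1
    have hA' : A'.length = ℓ + 1 := by simpa using hz1
    have hyl : y.reverse.length = ℓ + 1 := by simpa using hy1
    obtain ⟨T, hT1, hT2⟩ := PowChain.interleave_hubs (G := G) hyl (2 * ℓ) hs A' p hs1 hA'
      (by rw [hp1]; ring)
      (PowChain.right_of_append (A := [x]) (by simpa using hp3)) (by
        intro h hh v hv
        obtain ⟨-, -, h1, h2, h3⟩ := hmem i₀ hi₀ h hh
        simp only [List.mem_append, List.mem_reverse] at hv
        rcases hv with (hv | hv) | hv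
        · exact (h1 v (by simp [hv])).2
        · exact (h3 v hv).2.1
        · exact (h2 v hv).2.1)
    have hTmem : ∀ v, v ∈ T ↔ v ∈ hs ∨ v ∈ p := fun v => by rw [hT1.mem_iff, List.mem_append]
    refine ⟨x :: A' ++ T ++ y.reverse, ?_, ?_, ?_, ?_⟩
    · simp only [List.length_append, hT1.length_eq, hs1, hp1, hyl, hz1]
      ring
    · obtain ⟨-, -, h1, h2, h3⟩ := hmem i₀ hi₀ h₀ hh₀
      have hTn : T.Nodup := by
        rw [hT1.nodup_iff, List.nodup_append']
        refine ⟨hs2, hp2, fun h hh hhp => ?_⟩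
        exact G.loopless.irrefl h ((hmem i₀ hi₀ h hh).2.2.2.2 h hhp).2.1
      rw [List.nodup_append', List.nodup_append']
      refine ⟨⟨hz2, hTn, fun v hv hvT => ?_⟩, List.nodup_reverse.2 hy2, fun v hv hvy => ?_⟩
      · rcases (hTmem v).1 hvT with hvT | hvT
        · exact G.loopless.irrefl v ((hmem i₀ hi₀ v hvT).2.2.1 v hv).2
        · exact (h3 v hvT).2.2.1 hv
      · rw [List.mem_reverse] at hvy
        rcases List.mem_append.1 hv with hv | hv
        · exact (h2 v hvy).2.2 hv
        · rcases (hTmem v).1 hv with hvT | hvT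
          · exact G.loopless.irrefl v ((hmem i₀ hi₀ v hvT).2.2.2.1 v hvy).2.1
          · exact (h3 v hvT).2.2.2 hvy
    · have h1 := PowChain.glue (A := X ++ [x]) (E := A') (B := T ++ y.reverse) hA'.ge
        (by simpa using hT2) (by simpa using hz4)
      have h2 := PowChain.glue (A := X ++ x :: A' ++ T) (E := y.reverse) (B := Y) hyl.ge hyY
        (by simpa using h1)
      simpa using h2
    · refine hs3.trans (Nat.cast_le.2 (Finset.card_le_card fun i hi => Finset.mem_filter.2
        ⟨(Finset.mem_filter.1 hi).1, fun v hv => ?_⟩))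
      obtain ⟨-, -, h1, h2, h3⟩ := hmem i hi h₀ hh₀
      simp only [List.mem_append, List.mem_reverse, hTmem] at hv
      rcases hv with (hv | hv | hv) | hv
      · exact (h1 v hv).1
      · exact (hmem i hi v hv).2.1
      · exact (h3 v hv).1
      · exact (h2 v hv).1

end Connecting

section Tiles

open Classical

variable {α : Type} {G : SimpleGraph α} {k t : ℕ}

/-- The sets `T i` are the parts of a complete `k`-partite graph with parts of size `t`. -/
def IsParts (G : SimpleGraph α) (t : ℕ) (T : Fin k → Finset α) : Prop :=
  (∀ i, (T i).card = t) ∧ ∀ i j, i ≠ j → ∀ x ∈ T i, ∀ y ∈ T j, G.Adj x y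

lemma exists_parts_in_family (t j : ℕ) : ∀ η : ℝ, 0 < η → ∃ δ : ℝ, 0 < δ ∧ ∃ n₀ : ℝ,
    ∀ (α ι : Type) (G : SimpleGraph α) (n D : ℝ) (W : Finset α) (I : Finset ι) (A : ι → Finset α),
      n₀ ≤ n → 0 < n → 0 ≤ D → (W.card : ℝ) ≤ n → I.Nonempty → (∀ i ∈ I, A i ⊆ W) →
      (∀ i ∈ I, ((j : ℝ) - 1) * D + η * n ≤ (A i).card) →
      (∀ v ∈ W, ((nonNbrs G W v).card : ℝ) ≤ D) →
      ∃ T : Fin j → Finset α, IsParts G t T ∧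
        δ * I.card ≤ (I.filter fun i => ∀ a, T a ⊆ A i).card := by
  induction j with
  | zero =>
    intro η _
    exact ⟨1, one_pos, 0, fun α ι G n D W I A _ _ _ _ _ _ _ _ =>
      ⟨Fin.elim0, ⟨fun i => i.elim0, fun i => i.elim0⟩, by simp⟩⟩
  | succ j ih =>
    intro η hη
    obtain ⟨δ, hδ0, n₁, ih⟩ := ih η hη
    refine ⟨(δ * η / 4) ^ t * (δ * η / 2), by positivity, max n₁ (t / (δ * η / 4)), ?_⟩
    intro α ι G n D W I A hnn hn hD hW hI hA hcard hWD
    have hn1 : n₁ ≤ n := (le_max_left _ _).trans hnn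
    have hn3 : (t : ℝ) ≤ δ * η / 4 * n := by
      have := (le_max_right _ _).trans hnn
      rwa [div_le_iff₀' (by positivity)] at this
    push_cast at hcard
    have hjD : 0 ≤ (j : ℝ) * D := by positivity
    have hcard' : ∀ i ∈ I, j * D + η * n ≤ (A i).card := fun i hi => by linarith [hcard i hi]
    set J := (I ×ˢ W).filter fun j => j.2 ∈ A j.1 with hJ
    have hJI : ∀ j ∈ J, j.1 ∈ I ∧ j.2 ∈ W ∧ j.2 ∈ A j.1 := fun j hj => by
      simpa [hJ, and_assoc] using hj
    set B : ι × α → Finset α := fun j => (A j.1).filter fun x => ∀ y ∈ [j.2], G.Adj y x with hB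
    have hBcard : ∀ i ∈ J, (j - 1) * D + η * n ≤ (B i).card := by
      intro i hi
      have h1 := card_sub_le_card_common_nbrs (G := G) (hA i.1 (hJI i hi).1) hD 1 [i.2] (by simp)
        (by simpa using hWD _ (hJI i hi).2.1)
      have h2 := hcard' i.1 (hJI i hi).1
      push_cast at h1
      linarith
    have hJne : J.Nonempty := by
      obtain ⟨i, hi⟩ := hI
      have h1 := hcard' i hi
      have h2 : 0 < η * n := by positivity
      have h3 : (0 : ℝ) < (A i).card := by linarith
      obtain ⟨h, hh⟩ := Finset.card_pos.1 (by exact_mod_cast h3)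
      exact ⟨(i, h), by simp [hJ, hi, hh, hA i hi hh]⟩
    obtain ⟨T, hT, hTcard⟩ := ih α (ι × α) G n D W J B hn1 hn hD hW hJne
      (fun i hi => (Finset.filter_subset _ _).trans (hA _ (hJI i hi).1)) hBcard hWD
    obtain ⟨hs, hs1, hs2, hs3⟩ := exists_common_hubs hn hδ0 hη hn3 hW hI hA
      (fun i hi => by have := hcard' i hi; linarith) (Finset.filter_subset _ J) hTcard
    set I' := I.filter fun i => ∀ h ∈ hs, (i, h) ∈ J.filter fun i => ∀ a, T a ⊆ B i with hI'
    have hI'ne : I'.Nonempty := by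
      have h1 : (0 : ℝ) < I.card := by exact_mod_cast hI.card_pos
      have h2 : (0 : ℝ) < I'.card := lt_of_lt_of_le (by positivity) hs3
      exact Finset.card_pos.1 (by exact_mod_cast h2)
    have hmem : ∀ i ∈ I', ∀ h ∈ hs, h ∈ A i ∧ ∀ a, ∀ x ∈ T a, x ∈ A i ∧ G.Adj h x := by
      intro i hi h hh
      have h1 := (Finset.mem_filter.1 hi).2 h hh
      rw [Finset.mem_filter] at h1
      refine ⟨(hJI _ h1.1).2.2, fun a x hx => ?_⟩
      simpa [hB] using h1.2 a hx
    obtain ⟨i₀, hi₀⟩ := hI'ne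
    by_cases ht : t = 0
    · refine ⟨fun _ => ∅, ⟨by simp [ht], by simp⟩, hs3.trans ?_⟩
      exact Nat.cast_le.2 (Finset.card_le_card fun i hi => by
        simp [(Finset.mem_filter.1 hi).1])
    obtain ⟨h₀, hh₀⟩ : ∃ h, h ∈ hs := List.exists_mem_of_length_pos (by omega)
    refine ⟨Fin.cons hs.toFinset T, ⟨fun i => ?_, fun i i' hii' x hx y hy => ?_⟩, hs3.trans ?_⟩
    · refine Fin.cases ?_ (fun i => ?_) i
      · simp [List.toFinset_card_of_nodup hs2, hs1]
      · simpa using hT.1 i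
    · revert hii' hx hy
      refine Fin.cases ?_ (fun i => ?_) i <;> refine Fin.cases ?_ (fun i' => ?_) i'
      · simp
      · simp only [Fin.cons_zero, Fin.cons_succ, List.mem_toFinset]
        exact fun _ hx hy => ((hmem i₀ hi₀ x hx).2 _ y hy).2
      · simp only [Fin.cons_zero, Fin.cons_succ, List.mem_toFinset]
        exact fun _ hx hy => ((hmem i₀ hi₀ y hy).2 _ x hx).2.symm
      · simp only [Fin.cons_succ, ne_eq, Fin.succ_inj]
        exact fun h hx hy => hT.2 i i' h x hx y hy
    · refine Nat.cast_le.2 (Finset.card_le_card fun i hi => Finset.mem_filter.2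
        ⟨(Finset.mem_filter.1 hi).1, fun a => ?_⟩)
      refine Fin.cases ?_ (fun a => ?_) a
      · exact fun x hx => (hmem i hi x (by simpa using hx)).1
      · exact fun x hx => ((hmem i hi h₀ hh₀).2 a x (by simpa using hx)).1

/-- `S` is the vertex set of a complete `k`-partite graph with parts of size `t`. -/
def IsTile (G : SimpleGraph α) (k t : ℕ) (S : Finset α) : Prop :=
  ∃ T : Fin k → Finset α, IsParts G t T ∧ S = Finset.univ.biUnion T

/-- `S` is partitioned into tiles. -/
def Tiled (G : SimpleGraph α) (k t : ℕ) (S : Finset α) : Prop :=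
  ∃ P : Finset (Finset α), (∀ S ∈ P, IsTile G k t S) ∧ (P : Set (Finset α)).PairwiseDisjoint id ∧
    P.biUnion id = S

lemma IsParts.disjoint {T : Fin k → Finset α} (hT : IsParts G t T) {i j : Fin k} (hij : i ≠ j) :
    Disjoint (T i) (T j) :=
  Finset.disjoint_left.2 fun x hx hy => G.loopless.irrefl x (hT.2 i j hij x hx x hy)

lemma IsTile.card {S : Finset α} (h : IsTile G k t S) : S.card = k * t := by
  obtain ⟨T, hT, rfl⟩ := h
  rw [Finset.card_biUnion fun i _ j _ hij => hT.disjoint hij]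
  simp [hT.1]

lemma Tiled.empty : Tiled G k t ∅ := ⟨∅, by simp, by simp, by simp⟩

lemma IsTile.tiled {S : Finset α} (h : IsTile G k t S) : Tiled G k t S :=
  ⟨{S}, by simpa using h, by simp, by simp⟩

lemma Tiled.union {S S' : Finset α} (h : Tiled G k t S) (h' : Tiled G k t S')
    (hd : Disjoint S S') : Tiled G k t (S ∪ S') := by
  obtain ⟨P, hP1, hP2, rfl⟩ := h
  obtain ⟨Q, hQ1, hQ2, rfl⟩ := h'
  refine ⟨P ∪ Q, fun S hS => (Finset.mem_union.1 hS).elim (hP1 S) (hQ1 S), ?_, ?_⟩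
  · rw [Finset.coe_union, Set.pairwiseDisjoint_union]
    refine ⟨hP2, hQ2, fun S hS S' hS' _ => ?_⟩
    exact hd.mono (Finset.subset_biUnion_of_mem id hS) (Finset.subset_biUnion_of_mem id hS')
  · rw [Finset.union_biUnion]

lemma Tiled.biUnion {β : Type*} {I : Finset β} {S : β → Finset α} (h : ∀ i ∈ I, Tiled G k t (S i))
    (hd : (I : Set β).PairwiseDisjoint S) : Tiled G k t (I.biUnion S) := by
  induction I using Finset.induction_on with
  | empty => exact Tiled.empty
  | insert a I ha ih =>
    rw [Finset.biUnion_insert]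
    refine (h a (by simp)).union (ih (fun i hi => h i (by simp [hi]))
      (hd.subset (by simp))) ?_
    rw [Finset.disjoint_biUnion_right]
    exact fun i hi => hd (by simp) (by simp [hi]) (by rintro rfl; exact ha hi)

lemma tiled_of_isParts (r : ℕ) : ∀ {T : Fin k → Finset α}, IsParts G (t * r) T →
    Tiled G k t (Finset.univ.biUnion T) := by
  induction r with
  | zero =>
    intro T hT
    have : Finset.univ.biUnion T = ∅ := by
      have h0 : ∀ i, T i = ∅ := by simpa using hT.1
      ext x
      simp [h0]
    rw [this]
    exact Tiled.empty
  | succ r ih =>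
    intro T hT
    have hsub : ∀ i, ∃ S ⊆ T i, S.card = t := fun i =>
      Finset.exists_subset_card_eq (by rw [hT.1 i]; exact Nat.le_mul_of_pos_right t r.succ_pos)
    choose S hS hSc using hsub
    have h1 : IsParts G t S := ⟨hSc, fun i j hij x hx y hy => hT.2 i j hij x (hS i hx) y (hS j hy)⟩
    have h2 : IsParts G (t * r) fun i => T i \ S i := by
      refine ⟨fun i => ?_, fun i j hij x hx y hy =>
        hT.2 i j hij x (Finset.mem_sdiff.1 hx).1 y (Finset.mem_sdiff.1 hy).1⟩
      rw [Finset.card_sdiff_of_subset (hS i), hT.1, hSc, mul_add, mul_one, Nat.add_sub_cancel]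
    have h3 : Finset.univ.biUnion T =
        Finset.univ.biUnion S ∪ Finset.univ.biUnion fun i => T i \ S i := by
      ext x
      simp only [Finset.mem_biUnion, Finset.mem_univ, true_and, Finset.mem_union,
        Finset.mem_sdiff]
      constructor
      · rintro ⟨i, hi⟩
        by_cases h : x ∈ S i
        · exact Or.inl ⟨i, h⟩
        · exact Or.inr ⟨i, hi, h⟩
      · rintro (⟨i, hi⟩ | ⟨i, hi, -⟩)
        exacts [⟨i, hS i hi⟩, ⟨i, hi⟩]
    rw [h3]
    refine (IsTile.tiled ⟨S, h1, rfl⟩).union (ih h2) ?_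
    rw [Finset.disjoint_biUnion_left]
    intro i _
    rw [Finset.disjoint_biUnion_right]
    intro j _
    rcases eq_or_ne i j with rfl | hij
    · exact Finset.disjoint_sdiff
    · exact (hT.disjoint hij).mono (hS i) Finset.sdiff_subset

lemma Tiled.of_mul {r : ℕ} {S : Finset α} (h : Tiled G k (t * r) S) : Tiled G k t S := by
  obtain ⟨P, hP1, hP2, rfl⟩ := h
  refine Tiled.biUnion (fun S hS => ?_) hP2
  obtain ⟨T, hT, rfl⟩ := hP1 S hS
  exact tiled_of_isParts r hT

lemma exists_disjoint_pieces (t : ℕ) : ∀ (k : ℕ) (C : Finset α), k * t ≤ C.card →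
    ∃ P : Fin k → Finset α, (∀ i, P i ⊆ C) ∧ (∀ i, (P i).card = t) ∧
      ∀ i j, i ≠ j → Disjoint (P i) (P j) := by
  intro k
  induction k with
  | zero => exact fun C _ => ⟨Fin.elim0, fun i => i.elim0, fun i => i.elim0, fun i => i.elim0⟩
  | succ k ih =>
    intro C hC
    rw [add_mul, one_mul] at hC
    obtain ⟨S, hS, hSc⟩ := Finset.exists_subset_card_eq (show t ≤ C.card by omega)
    obtain ⟨P, hP1, hP2, hP3⟩ := ih (C \ S) (by rw [Finset.card_sdiff_of_subset hS]; omega)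
    have hd : ∀ i, Disjoint S (P i) := fun i => Finset.disjoint_sdiff.mono_right (hP1 i)
    refine ⟨Fin.cons S P, fun i => ?_, fun i => ?_, fun i j => ?_⟩
    · refine Fin.cases hS (fun i => ?_) i
      exact (hP1 i).trans Finset.sdiff_subset
    · exact Fin.cases hSc hP2 i
    · refine Fin.cases ?_ (fun i => ?_) i <;> refine Fin.cases ?_ (fun j => ?_) j
      · simp
      · exact fun _ => hd j
      · exact fun _ => (hd i).symm
      · exact fun h => hP3 i j (by simpa using h)

/-- A large tile together with a few vertices having many common neighbours in each part splits
into smaller tiles. -/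
lemma tiled_union_of_common_nbrs {N : ℕ} {T : Fin k → Finset α}
    (hT : IsParts G (t * N) T) {Y : Finset α} (hY : Y.card = k * t)
    (hYT : ∀ i, Disjoint Y (T i)) {C : Fin k → Finset α} (hCT : ∀ i, C i ⊆ T i)
    (hC : ∀ i, k * t ≤ (C i).card) (hYC : ∀ y ∈ Y, ∀ i, ∀ x ∈ C i, G.Adj y x) :
    Tiled G k t (Finset.univ.biUnion T ∪ Y) := by
  obtain ⟨Z, hZ1, hZ2, hZ3⟩ := exists_disjoint_pieces t k Y hY.ge
  have hP := fun j => exists_disjoint_pieces t k (C j) (hC j)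
  choose P hP1 hP2 hP3 using hP
  have hZY : Finset.univ.biUnion Z = Y := by
    refine Finset.eq_of_subset_of_card_le (Finset.biUnion_subset.2 fun i _ => hZ1 i) ?_
    rw [Finset.card_biUnion fun i _ j _ hij => hZ3 i j hij, hY]
    simp [hZ2]
  set S : Fin k → Fin k → Finset α := fun i j => if j = i then Z i else P j i with hS
  have hSparts : ∀ i, IsParts G t (S i) := by
    intro i
    refine ⟨fun j => ?_, fun j j' hjj' x hx y hy => ?_⟩
    · simp only [hS]; split_ifs; exacts [hZ2 i, hP2 j i]
    · simp only [hS] at hx hy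
      split_ifs at hx hy with h1 h2
      · exact absurd (h1.trans h2.symm) hjj'
      · exact hYC x (hZ1 i hx) j' y (hP1 j' i hy)
      · exact (hYC y (hZ1 i hy) j x (hP1 j i hx)).symm
      · exact hT.2 j j' hjj' x (hCT j (hP1 j i hx)) y (hCT j' (hP1 j' i hy))
  set U : Fin k → Finset α := fun j => (Finset.univ.erase j).biUnion (P j) with hU
  have hUT : ∀ j, U j ⊆ T j := fun j => Finset.biUnion_subset.2 fun i _ =>
    (hP1 j i).trans (hCT j)
  have hUcard : ∀ j, (U j).card = (k - 1) * t := by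
    intro j
    rw [hU, Finset.card_biUnion fun i _ i' _ hii' => hP3 j i i' hii']
    simp [hP2]
  have hR : IsParts G (t * (N - (k - 1))) fun j => T j \ U j := by
    refine ⟨fun j => ?_, fun i j hij x hx y hy =>
      hT.2 i j hij x (Finset.mem_sdiff.1 hx).1 y (Finset.mem_sdiff.1 hy).1⟩
    rw [Finset.card_sdiff_of_subset (hUT j), hT.1, hUcard, Nat.mul_sub, mul_comm (k - 1)]
  have hmemS : ∀ i x, x ∈ Finset.univ.biUnion (S i) ↔ x ∈ Z i ∨ ∃ j, j ≠ i ∧ x ∈ P j i := by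
    intro i x
    simp only [hS, Finset.mem_biUnion, Finset.mem_univ, true_and]
    constructor
    · rintro ⟨j, hj⟩
      split_ifs at hj with h
      exacts [Or.inl hj, Or.inr ⟨j, h, hj⟩]
    · rintro (h | ⟨j, hj, hx⟩)
      · exact ⟨i, by simpa using h⟩
      · exact ⟨j, by simpa [hj] using hx⟩
  have hYTx : ∀ x ∈ Y, ∀ i, x ∉ T i := fun x hx i => Finset.disjoint_left.1 (hYT i) hx
  have hunion : Finset.univ.biUnion T ∪ Y = (Finset.univ.biUnion fun i =>
      Finset.univ.biUnion (S i)) ∪ Finset.univ.biUnion fun j => T j \ U j := by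
    ext x
    rw [Finset.mem_union, Finset.mem_union, Finset.mem_biUnion, Finset.mem_biUnion,
      Finset.mem_biUnion]
    simp only [hmemS, Finset.mem_univ, true_and, Finset.mem_sdiff, ← hZY, Finset.mem_biUnion, hU,
      Finset.mem_erase, not_exists, not_and, and_true]
    constructor
    · rintro (⟨j, hj⟩ | ⟨i, hi⟩)
      · by_cases h : ∃ i, i ≠ j ∧ x ∈ P j i
        · obtain ⟨i, hi, hx⟩ := h
          exact Or.inl ⟨i, Or.inr ⟨j, hi.symm, hx⟩⟩
        · push Not at h
          exact Or.inr ⟨j, hj, h⟩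
      · exact Or.inl ⟨i, Or.inl hi⟩
    · rintro (⟨i, hi | ⟨j, -, hx⟩⟩ | ⟨j, hj, -⟩)
      · exact Or.inr ⟨i, hi⟩
      · exact Or.inl ⟨j, hCT j (hP1 j i hx)⟩
      · exact Or.inl ⟨j, hj⟩
  rw [hunion]
  refine (Tiled.biUnion (fun i _ => IsTile.tiled ⟨S i, hSparts i, rfl⟩) ?_).union
    (tiled_of_isParts _ hR) ?_
  · intro i _ i' _ hii'
    refine Finset.disjoint_left.2 fun x hx hx' => ?_
    rw [hmemS] at hx hx'
    rcases hx with hx | ⟨j, hj, hx⟩ <;> rcases hx' with hx' | ⟨j', hj', hx'⟩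
    · exact Finset.disjoint_left.1 (hZ3 i i' hii') hx hx'
    · exact hYTx x (hZ1 i hx) j' (hCT _ (hP1 _ _ hx'))
    · exact hYTx x (hZ1 i' hx') j (hCT _ (hP1 _ _ hx))
    · rcases eq_or_ne j j' with rfl | hjj'
      · exact Finset.disjoint_left.1 (hP3 j i i' hii') hx hx'
      · exact Finset.disjoint_left.1 (hT.disjoint hjj') (hCT _ (hP1 _ _ hx)) (hCT _ (hP1 _ _ hx'))
  · refine Finset.disjoint_left.2 fun x hx hx' => ?_
    obtain ⟨i, -, hx⟩ := Finset.mem_biUnion.1 hx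
    obtain ⟨j, -, hx'⟩ := Finset.mem_biUnion.1 hx'
    rw [Finset.mem_sdiff] at hx'
    rcases (hmemS i x).1 hx with hx | ⟨j', hj', hx⟩
    · exact hYTx x (hZ1 i hx) j hx'.1
    · rcases eq_or_ne j' j with rfl | hjj'
      · exact hx'.2 (Finset.mem_biUnion.2 ⟨i, by simpa using hj'.symm, hx⟩)
      · exact Finset.disjoint_left.1 (hT.disjoint hjj') (hCT _ (hP1 _ _ hx)) hx'.1

end Tiles

section NearCover

open Classical

variable {α : Type} {G : SimpleGraph α} {k t : ℕ}

lemma exists_parts_of_isTile {S : Finset α} (h : IsTile G k t S) {ν : ℝ} :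
    ∃ T : Fin k → Finset α, IsParts G t T ∧ S = Finset.univ.biUnion T ∧
      ∀ v, ((nonNbrs G S v).card : ℝ) ≤ (1 - ν) * t →
        ∀ i, ν * t ≤ ((T i).filter fun x => G.Adj v x).card := by
  obtain ⟨T, hT, rfl⟩ := h
  refine ⟨T, hT, rfl, fun v hv i => ?_⟩
  have h1 := nonNbrs_card_mono (G := G) (Finset.subset_biUnion_of_mem T (Finset.mem_univ i)) v
  have h2 := Finset.card_filter_add_card_filter_not (s := T i) (fun x => G.Adj v x)
  rw [hT.1 i] at h2
  have h3 : (((T i).filter fun x => G.Adj v x).card : ℝ) + (nonNbrs G (T i) v).card = t := by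
    rw [nonNbrs]
    exact_mod_cast h2
  linarith

/-- Vertices which see linearly many tiles well can be absorbed into some of these tiles. -/
lemma exists_tiled_union {t N : ℕ} {P : Finset (Finset α)} {Q : Finset α} {ν : ℝ} (hν : 0 < ν)
    (hν1 : ν ≤ 1) (hN : k ≤ ν * N) (hP : ∀ S ∈ P, IsTile G k (t * N) S)
    (hPd : (P : Set (Finset α)).PairwiseDisjoint id) (hPQ : ∀ S ∈ P, Disjoint Q S)
    (hgood : ∀ v ∈ Q, ν * P.card ≤
      (P.filter fun S => ((nonNbrs G S v).card : ℝ) ≤ (1 - ν) * (t * N : ℕ)).card)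
    (hQ : (2 : ℝ) ^ (k * (t * N)) * (k * t) ≤ ν / 4 * Q.card) :
    ∀ a : ℕ, (a : ℝ) ≤ ν / 2 * P.card → 2 * (k * t * a) ≤ Q.card →
      ∃ 𝒜 ⊆ P, 𝒜.card = a ∧ ∃ Z ⊆ Q, Z.card = k * t * a ∧ Tiled G k t (𝒜.biUnion id ∪ Z) := by
  intro a
  induction a with
  | zero => exact fun _ _ => ⟨∅, by simp, by simp, ∅, by simp, by simp, by simpa using Tiled.empty⟩
  | succ a ih =>
    intro haP haQ
    push_cast at haP
    obtain ⟨𝒜, h𝒜, h𝒜c, Z, hZ, hZc, htiled⟩ := ih (by linarith) (by nlinarith)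
    have hPcard : (a : ℝ) < P.card := by nlinarith [(Nat.cast_nonneg P.card : (0 : ℝ) ≤ _)]
    have hcardP' : (P \ 𝒜).card = P.card - a := by rw [Finset.card_sdiff_of_subset h𝒜, h𝒜c]
    have hP'ne : (P \ 𝒜).Nonempty := by
      rw [← Finset.card_pos, hcardP']
      have : a < P.card := by exact_mod_cast hPcard
      omega
    set good : α → Finset (Finset α) := fun v =>
      P.filter fun S => ((nonNbrs G S v).card : ℝ) ≤ (1 - ν) * (t * N : ℕ) with hgooddef
    obtain ⟨S, hS, hSw⟩ := exists_weight_ge (Q \ Z) (w := fun _ => (1 : ℝ))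
      (fun _ _ => zero_le_one) hP'ne
      (A := fun v => good v \ 𝒜)
      (fun v _ => Finset.sdiff_subset_sdiff (Finset.filter_subset _ _) le_rfl)
      (n := P.card) (κ := ν / 2) (by positivity) (Nat.cast_le.2 (Finset.card_le_card
        Finset.sdiff_subset)) (fun v hv => by
        have h1 := hgood v (Finset.mem_sdiff.1 hv).1
        have h2 : ((good v).card : ℝ) ≤ (good v \ 𝒜).card + 𝒜.card := by
          exact_mod_cast Finset.card_le_card_sdiff_add_card
        rw [h𝒜c] at h2
        linarith)
    simp only [Finset.sum_const, nsmul_eq_mul, mul_one] at hSw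
    rw [Finset.mem_sdiff] at hS
    obtain ⟨T, hT, hST, hTgood⟩ := exists_parts_of_isTile (hP S hS.1) (ν := ν)
    set F := (Q \ Z).filter fun v => S ∈ good v \ 𝒜 with hF
    have hSF : ν / 2 * ((Q \ Z).card : ℝ) ≤ F.card := by
      refine hSw.trans (Nat.cast_le.2 (Finset.card_le_card fun v hv => ?_))
      simpa [hF] using hv
    have hQZ : (Q.card : ℝ) / 2 ≤ (Q \ Z).card := by
      rw [Finset.card_sdiff_of_subset hZ, hZc]
      have h1 : 2 * (k * t * a) ≤ Q.card := by nlinarith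
      rw [Nat.cast_sub (by omega)]
      have h2 : (2 : ℝ) * ((k * t * a : ℕ) : ℝ) ≤ Q.card := by exact_mod_cast h1
      linarith
    have hFcard : S.powerset.card * (k * t) ≤ F.card := by
      rw [Finset.card_powerset, (hP S hS.1).card]
      have h1 : (2 : ℝ) ^ (k * (t * N)) * (k * t) ≤ F.card := by
        have h2 : ν / 2 * ((Q.card : ℝ) / 2) ≤ ν / 2 * (Q \ Z).card := by gcongr
        linarith [h2, hQ, hSF]
      exact_mod_cast h1
    obtain ⟨C, hC, hCF⟩ := Finset.exists_le_card_fiber_of_mul_le_card_of_maps_to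
      (f := fun v => S.filter fun x => G.Adj v x)
      (fun v _ => Finset.mem_powerset.2 (Finset.filter_subset _ S)) ⟨∅, by simp⟩ hFcard
    obtain ⟨Y, hYF, hYc⟩ := Finset.exists_subset_card_eq hCF
    have hY : ∀ y ∈ Y, (y ∈ Q ∧ y ∉ Z) ∧ ((nonNbrs G S y).card : ℝ) ≤ (1 - ν) * (t * N : ℕ) ∧
        (S.filter fun x => G.Adj y x) = C := by
      intro y hy
      have h1 := Finset.mem_filter.1 (hYF hy)
      have h2 := Finset.mem_filter.1 h1.1
      have h3 := Finset.mem_filter.1 (Finset.mem_sdiff.1 h2.2).1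
      exact ⟨Finset.mem_sdiff.1 h2.1, h3.2, h1.2⟩
    have hnew : Tiled G k t (S ∪ Y) := by
      rcases Y.eq_empty_or_nonempty with hY0 | ⟨y, hy⟩
      · rw [hY0, Finset.union_empty]
        exact (hP S hS.1).tiled.of_mul
      have hTS : ∀ i, T i ⊆ S := fun i => by
        rw [hST]; exact Finset.subset_biUnion_of_mem T (Finset.mem_univ i)
      have hdis : ∀ i, Disjoint Y (T i) := fun i =>
        ((hPQ S hS.1).mono_right (hTS i)).mono_left fun y hy => (hY y hy).1.1
      rw [hST]
      refine tiled_union_of_common_nbrs hT hYc hdis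
        (C := fun i => (T i).filter fun x => G.Adj y x) (fun i => Finset.filter_subset _ _)
        (fun i => ?_) (fun y' hy' i x hx => ?_)
      · have h1 := hTgood y (hY y hy).2.1 i
        have h2 : (k * t : ℝ) ≤ ν * (t * N : ℕ) := by
          push_cast
          have : (k : ℝ) * t ≤ ν * N * t := by gcongr
          linarith
        exact_mod_cast h2.trans h1
      · rw [Finset.mem_filter] at hx
        have h1 : x ∈ S.filter fun x => G.Adj y x := Finset.mem_filter.2 ⟨hTS i hx.1, hx.2⟩
        rw [(hY y hy).2.2, ← (hY y' hy').2.2] at h1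
        exact (Finset.mem_filter.1 h1).2
    have hYQ : Y ⊆ Q := fun y hy => (hY y hy).1.1
    have hYZ : Disjoint Y Z := Finset.disjoint_left.2 fun y hy => (hY y hy).1.2
    refine ⟨insert S 𝒜, Finset.insert_subset hS.1 h𝒜,
      by rw [Finset.card_insert_of_notMem hS.2, h𝒜c],
      Y ∪ Z, Finset.union_subset hYQ hZ,
      by rw [Finset.card_union_of_disjoint hYZ, hYc, hZc]; ring, ?_⟩
    rw [Finset.biUnion_insert, id, Finset.union_union_union_comm]
    refine hnew.union htiled ?_
    rw [Finset.disjoint_union_left, Finset.disjoint_union_right, Finset.disjoint_union_right,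
      Finset.disjoint_biUnion_right, Finset.disjoint_biUnion_right]
    refine ⟨⟨fun A hA => hPd hS.1 (h𝒜 hA) ?_, ((hPQ S hS.1).mono_left hZ).symm⟩,
      fun A hA => (hPQ A (h𝒜 hA)).mono_left hYQ, hYZ⟩
    rintro rfl
    exact hS.2 hA

lemma card_nonNbrs_biUnion {P : Finset (Finset α)}
    (hPd : (P : Set (Finset α)).PairwiseDisjoint id) (v : α) :
    (nonNbrs G (P.biUnion id) v).card = ∑ S ∈ P, (nonNbrs G S v).card := by
  rw [nonNbrs, Finset.filter_biUnion, Finset.card_biUnion]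
  · rfl
  · exact fun S hS S' hS' h => Finset.disjoint_filter_filter (hPd hS hS' h)

lemma card_good_tiles_ge {t : ℕ} (ht : 0 < t) {P : Finset (Finset α)} {ν : ℝ} (hν1 : ν < 1)
    (hPd : (P : Set (Finset α)).PairwiseDisjoint id) {v : α}
    (hv : ((nonNbrs G (P.biUnion id) v).card : ℝ) ≤ (1 - 2 * ν) * (t * P.card)) :
    ν * P.card ≤ (P.filter fun S => ((nonNbrs G S v).card : ℝ) ≤ (1 - ν) * t).card := by
  have h1 := Finset.card_filter_add_card_filter_not (s := P)
    (fun S => ((nonNbrs G S v).card : ℝ) ≤ (1 - ν) * t)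
  set a := (P.filter fun S => ((nonNbrs G S v).card : ℝ) ≤ (1 - ν) * t).card
  set Bd := P.filter fun S => ¬ ((nonNbrs G S v).card : ℝ) ≤ (1 - ν) * t with hBd
  have h2 : (a : ℝ) + Bd.card = P.card := by exact_mod_cast h1
  have h3 : (1 - ν) * t * Bd.card ≤ (nonNbrs G (P.biUnion id) v).card := by
    rw [card_nonNbrs_biUnion hPd, Nat.cast_sum]
    calc (1 - ν) * t * Bd.card = ∑ S ∈ Bd, (1 - ν) * t := by
          rw [Finset.sum_const, nsmul_eq_mul, mul_comm]
      _ ≤ ∑ S ∈ Bd, ((nonNbrs G S v).card : ℝ) :=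
          Finset.sum_le_sum fun S hS => (not_le.1 (Finset.mem_filter.1 hS).2).le
      _ ≤ _ := Finset.sum_le_sum_of_subset_of_nonneg (Finset.filter_subset _ _)
          fun _ _ _ => Nat.cast_nonneg _
  have ht' : (0 : ℝ) < t := by exact_mod_cast ht
  have h4 : (1 - ν) * Bd.card ≤ (1 - 2 * ν) * P.card := by
    refine le_of_mul_le_mul_left ?_ ht'
    linarith
  have h5 : (1 - ν) * (Bd.card : ℝ) ≤ (1 - ν) * ((1 - ν) * P.card) := by
    have : 0 ≤ ν ^ 2 * (P.card : ℝ) := by positivity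
    linarith
  have h6 := le_of_mul_le_mul_left h5 (by linarith)
  linarith

end NearCover

section NearCover

open Classical

variable {α : Type} {G : SimpleGraph α} {k t : ℕ}

lemma card_nonNbrs_add_sdiff {S V : Finset α} (h : S ⊆ V) (v : α) :
    (nonNbrs G S v).card + (nonNbrs G (V \ S) v).card = (nonNbrs G V v).card := by
  rw [nonNbrs, nonNbrs, nonNbrs, ← Finset.card_union_of_disjoint, ← Finset.filter_union,
    Finset.union_sdiff_of_subset h]
  exact Finset.disjoint_filter_filter Finset.disjoint_sdiff

/-- A tile-free set of vertices has many vertices of low degree inside it. -/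
lemma card_low_degree_ge (hk : 1 ≤ k) (t : ℕ) : ∃ n₀ : ℝ, ∀ (α : Type) (G : SimpleGraph α)
    (L : Finset α) (D : ℝ), n₀ ≤ L.card → 0 < L.card → 0 ≤ D → k * D ≤ L.card →
    (∀ S ⊆ L, ¬ IsTile G k t S) →
    (L.card : ℝ) / (2 * k) ≤ (L.filter fun v => D < (nonNbrs G L v).card).card := by
  have hk0 : (0 : ℝ) < k := by exact_mod_cast hk
  obtain ⟨δ, hδ, n₀, h⟩ := exists_parts_in_family t k (1 / (2 * k)) (by positivity)
  refine ⟨n₀, fun α G L D hn hL hD hkD hfree => ?_⟩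
  by_contra! hcon
  have hL' : (0 : ℝ) < L.card := by exact_mod_cast hL
  have h1 := Finset.card_filter_add_card_filter_not (s := L) (fun v => D < (nonNbrs G L v).card)
  set L' := L.filter fun v => ¬ D < (nonNbrs G L v).card with hL'def
  have h1' : ((L.filter fun v => D < (nonNbrs G L v).card).card : ℝ) + L'.card = L.card := by
    exact_mod_cast h1
  have hsub : L' ⊆ L := Finset.filter_subset _ _
  obtain ⟨T, hT, hTc⟩ := h α Unit G L.card D L' Finset.univ (fun _ => L') hn hL' hD
    (by exact_mod_cast Finset.card_le_card hsub) (by simp) (by simp) (fun _ _ => by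
      have h2 : (L.card : ℝ) / (2 * k) = 1 / (2 * k) * L.card := by ring
      have h3 : 1 / (2 * k) * (L.card : ℝ) * (2 * k) = L.card := by field_simp
      have h4 : D ≤ 1 / (2 * k) * (L.card : ℝ) * 2 := by
        refine le_of_mul_le_mul_left ?_ hk0
        linarith
      have h6 : (k - 1 : ℝ) * D ≤ (k - 1) * (1 / (2 * k) * (L.card : ℝ) * 2) :=
        mul_le_mul_of_nonneg_left h4 (by linarith [(Nat.one_le_cast (α := ℝ)).2 hk])
      linarith) (fun v hv =>
      (nonNbrs_card_mono hsub v).trans (not_lt.1 (Finset.mem_filter.1 hv).2))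
  have h5 : (0 : ℝ) < ((Finset.univ : Finset Unit).filter fun _ => ∀ a, T a ⊆ L').card :=
    lt_of_lt_of_le (by simpa using hδ) hTc
  obtain ⟨_, hx⟩ := Finset.card_pos.1 (Nat.cast_pos.1 h5)
  exact hfree _ (Finset.biUnion_subset.2 fun i _ => ((Finset.mem_filter.1 hx).2 i).trans hsub)
    ⟨T, hT, rfl⟩

lemma exists_larger_tiling (hk : 1 ≤ k) {μ ε : ℝ} (hμ : 0 < μ) (hε : 0 < ε) :
    ∃ N : ℕ, 0 < N ∧ ∃ g : ℝ, 0 < g ∧ ∀ t : ℕ, 0 < t → ∃ n₀ : ℝ, ∀ (α : Type) (G : SimpleGraph α)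
      (V : Finset α), n₀ ≤ V.card → 0 < V.card →
      (∀ v ∈ V, ((nonNbrs G V v).card : ℝ) ≤ (1 / k - μ) * V.card) → ∀ S ⊆ V,
      Tiled G k (t * N) S → ε * V.card < (V \ S).card → (∀ S' ⊆ V \ S, ¬ IsTile G k (t * N) S') →
      ∃ S' ⊆ V, Tiled G k t S' ∧ S.card + g * V.card ≤ S'.card := by
  have hk0 : (0 : ℝ) < k := by exact_mod_cast hk
  set ν : ℝ := k * μ / 2 with hν
  have hν0 : 0 < ν := by positivity
  set N : ℕ := ⌈k / ν⌉₊ with hNdef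
  have hN : 0 < N := Nat.ceil_pos.2 (by positivity)
  have hN0 : (0 : ℝ) < N := by exact_mod_cast hN
  have hkN : k ≤ ν * N := by
    have := Nat.le_ceil (k / ν)
    rwa [div_le_iff₀' hν0] at this
  set x₀ : ℝ := min (ν ^ 2 * ε / (2 * k * N)) (ε / (4 * k ^ 2)) with hx₀
  have hx0 : 0 < x₀ := by positivity
  refine ⟨N, hN, k * x₀ / 2, by positivity, fun t ht => ?_⟩
  have ht0 : (0 : ℝ) < t := by exact_mod_cast ht
  obtain ⟨n₁, hlow⟩ := card_low_degree_ge hk (t * N)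
  refine ⟨max (max (n₁ / ε) (2 * t / x₀))
    ((2 : ℝ) ^ (k * (t * N)) * (k * t) * (2 * k) * 4 / (ν * ε)), ?_⟩
  intro α G V hn hV hdeg S hS hSt hL hfree
  have hn1 : n₁ ≤ ε * V.card := by
    have := (le_max_left _ _).trans ((le_max_left _ _).trans hn)
    rwa [div_le_iff₀' hε] at this
  have hn2 : 2 * t ≤ x₀ * V.card := by
    have := (le_max_right _ _).trans ((le_max_left _ _).trans hn)
    rwa [div_le_iff₀' hx0] at this
  have hn3 : (2 : ℝ) ^ (k * (t * N)) * (k * t) * (2 * k) * 4 ≤ ν * ε * V.card := by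
    have := (le_max_right _ _).trans hn
    rwa [div_le_iff₀' (by positivity)] at this
  have hV0 : (0 : ℝ) < V.card := by exact_mod_cast hV
  have hμk : 0 ≤ 1 / k - μ := by
    obtain ⟨v, hv⟩ := Finset.card_pos.1 hV
    have h1 := (Nat.cast_nonneg _).trans (hdeg v hv)
    exact nonneg_of_mul_nonneg_left h1 hV0
  have hkμ : k * (1 / k - μ) = 1 - 2 * ν := by rw [hν]; field_simp
  have hν1 : 2 * ν ≤ 1 := by
    have : 0 ≤ k * (1 / k - μ) := by positivity
    linarith
  set L := V \ S with hLdef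
  have hL0 : (0 : ℝ) < L.card := lt_trans (by positivity) hL
  set D : ℝ := (1 / k - μ / 2) * L.card with hD
  have hQ := hlow α G L D (by linarith) (by exact_mod_cast hL0)
    (mul_nonneg (by linarith) hL0.le) (by
      have h1 : k * D = (1 - ν) * L.card := by rw [hD, hν]; field_simp
      rw [h1]
      have : 0 ≤ ν * L.card := by positivity
      linarith) hfree
  set Q := L.filter fun v => D < (nonNbrs G L v).card with hQdef
  have hQL : Q ⊆ L := Finset.filter_subset _ _
  obtain ⟨P, hP, hPd, hPS⟩ := hSt
  have hScard : (S.card : ℝ) = k * (t * N) * P.card := by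
    have h1 : S.card = P.card * (k * (t * N)) := by
      rw [← hPS, Finset.card_biUnion hPd]
      exact Finset.sum_const_nat fun S hS => (hP S hS).card
    rw [h1]
    push_cast
    ring
  have hVcard : (V.card : ℝ) = S.card + L.card := by
    rw [hLdef, ← Finset.card_sdiff_add_card_eq_card hS]
    push_cast
    ring
  have hSQ : ∀ v ∈ Q, ((nonNbrs G S v).card : ℝ) ≤ (1 / k - μ) * S.card - μ / 2 * L.card := by
    intro v hv
    have h1 : ((nonNbrs G S v).card : ℝ) + (nonNbrs G L v).card = (nonNbrs G V v).card := by
      exact_mod_cast card_nonNbrs_add_sdiff hS v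
    have h2 := (Finset.mem_filter.1 hv).2
    have h3 := hdeg v (Finset.mem_sdiff.1 (hQL hv)).1
    rw [hVcard] at h3
    rw [hD] at h2
    linarith
  have hQ0 : (0 : ℝ) < Q.card := lt_of_lt_of_le (by positivity) hQ
  have hSL : ν * L.card ≤ S.card := by
    obtain ⟨v, hv⟩ := Finset.card_pos.1 (Nat.cast_pos.1 hQ0)
    have h1 := (Nat.cast_nonneg _).trans (hSQ v hv)
    have h2 : 0 ≤ k * ((1 / k - μ) * S.card - μ / 2 * L.card) := by positivity
    have h3 : k * ((1 / k - μ) * S.card - μ / 2 * L.card) =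
      k * (1 / k - μ) * S.card - ν * L.card := by rw [hν]; ring
    rw [h3, hkμ] at h2
    have : 0 ≤ ν * (S.card : ℝ) := by positivity
    linarith
  have hPcard : ν * ε * V.card ≤ k * (t * N) * P.card := by
    rw [← hScard]
    have : ν * (ε * V.card) ≤ ν * L.card := by gcongr
    linarith
  have hεQ : ε * V.card ≤ 2 * k * Q.card := by
    rw [div_le_iff₀' (by positivity)] at hQ
    linarith
  set a : ℕ := ⌊x₀ * V.card / t⌋₊ with ha
  have ha1 : (a : ℝ) * t ≤ x₀ * V.card := by
    have := Nat.floor_le (show 0 ≤ x₀ * V.card / t by positivity)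
    rwa [le_div_iff₀ ht0] at this
  have ha2 : x₀ * V.card ≤ (a + 1) * t := by
    have := (Nat.lt_floor_add_one (x₀ * V.card / t)).le
    rwa [div_le_iff₀ ht0] at this
  have hx1 : x₀ * (2 * k * N) ≤ ν ^ 2 * ε := by
    rw [← le_div_iff₀ (by positivity)]
    exact min_le_left _ _
  have hx2 : x₀ * (4 * k ^ 2) ≤ ε := by
    rw [← le_div_iff₀ (by positivity)]
    exact min_le_right _ _
  have haP : (a : ℝ) ≤ ν / 2 * P.card := by
    have h1 : (2 * k * N * t) * (a : ℝ) ≤ (2 * k * N * t) * (ν / 2 * P.card) :=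
      calc (2 * k * N * t) * (a : ℝ) = 2 * k * N * (a * t) := by ring
        _ ≤ 2 * k * N * (x₀ * V.card) := by gcongr
        _ = x₀ * (2 * k * N) * V.card := by ring
        _ ≤ ν ^ 2 * ε * V.card := by gcongr
        _ = ν * (ν * ε * V.card) := by ring
        _ ≤ ν * (k * (t * N) * P.card) := by gcongr
        _ = _ := by ring
    exact le_of_mul_le_mul_left h1 (by positivity)
  have haQ : 2 * (k * t * a) ≤ Q.card := by
    have h1 : 2 * k * (2 * (k * t * a : ℝ)) ≤ 2 * k * Q.card :=
      calc 2 * k * (2 * (k * t * a : ℝ)) = 4 * k ^ 2 * (a * t) := by ring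
        _ ≤ 4 * k ^ 2 * (x₀ * V.card) := by gcongr
        _ = x₀ * (4 * k ^ 2) * V.card := by ring
        _ ≤ ε * V.card := by gcongr
        _ ≤ _ := hεQ
    exact_mod_cast le_of_mul_le_mul_left h1 (by positivity)
  have hdisj : Disjoint S L := Finset.disjoint_sdiff
  obtain ⟨𝒜, h𝒜, -, Z, hZ, hZc, htiled⟩ := exists_tiled_union (G := G) (t := t) (Q := Q) hν0
    (by linarith) hkN hP hPd (fun T hT => by
      refine Disjoint.symm (hdisj.mono ?_ hQL)
      rw [← hPS]
      exact Finset.subset_biUnion_of_mem id hT)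
    (fun v hv => card_good_tiles_ge (by positivity) (by linarith) hPd (by
      rw [hPS]
      refine (hSQ v hv).trans ?_
      rw [hScard, ← hkμ]
      push_cast
      have : 0 ≤ μ / 2 * L.card := by positivity
      linarith))
    (by
      have h1 : 2 * k * 4 * ((2 : ℝ) ^ (k * (t * N)) * (k * t)) ≤ 2 * k * 4 * (ν / 4 * Q.card) := by
        have : ν * (ε * V.card) ≤ ν * (2 * k * Q.card) := by gcongr
        linarith
      exact le_of_mul_le_mul_left h1 (by positivity)) a haP haQ
  have hrest : Tiled G k t ((P \ 𝒜).biUnion id) :=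
    Tiled.biUnion (fun T hT => (hP T (Finset.mem_sdiff.1 hT).1).tiled.of_mul)
      (hPd.subset (by exact_mod_cast Finset.sdiff_subset))
  have hall : (P \ 𝒜).biUnion id ∪ (𝒜.biUnion id ∪ Z) = S ∪ Z := by
    rw [← Finset.union_assoc, ← Finset.union_biUnion, Finset.sdiff_union_of_subset h𝒜, hPS]
  have hZS : Disjoint S Z := hdisj.mono_right (hZ.trans hQL)
  refine ⟨S ∪ Z, Finset.union_subset hS ((hZ.trans hQL).trans Finset.sdiff_subset), ?_, ?_⟩
  · rw [← hall]
    refine hrest.union htiled ?_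
    rw [Finset.disjoint_union_right]
    refine ⟨?_, hZS.mono_left ?_⟩
    · rw [Finset.disjoint_biUnion_left]
      intro T hT
      rw [Finset.disjoint_biUnion_right]
      intro T' hT'
      refine hPd (Finset.mem_sdiff.1 hT).1 (h𝒜 hT') ?_
      rintro rfl
      exact (Finset.mem_sdiff.1 hT).2 hT'
    · rw [← hPS]
      exact Finset.biUnion_subset_biUnion_of_subset_left _ Finset.sdiff_subset
  · rw [Finset.card_union_of_disjoint hZS, hZc]
    push_cast
    have h1 : x₀ * V.card / 2 ≤ a * t := by linarith
    have h2 : k * (x₀ * V.card / 2) ≤ k * (a * t) := by gcongr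
    linarith

/-- Almost all vertices of a graph of large minimum degree can be covered by tiles. -/
theorem exists_near_cover (hk : 1 ≤ k) {μ ε : ℝ} (hμ : 0 < μ) (hε : 0 < ε) {t : ℕ} (ht : 0 < t) :
    ∃ n₀ : ℝ, ∀ (α : Type) (G : SimpleGraph α) (V : Finset α), n₀ ≤ V.card →
      (∀ v ∈ V, ((nonNbrs G V v).card : ℝ) ≤ (1 / k - μ) * V.card) →
      ∃ S ⊆ V, Tiled G k t S ∧ ((V \ S).card : ℝ) ≤ ε * V.card := by
  obtain ⟨N, hN, g, hg, hlarger⟩ := exists_larger_tiling hk hμ hε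
  have key : ∀ r : ℕ, ∀ t : ℕ, 0 < t → ∃ n₀ : ℝ, ∀ (α : Type) (G : SimpleGraph α) (V : Finset α),
      n₀ ≤ V.card → 0 < V.card → (∀ v ∈ V, ((nonNbrs G V v).card : ℝ) ≤ (1 / k - μ) * V.card) →
      ∃ S ⊆ V, Tiled G k t S ∧
        (((V \ S).card : ℝ) ≤ ε * V.card ∨ r * g * V.card ≤ S.card) := by
    intro r
    induction r with
    | zero =>
      exact fun t _ => ⟨0, fun α G V _ _ _ => ⟨∅, by simp, Tiled.empty, by simp⟩⟩
    | succ r ih =>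
      intro t ht
      obtain ⟨n₁, h₁⟩ := ih (t * N) (by positivity)
      obtain ⟨n₂, h₂⟩ := hlarger t ht
      refine ⟨max n₁ n₂, fun α G V hn hV hdeg => ?_⟩
      obtain ⟨S₀, hS₀, hS₀t, hS₀c⟩ := h₁ α G V ((le_max_left _ _).trans hn) hV hdeg
      obtain ⟨S, hS, hmax⟩ := Finset.exists_max_image
        (V.powerset.filter fun S => Tiled G k (t * N) S) Finset.card
        ⟨S₀, by simp [hS₀, hS₀t]⟩
      rw [Finset.mem_filter, Finset.mem_powerset] at hS
      have hSS₀ : S₀.card ≤ S.card := hmax S₀ (by simp [hS₀, hS₀t])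
      rcases le_or_gt ((V \ S).card : ℝ) (ε * V.card) with h | h
      · exact ⟨S, hS.1, hS.2.of_mul, Or.inl h⟩
      obtain ⟨S', hS', hS't, hS'c⟩ := h₂ α G V ((le_max_right _ _).trans hn) hV hdeg S hS.1 hS.2 h
        (fun T hT hTt => by
          have hd : Disjoint S T := Finset.disjoint_sdiff.mono_right hT
          have h3 := hmax (S ∪ T) (by
            rw [Finset.mem_filter, Finset.mem_powerset]
            exact ⟨Finset.union_subset hS.1 (hT.trans Finset.sdiff_subset),
              hS.2.union hTt.tiled hd⟩)
          rw [Finset.card_union_of_disjoint hd, hTt.card] at h3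
          have : 0 < k * (t * N) := by positivity
          omega)
      refine ⟨S', hS', hS't, Or.inr ?_⟩
      have h5 : (S₀.card : ℝ) ≤ S.card := by exact_mod_cast hSS₀
      rcases hS₀c with h4 | h4
      · exfalso
        rw [Finset.card_sdiff_of_subset hS₀, Nat.cast_sub (Finset.card_le_card hS₀)] at h4
        rw [Finset.card_sdiff_of_subset hS.1, Nat.cast_sub (Finset.card_le_card hS.1)] at h
        linarith
      · push_cast
        linarith
  obtain ⟨r, hr⟩ := exists_nat_gt (1 / g)
  obtain ⟨n₀, h⟩ := key r t ht
  refine ⟨max n₀ 1, fun α G V hn hdeg => ?_⟩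
  have hV : (0 : ℝ) < V.card := by linarith [(le_max_right n₀ 1).trans hn]
  obtain ⟨S, hS, hSt, hSc⟩ := h α G V ((le_max_left _ _).trans hn) (by exact_mod_cast hV) hdeg
  refine ⟨S, hS, hSt, hSc.resolve_right fun h1 => ?_⟩
  rw [div_lt_iff₀ hg] at hr
  have h2 : (S.card : ℝ) ≤ V.card := by exact_mod_cast Finset.card_le_card hS
  have h3 : 1 * (V.card : ℝ) < r * g * V.card := by gcongr
  linarith

end NearCover

section Absorb

open Classical

variable {α : Type} {G : SimpleGraph α} {ℓ : ℕ}

lemma IsTile.exists_powChain {t : ℕ} {S : Finset α} (h : IsTile G (ℓ + 1) t S) :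
    ∃ L : List α, L.Nodup ∧ L.toFinset = S ∧ PowChain G ℓ L := by
  obtain ⟨T, hT, rfl⟩ := h
  have e : ∀ i, Fin t ≃ T i := fun i => (Finset.equivFinOfCardEq (hT.1 i)).symm
  set f : Fin (t * (ℓ + 1)) → α := fun p =>
    e (finProdFinEquiv.symm p).2 (finProdFinEquiv.symm p).1 with hf
  have hfmem : ∀ p, f p ∈ T (finProdFinEquiv.symm p).2 := fun p => (e _ _).2
  have hinj : Function.Injective f := by
    intro p q hpq
    refine finProdFinEquiv.symm.injective ?_
    have h2 : (finProdFinEquiv.symm p).2 = (finProdFinEquiv.symm q).2 := by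
      by_contra hne
      exact Finset.disjoint_left.1 (hT.disjoint hne) (hfmem p) (hpq ▸ hfmem q)
    revert hpq h2
    simp only [hf]
    generalize finProdFinEquiv.symm p = x
    generalize finProdFinEquiv.symm q = y
    rintro hxy h2
    obtain ⟨a, i⟩ := x
    obtain ⟨b, j⟩ := y
    obtain rfl : i = j := h2
    exact Prod.ext ((e i).injective (Subtype.ext hxy)) rfl
  refine ⟨List.ofFn f, List.nodup_ofFn.2 hinj, ?_, powChain_iff_getElem.2 fun i j hij hj hjl => ?_⟩
  · ext x
    simp only [List.mem_toFinset, List.mem_ofFn, Finset.mem_biUnion, Finset.mem_univ, true_and]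
    constructor
    · rintro ⟨p, rfl⟩
      exact ⟨_, hfmem p⟩
    · rintro ⟨i, hi⟩
      exact ⟨finProdFinEquiv ((e i).symm ⟨x, hi⟩, i), by
        refine (congrArg (fun x : Fin t × Fin (ℓ + 1) => (e x.2 x.1 : α))
          (finProdFinEquiv.symm_apply_apply ((e i).symm ⟨x, hi⟩, i))).trans ?_
        simp only [Equiv.apply_symm_apply]⟩
  · rw [List.length_ofFn] at hj
    rw [List.getElem_ofFn, List.getElem_ofFn]
    refine hT.2 _ _ (fun h => ?_) _ (hfmem _) _ (hfmem _)
    have h1 := congrArg Fin.val h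
    simp only [finProdFinEquiv, Equiv.coe_fn_symm_mk, Fin.modNat] at h1
    have h2 : (j - i) % (ℓ + 1) = 0 := Nat.sub_mod_eq_zero_of_mod_eq h1.symm
    rw [Nat.mod_eq_of_lt (by omega)] at h2
    omega

lemma PowChain.insert_absorber {P B C S : List α} {v : α} (hB : B.length = ℓ)
    (hC : C.length = ℓ) (h : PowChain G ℓ (P ++ (B ++ C) ++ S)) (hv : ∀ y ∈ B ++ C, G.Adj v y) :
    PowChain G ℓ (P ++ (B ++ v :: C) ++ S) := by
  rcases ℓ with _ | ℓ
  · exact powChain_zero _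
  have h1 : PowChain G (ℓ + 1) (B ++ v :: C) :=
    PowChain.insert_hub hB.le hC.le ((h.left_of_append.right_of_append).mono ℓ.le_succ) hv
  have h2 : PowChain G (ℓ + 1) (P ++ B) := by
    rw [← List.append_assoc] at h
    exact h.left_of_append.left_of_append
  have h3 : PowChain G (ℓ + 1) (P ++ B ++ v :: C) := PowChain.glue hB.ge h1 h2
  have h4 : PowChain G (ℓ + 1) (C ++ S) := by
    rw [← List.append_assoc, List.append_assoc] at h
    exact h.right_of_append
  have h5 := PowChain.glue (A := P ++ B ++ [v]) hC.ge h4 (by simpa using h3)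
  simpa using h5

/-- Leftover vertices can be inserted into the absorbers of a chain. -/
lemma exists_absorb {P S : List α} : ∀ (B : List α) (segs 𝒜 rest : List (List α)),
    segs.Perm (𝒜 ++ rest) → (∀ A ∈ 𝒜, A.length = 2 * ℓ) →
    (∀ v ∈ B, B.length ≤ 𝒜.countP fun A => ∀ y ∈ A, G.Adj v y) →
    PowChain G ℓ (P ++ segs.flatten ++ S) →
    ∃ L : List α, L.Perm (segs.flatten ++ B) ∧ PowChain G ℓ (P ++ L ++ S)
  | [], segs, _, _, _, _, _, h => ⟨segs.flatten, by simp, h⟩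
  | v :: B, segs, 𝒜, rest, hperm, hlen, hcount, h => by
    obtain ⟨A, hA, hAv⟩ : ∃ A ∈ 𝒜, ∀ y ∈ A, G.Adj v y := by
      have h1 : 0 < 𝒜.countP fun A => ∀ y ∈ A, G.Adj v y :=
        lt_of_lt_of_le (by simp) (hcount v (by simp))
      simpa using List.countP_pos_iff.1 h1
    obtain ⟨s₁, s₂, rfl⟩ := List.append_of_mem (hperm.mem_iff.2 (List.mem_append_left _ hA))
    have hAperm := List.perm_cons_erase hA
    have hAlen := hlen A hA
    set A' := A.take ℓ ++ v :: A.drop ℓ with hA'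
    have hA'perm : A'.Perm (v :: A) := by
      refine List.perm_middle.trans ?_
      rw [List.take_append_drop]
    have hperm' : (s₁ ++ A' :: s₂).Perm (𝒜.erase A ++ A' :: rest) := by
      refine List.perm_middle.trans (List.Perm.trans ?_ List.perm_middle.symm)
      refine List.Perm.cons _ ?_
      have h1 : (A :: (s₁ ++ s₂)).Perm (A :: (𝒜.erase A ++ rest)) :=
        (List.perm_middle.symm.trans hperm).trans (hAperm.append_right rest)
      exact h1.cons_inv
    have h' : PowChain G ℓ (P ++ (s₁ ++ A' :: s₂).flatten ++ S) := by
      have h1 := PowChain.insert_absorber (G := G) (ℓ := ℓ) (P := P ++ s₁.flatten) (B := A.take ℓ)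
        (C := A.drop ℓ) (S := s₂.flatten ++ S) (v := v) (by simp; omega) (by simp; omega)
        (by simpa using h) (by simpa using hAv)
      simpa [hA'] using h1
    obtain ⟨L, hL, hLc⟩ := exists_absorb B (s₁ ++ A' :: s₂) (𝒜.erase A) (A' :: rest) hperm'
      (fun A hA => hlen A (List.mem_of_mem_erase hA)) (fun u hu => by
        have h1 := hcount u (by simp [hu])
        rw [hAperm.countP_eq, List.countP_cons] at h1
        simp only [List.length_cons] at h1
        split_ifs at h1 <;> omega) h'
    refine ⟨L, hL.trans ?_, hLc⟩
    have h2 : (s₁ ++ A' :: s₂).flatten.Perm ((s₁ ++ A :: s₂).flatten ++ [v]) := by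
      have h3 : (s₁ ++ A' :: s₂).Perm (A' :: (s₁ ++ s₂)) := List.perm_middle
      have h4 : (s₁ ++ A :: s₂).Perm (A :: (s₁ ++ s₂)) := List.perm_middle
      refine h3.flatten.trans (List.Perm.trans ?_ (h4.flatten.append_right [v]).symm)
      simp only [List.flatten_cons]
      refine (hA'perm.append_right _).trans ?_
      exact (List.perm_append_singleton v (A ++ (s₁ ++ s₂).flatten)).symm
    have h5 := h2.append_right B
    simpa using h5

/-- Chains can be linked through a set of vertices of high degree. -/
lemma exists_link (ℓ : ℕ) {η : ℝ} (hη : 0 < η) : ∃ n₀ : ℝ, ∀ (α : Type) (G : SimpleGraph α)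
    (n D : ℝ), n₀ ≤ n → 0 < n → 0 ≤ D → ∀ (Qs : List (List α)) (X Y : List α) (W : Finset α),
      (W.card : ℝ) ≤ n →
      (ℓ + 1) * D + η * n + (2 * ℓ * (ℓ + 1) : ℕ) * (Qs.length + 1) ≤ W.card →
      (∀ v ∈ W, ((nonNbrs G W v).card : ℝ) ≤ D) →
      (∀ v ∈ X ++ Y ++ Qs.flatten, ((nonNbrs G W v).card : ℝ) ≤ D) →
      PowChain G ℓ X → PowChain G ℓ Y → (∀ Q ∈ Qs, PowChain G ℓ Q ∧ ℓ ≤ Q.length) →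
      ∃ mid Cs : List (List α), mid.Perm (Qs ++ Cs) ∧ Cs.flatten.Nodup ∧
        (∀ x ∈ Cs.flatten, x ∈ W) ∧
        Cs.flatten.length = 2 * ℓ * (ℓ + 1) * (Qs.length + 1) ∧
        PowChain G ℓ (X ++ mid.flatten ++ Y) := by
  obtain ⟨δ, hδ, n₀, hconn⟩ := exists_connecting_chain ℓ η hη
  refine ⟨n₀, fun α G n D hn hn0 hD Qs => ?_⟩
  have hconn' : ∀ (W : Finset α) (X Y : List α), (W.card : ℝ) ≤ n → (ℓ + 1) * D + η * n ≤ W.card →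
      (∀ v ∈ W, ((nonNbrs G W v).card : ℝ) ≤ D) → (∀ v ∈ X, ((nonNbrs G W v).card : ℝ) ≤ D) →
      (∀ v ∈ Y, ((nonNbrs G W v).card : ℝ) ≤ D) → PowChain G ℓ X → PowChain G ℓ Y →
      ∃ z : List α, z.length = 2 * ℓ * (ℓ + 1) ∧ z.Nodup ∧ PowChain G ℓ (X ++ z ++ Y) ∧
        ∀ x ∈ z, x ∈ W := by
    intro W X Y hW hWc hWD hXD hYD hX hY
    obtain ⟨z, h1, h2, h3, h4⟩ := hconn α Unit G n D W Finset.univ (fun _ => W) X Y hn hn0 hD hW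
      (by simp) (by simp) (fun _ _ => hWc) hWD hXD hYD hX hY
    refine ⟨z, h1, h2, h3, ?_⟩
    have h5 : (0 : ℝ) < ((Finset.univ : Finset Unit).filter fun _ => ∀ x ∈ z, x ∈ W).card :=
      lt_of_lt_of_le (by simpa using hδ) h4
    obtain ⟨_, hx⟩ := Finset.card_pos.1 (Nat.cast_pos.1 h5)
    exact (Finset.mem_filter.1 hx).2
  induction Qs with
  | nil =>
    intro X Y W hW hWc hWD hXY hX hY _
    have h0 : (0 : ℝ) ≤ (2 * ℓ * (ℓ + 1) : ℕ) * (([] : List (List α)).length + 1) := by positivity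
    obtain ⟨z, h1, h2, h3, h4⟩ := hconn' W X Y hW (by linarith) hWD
      (fun v hv => hXY v (by simp [hv])) (fun v hv => hXY v (by simp [hv])) hX hY
    exact ⟨[z], [z], by simp, by simpa using h2, by simpa using h4, by simp [h1], by simpa using h3⟩
  | cons Q Qs ih =>
    intro X Y W hW hWc hWD hXY hX hY hQs
    have h0 : (0 : ℝ) ≤ (2 * ℓ * (ℓ + 1) : ℕ) * ((Q :: Qs).length + 1) := by positivity
    obtain ⟨z, h1, h2, h3, h4⟩ := hconn' W X Q hW (by linarith) hWD
      (fun v hv => hXY v (by simp [hv])) (fun v hv => hXY v (by simp [hv])) hX (hQs Q (by simp)).1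
    have hzW : z.toFinset ⊆ W := fun x hx => h4 x (by simpa using hx)
    have hmono : ∀ v, ((nonNbrs G (W \ z.toFinset) v).card : ℝ) ≤ (nonNbrs G W v).card :=
      fun v => nonNbrs_card_mono Finset.sdiff_subset v
    have hcard : ((W \ z.toFinset).card : ℝ) = W.card - (2 * ℓ * (ℓ + 1) : ℕ) := by
      rw [Finset.card_sdiff_of_subset hzW, List.toFinset_card_of_nodup h2, h1, Nat.cast_sub]
      rw [← h1, ← List.toFinset_card_of_nodup h2]
      exact Finset.card_le_card hzW
    obtain ⟨mid, Cs, hm1, hm2, hm3, hm4, hm5⟩ := ih Q Y (W \ z.toFinset)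
      ((Nat.cast_le.2 (Finset.card_le_card Finset.sdiff_subset)).trans hW) (by
        rw [hcard]
        simp only [List.length_cons, Nat.cast_add, Nat.cast_one] at hWc
        linarith)
      (fun v hv => (hmono v).trans (hWD v (Finset.mem_sdiff.1 hv).1))
      (fun v hv => (hmono v).trans (hXY v (by
        simp only [List.mem_append, List.flatten_cons] at hv ⊢
        tauto)))
      (hQs Q (by simp)).1 hY (fun Q' hQ' => hQs Q' (by simp [hQ']))
    refine ⟨z :: Q :: mid, z :: Cs, ?_, ?_, ?_, ?_, ?_⟩
    · refine List.Perm.trans ?_ List.perm_middle.symm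
      exact (hm1.cons Q).cons z
    · rw [List.flatten_cons, List.nodup_append]
      refine ⟨h2, hm2, fun x hx y hy => ?_⟩
      rintro rfl
      exact (Finset.mem_sdiff.1 (hm3 x hy)).2 (by simpa using hx)
    · intro x hx
      rw [List.flatten_cons, List.mem_append] at hx
      exact hx.elim (h4 x) fun hx => (Finset.mem_sdiff.1 (hm3 x hx)).1
    · rw [List.flatten_cons, List.length_append, h1, hm4, List.length_cons]
      ring
    · have := PowChain.glue (A := X ++ z) (E := Q) (B := mid.flatten ++ Y) (hQs Q (by simp)).2
        (by simpa using hm5) h3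
      simpa using this

end Absorb

section Block

open Classical

variable {α : Type} {G : SimpleGraph α} {ℓ : ℕ}

lemma Tiled.exists_powChains {t : ℕ} {S : Finset α} (h : Tiled G (ℓ + 1) t S) :
    ∃ Qs : List (List α), (∀ Q ∈ Qs, PowChain G ℓ Q ∧ Q.length = (ℓ + 1) * t) ∧
      Qs.flatten.Nodup ∧ Qs.flatten.toFinset = S := by
  obtain ⟨P, hP, hPd, rfl⟩ := h
  induction P using Finset.induction_on with
  | empty => exact ⟨[], by simp, by simp, by simp⟩
  | insert S P hS ih =>
    obtain ⟨Qs, h1, h2, h3⟩ := ih (fun T hT => hP T (by simp [hT])) (hPd.subset (by simp))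
    obtain ⟨L, hL1, hL2, hL3⟩ := (hP S (by simp)).exists_powChain
    have hLlen : L.length = (ℓ + 1) * t := by
      rw [← List.toFinset_card_of_nodup hL1, hL2, (hP S (by simp)).card]
    refine ⟨L :: Qs, ?_, ?_, ?_⟩
    · intro Q hQ
      rcases List.mem_cons.1 hQ with rfl | hQ
      exacts [⟨hL3, hLlen⟩, h1 Q hQ]
    · rw [List.flatten_cons, List.nodup_append]
      refine ⟨hL1, h2, fun x hx y hy => ?_⟩
      rintro rfl
      rw [← List.mem_toFinset, hL2] at hx
      rw [← List.mem_toFinset, h3, Finset.mem_biUnion] at hy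
      obtain ⟨T, hT, hxT⟩ := hy
      exact Finset.disjoint_left.1 (hPd (by simp) (by simp [hT]) (by rintro rfl; exact hS hT))
        hx hxT
    · rw [List.flatten_cons, List.toFinset_append, hL2, h3, Finset.biUnion_insert, id]

lemma card_filter_adj (W : Finset α) (v : α) :
    ((W.filter fun x => G.Adj v x).card : ℝ) = W.card - (nonNbrs G W v).card := by
  rw [eq_sub_iff_add_eq, nonNbrs]
  exact_mod_cast Finset.card_filter_add_card_filter_not (s := W) (fun x => G.Adj v x)

lemma card_sub_length_le (W : Finset α) (L : List α) :
    (W.card : ℝ) - L.length ≤ (W \ L.toFinset).card := by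
  have h1 : W.card ≤ (W \ L.toFinset).card + L.toFinset.card :=
    Finset.card_le_card_sdiff_add_card
  have h2 := L.toFinset_card_le
  have h3 : (W.card : ℝ) ≤ (W \ L.toFinset).card + L.length := by exact_mod_cast (by omega)
  linarith

/-- A family of disjoint absorbers such that every vertex has many of them. -/
lemma exists_absorber_family {κ : ℝ} (hκ : 0 < κ) (hκ1 : κ ≤ 1) {K : ℕ}
    (hK : (1 - κ ^ (2 * ℓ) / 2) ^ K ≤ 1 / 4) {W V : Finset α} {D : ℝ} {s : ℕ} (hD : 0 ≤ D)
    (hW : 0 < W.card) (hV : V.Nonempty) (hVs : (V.card : ℝ) ≤ 2 ^ s)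
    (hWD : ∀ v ∈ W, ((nonNbrs G W v).card : ℝ) ≤ D)
    (hVW : ∀ v ∈ V, ℓ * D + κ * W.card + (2 * ℓ : ℕ) + 2 * ℓ * (K * s) ≤
      (W.filter fun x => G.Adj v x).card) :
    ∃ 𝒜 : List (List α), 𝒜.length = K * s ∧ (∀ A ∈ 𝒜, A.length = 2 * ℓ ∧ PowChain G ℓ A) ∧
      𝒜.flatten.Nodup ∧ (∀ x ∈ 𝒜.flatten, x ∈ W) ∧ 𝒜.flatten.length = 2 * ℓ * (K * s) ∧
      ∀ v ∈ V, s ≤ 𝒜.countP fun A => ∀ y ∈ A, G.Adj v y := by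
  set c := κ ^ (2 * ℓ) with hc
  have hc1 : c ≤ 1 := pow_le_one₀ hκ.le hκ1
  have key : ∀ M ≤ K * s, ∃ 𝒜 : List (List α), 𝒜.length = M ∧
      (∀ A ∈ 𝒜, A.length = 2 * ℓ ∧ PowChain G ℓ A) ∧ 𝒜.flatten.Nodup ∧
      (∀ x ∈ 𝒜.flatten, x ∈ W) ∧ 𝒜.flatten.length = 2 * ℓ * M ∧
      ∑ v ∈ V, (1 / 2 : ℝ) ^ (𝒜.countP fun A => ∀ y ∈ A, G.Adj v y) ≤
        (1 - c / 2) ^ M * V.card := by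
    intro M
    induction M with
    | zero => exact fun _ => ⟨[], by simp, by simp, by simp, by simp, by simp, by simp⟩
    | succ M ih =>
      intro hM
      obtain ⟨𝒜, h1, h2, h3, h4, h5, h6⟩ := ih (by omega)
      set w : α → ℝ := fun v => (1 / 2 : ℝ) ^ (𝒜.countP fun A => ∀ y ∈ A, G.Adj v y) with hw
      have hw0 : ∀ v, 0 < w v := fun v => by positivity
      set W' := W \ 𝒜.flatten.toFinset with hW'
      have hMs : (M : ℝ) ≤ K * s := by exact_mod_cast (by omega : M ≤ K * s)
      obtain ⟨z, hz1, hz2, hz3, hz4, hz5⟩ := exists_chain_in_family (G := G) (ℓ := ℓ)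
        (n := W.card) (κ := κ) (D := D) (by exact_mod_cast hW) hκ hD (fun v => (hw0 v).le) (2 * ℓ)
        W' V (fun v => W'.filter fun x => G.Adj v x) []
        (by exact_mod_cast Finset.card_le_card Finset.sdiff_subset)
        (Finset.sum_pos (fun v _ => hw0 v) hV) (fun v _ => Finset.filter_subset _ _)
        (fun v hv => by
          have g1 := hVW v hv
          have g2 := card_sub_length_le W 𝒜.flatten
          have g3 := nonNbrs_card_mono (G := G) (Finset.sdiff_subset : W' ⊆ W) v
          rw [card_filter_adj] at g1 ⊢
          rw [h5] at g2
          have g4 : (2 : ℝ) * ℓ * M ≤ 2 * ℓ * (K * s) := by gcongr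
          push_cast at g1 g2 ⊢
          linarith)
        (fun v hv => (nonNbrs_card_mono Finset.sdiff_subset v).trans
          (hWD v (Finset.mem_sdiff.1 hv).1)) (by simp) trivial
      refine ⟨z :: 𝒜, by simp [h1], ?_, ?_, ?_, ?_, ?_⟩
      · intro A hA
        rcases List.mem_cons.1 hA with rfl | hA
        exacts [⟨hz1, by simpa using hz4⟩, h2 A hA]
      · rw [List.flatten_cons, List.nodup_append]
        refine ⟨hz2, h3, fun x hx y hy => ?_⟩
        rintro rfl
        exact (Finset.mem_sdiff.1 (hz3 x hx)).2 (by simpa using hy)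
      · intro x hx
        rw [List.flatten_cons, List.mem_append] at hx
        exact hx.elim (fun hx => (Finset.mem_sdiff.1 (hz3 x hx)).1) (h4 x)
      · rw [List.flatten_cons, List.length_append, hz1, h5]
        ring
      · have g1 : ∀ v ∈ V, (1 / 2 : ℝ) ^ ((z :: 𝒜).countP fun A => ∀ y ∈ A, G.Adj v y) ≤
            w v - (if ∀ x ∈ z, x ∈ W'.filter fun x => G.Adj v x then w v else 0) / 2 := by
          intro v _
          rw [List.countP_cons]
          split_ifs with g2 g3 g3
          · rw [pow_succ]
            exact (by ring : w v * (1 / 2) = w v - w v / 2).le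
          · rw [pow_succ, zero_div, sub_zero]
            exact mul_le_of_le_one_right (hw0 v).le (by norm_num)
          · exact absurd (by simpa using fun y hy => (Finset.mem_filter.1 (g3 y hy)).2) g2
          · simp [hw]
        refine (Finset.sum_le_sum g1).trans ?_
        rw [Finset.sum_sub_distrib, ← Finset.sum_div, ← Finset.sum_filter]
        have g2 : ∑ v ∈ V, w v - (c * ∑ v ∈ V, w v) / 2 = (1 - c / 2) * ∑ v ∈ V, w v := by ring
        calc _ ≤ ∑ v ∈ V, w v - (c * ∑ v ∈ V, w v) / 2 := by gcongr
          _ = (1 - c / 2) * ∑ v ∈ V, w v := g2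
          _ ≤ (1 - c / 2) * ((1 - c / 2) ^ M * V.card) :=
            mul_le_mul_of_nonneg_left h6 (by linarith)
          _ = _ := by ring
  obtain ⟨𝒜, h1, h2, h3, h4, h5, h6⟩ := key (K * s) le_rfl
  refine ⟨𝒜, h1, h2, h3, h4, h5, fun v hv => ?_⟩
  by_contra! hcon
  have g1 : (1 / 2 : ℝ) ^ s < (1 / 2) ^ (𝒜.countP fun A => ∀ y ∈ A, G.Adj v y) :=
    pow_lt_pow_right_of_lt_one₀ (by norm_num) (by norm_num) hcon
  have g2 := Finset.single_le_sum (f := fun v => (1 / 2 : ℝ) ^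
    (𝒜.countP fun A => ∀ y ∈ A, G.Adj v y)) (fun v _ => by positivity) hv
  have g3 : (1 - c / 2) ^ (K * s) * V.card ≤ (1 / 4 : ℝ) ^ s * 2 ^ s := by
    rw [pow_mul]
    gcongr
    exact pow_nonneg (by linarith) K
  rw [← mul_pow, show (1 / 4 * 2 : ℝ) = 1 / 2 by norm_num] at g3
  exact absurd (g1.trans_le (g2.trans (h6.trans g3))) (lt_irrefl _)

lemma le_two_pow_of_mul_le {a n : ℝ} {s : ℕ} (ha : 0 < a) (hn : 8 / a ^ 2 ≤ n) (hs : a * n ≤ s) :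
    n ≤ 2 ^ s := by
  have hn0 : 0 ≤ n := le_trans (by positivity) hn
  have h1 : (s : ℝ) / 2 ≤ s * Real.log 2 := by
    have := Real.log_two_gt_d9
    have hs0 : (0 : ℝ) ≤ s := Nat.cast_nonneg s
    nlinarith
  have h2 : (2 : ℝ) ^ s = Real.exp (s * Real.log 2) := by
    rw [mul_comm, Real.exp_mul, Real.exp_log two_pos, Real.rpow_natCast]
  have h3 := Real.quadratic_le_exp_of_nonneg (show 0 ≤ a * n / 2 by positivity)
  have h4 : Real.exp (a * n / 2) ≤ 2 ^ s := by
    rw [h2]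
    exact Real.exp_le_exp.2 (by linarith)
  have h5 : n ≤ (a * n / 2) ^ 2 / 2 := by
    rw [div_le_iff₀ (by positivity)] at hn
    have : 8 * n ≤ n * a ^ 2 * n := mul_le_mul_of_nonneg_right hn hn0
    linarith
  have : 0 ≤ a * n / 2 := by positivity
  linarith

end Block

section Block

open Classical

set_option maxHeartbeats 2000000 in
/-- A set split into two parts, to both of which all vertices have large degree, is spanned by a
chain with prescribed ends. -/
theorem exists_spanning_chain {ℓ : ℕ} (hℓ : 1 ≤ ℓ) {μ : ℝ} (hμ : 0 < μ) :
    ∃ q : ℕ, 2 ≤ q ∧ ∃ b₀ : ℕ, ∀ (α : Type) (G : SimpleGraph α) (R U : Finset α) (X Y : List α),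
      Disjoint R U → b₀ ≤ (R ∪ U).card → q * R.card ≤ (R ∪ U).card →
      (R ∪ U).card ≤ 2 * q * R.card →
      (∀ v ∈ R ∪ U, ((nonNbrs G R v).card : ℝ) ≤ (1 / (ℓ + 1) - μ) * R.card) →
      (∀ v ∈ R ∪ U, ((nonNbrs G U v).card : ℝ) ≤ (1 / (ℓ + 1) - μ) * U.card) →
      X.length = ℓ → Y.length = ℓ → (X ++ Y).Nodup → (∀ v ∈ X ++ Y, v ∈ R ∪ U) →
      PowChain G ℓ X → PowChain G ℓ Y →
      ∃ M : List α, (X ++ M ++ Y).Nodup ∧ (X ++ M ++ Y).toFinset = R ∪ U ∧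
        PowChain G ℓ (X ++ M ++ Y) := by
  have hℓ0 : (1 : ℝ) ≤ ℓ := by exact_mod_cast hℓ
  set κ := min μ 1 with hκdef
  have hκ : 0 < κ := lt_min hμ one_pos
  have hκ1 : κ ≤ 1 := min_le_right _ _
  have hκμ : κ ≤ μ := min_le_left _ _
  have hc0 : 0 < κ ^ (2 * ℓ) := by positivity
  obtain ⟨K, hK⟩ := exists_pow_lt_of_lt_one (show (0 : ℝ) < 1 / 4 by norm_num)
    (show 1 - κ ^ (2 * ℓ) / 2 < 1 by linarith)
  obtain ⟨n₁, hlink⟩ := exists_link ℓ (show 0 < μ / 2 by positivity)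
  set m : ℕ := 2 * ℓ * (ℓ + 1) with hm
  set c₁ : ℝ := 2 * ℓ * K + m * K with hc₁
  have hc₁0 : 0 ≤ c₁ := by positivity
  set a : ℝ := μ / (8 * (c₁ + 1)) with ha
  have ha0 : 0 < a := by positivity
  set q : ℕ := max 2 ⌈2 / a⌉₊ with hq
  have hq2 : 2 ≤ q := le_max_left _ _
  have hq2' : (2 : ℝ) ≤ q := by exact_mod_cast hq2
  have hqa : 2 ≤ a * q := by
    have h1 : 2 / a ≤ q := (Nat.le_ceil _).trans (Nat.cast_le.2 (le_max_right _ _))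
    rwa [div_le_iff₀' ha0] at h1
  set t : ℕ := ⌈16 * q * m / μ⌉₊ + 1 with ht
  have ht0 : 0 < t := Nat.succ_pos _
  have htm : 16 * q * m ≤ μ * t := by
    have h1 : 16 * q * m / μ ≤ t := (Nat.le_ceil _).trans (Nat.cast_le.2 (Nat.le_succ _))
    rwa [div_le_iff₀' hμ] at h1
  obtain ⟨n₂, hcover⟩ := exists_near_cover (k := ℓ + 1) (ε := a / 2) (by omega)
    (show 0 < μ / 2 by positivity) (by positivity) ht0
  set b₁ : ℝ := max (max (8 * (c₁ + m + 4 * ℓ) / μ) (2 * q * (8 * (m + 2 * ℓ)) / μ))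
    (max (8 / a ^ 2) (max (2 * q * max n₁ 1) (4 * max n₂ 1))) with hb₁
  refine ⟨q, hq2, ⌈b₁⌉₊, ?_⟩
  intro α G R U X Y hRU hb hqR hRq hdegR hdegU hXl hYl hXYn hXYV hX hY
  set n : ℝ := ((R ∪ U).card : ℝ) with hn
  have hbn : b₁ ≤ n := (Nat.le_ceil _).trans (Nat.cast_le.2 hb)
  have hb1 : 8 * (c₁ + m + 4 * ℓ) ≤ μ * n := by
    have := ((le_max_left _ _).trans (le_max_left _ _)).trans hbn
    rwa [div_le_iff₀' hμ] at this
  have hb2 : 2 * q * (8 * (m + 2 * ℓ)) ≤ μ * n := by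
    have := ((le_max_right _ _).trans (le_max_left _ _)).trans hbn
    rwa [div_le_iff₀' hμ] at this
  have hb3 : 8 / a ^ 2 ≤ n := ((le_max_left _ _).trans (le_max_right _ _)).trans hbn
  have hb4 : 2 * q * max n₁ 1 ≤ n :=
    (((le_max_left _ _).trans (le_max_right _ _)).trans (le_max_right _ _)).trans hbn
  have hb5 : 4 * max n₂ 1 ≤ n :=
    (((le_max_right _ _).trans (le_max_right _ _)).trans (le_max_right _ _)).trans hbn
  clear_value b₁
  set r : ℝ := (R.card : ℝ) with hr
  set u : ℝ := (U.card : ℝ) with hu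
  have hnru : n = r + u := by
    rw [hn, hr, hu, Finset.card_union_of_disjoint hRU, Nat.cast_add]
  have hqr : q * r ≤ n := by rw [hr, hn]; exact_mod_cast hqR
  have hnqr : n ≤ 2 * q * r := by rw [hr, hn]; exact_mod_cast hRq
  have hr0 : 0 ≤ r := Nat.cast_nonneg _
  have hrn : 2 * r ≤ n := le_trans (by gcongr) hqr
  have hun : n ≤ 2 * u := by linarith
  have hn1r : max n₁ 1 ≤ r := by
    refine le_of_mul_le_mul_left (hb4.trans hnqr) (by positivity)
  have hr1 : 1 ≤ r := (le_max_right _ _).trans hn1r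
  have hru : r ≤ u := by linarith
  have hn0 : 0 < n := by linarith
  have hu0 : 0 < u := by linarith
  set θ : ℝ := 1 / (ℓ + 1) - μ with hθ
  have hVne : (R ∪ U).Nonempty := Finset.card_pos.1 (Nat.cast_pos.1 hn0)
  have hθ0 : 0 ≤ θ := by
    obtain ⟨v, hv⟩ := hVne
    exact nonneg_of_mul_nonneg_left ((Nat.cast_nonneg _).trans (hdegU v hv)) hu0
  have hθℓ : (ℓ + 1) * θ = 1 - (ℓ + 1) * μ := by rw [hθ]; field_simp
  have hμ1 : μ ≤ 1 / 2 := by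
    have h1 : 1 / ((ℓ : ℝ) + 1) ≤ 1 / 2 := by gcongr; linarith
    linarith
  have hℓμ : 2 * μ ≤ (ℓ + 1) * μ := by gcongr; linarith
  set s : ℕ := ⌈a * n⌉₊ with hs
  have hs1 : a * n ≤ s := Nat.le_ceil _
  have hs2 : (s : ℝ) ≤ a * n + 1 := (Nat.ceil_lt_add_one (by positivity)).le
  have hVs : n ≤ 2 ^ s := le_two_pow_of_mul_le ha0 hb3 hs1
  have hbudget : c₁ * s + m + 4 * ℓ ≤ μ / 2 * u := by
    have h1 : a * (8 * (c₁ + 1)) = μ := by rw [ha]; field_simp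
    have h2 : c₁ * s ≤ c₁ * (a * n + 1) := by gcongr
    have h3 : 8 * (c₁ * a * n) ≤ μ * n := by
      rw [← h1]
      have : 0 ≤ a * n := by positivity
      linarith
    have h4 : μ * n ≤ μ * (2 * u) := by gcongr
    linarith
  have hℓKs : (0 : ℝ) ≤ 2 * ℓ * (K * s) := by positivity
  have hmKs : (0 : ℝ) ≤ m * (K * s) := by positivity
  have hbud' : 2 * ℓ * (K * s) + m * (K * s) + m + 4 * ℓ ≤ μ / 2 * u := by
    have : c₁ * s = 2 * ℓ * (K * s) + m * (K * s) := by rw [hc₁]; ring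
    linarith
  have hm0 : (0 : ℝ) ≤ m := Nat.cast_nonneg _
  have hμu : 0 ≤ μ * u := by positivity
  have hℓμu : 2 * (μ * u) ≤ (ℓ + 1) * μ * u := by
    have := mul_le_mul_of_nonneg_right hℓμ hu0.le
    linarith
  have hθu : (ℓ + 1) * (θ * u) = u - (ℓ + 1) * μ * u := by rw [← mul_assoc, hθℓ]; ring
  -- absorbers
  set U' := U \ (X ++ Y).toFinset with hU'
  have hU'c : u - 2 * ℓ ≤ U'.card := by
    have := card_sub_length_le U (X ++ Y)
    rw [List.length_append, hXl, hYl] at this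
    push_cast at this
    linarith
  have hU'u : (U'.card : ℝ) ≤ u := Nat.cast_le.2 (Finset.card_le_card Finset.sdiff_subset)
  have hnonU : ∀ W ⊆ U, ∀ v ∈ R ∪ U, ((nonNbrs G W v).card : ℝ) ≤ θ * u :=
    fun W hW v hv => (nonNbrs_card_mono hW v).trans (hdegU v hv)
  have hUV : ∀ W ⊆ U, ∀ v ∈ W, v ∈ R ∪ U := fun W hW v hv => Finset.mem_union_right _ (hW hv)
  have hU'U : U' ⊆ U := Finset.sdiff_subset
  obtain ⟨𝒜, h𝒜1, h𝒜2, h𝒜3, h𝒜4, h𝒜5, h𝒜6⟩ := exists_absorber_family (G := G) (ℓ := ℓ) hκ hκ1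
    hK.le (W := U') (V := R ∪ U) (D := θ * u) (s := s) (by positivity)
    (by
      have h1 : μ * u ≤ 1 / 2 * u := mul_le_mul_of_nonneg_right hμ1 hu0.le
      have : (0 : ℝ) < U'.card := by linarith
      exact_mod_cast this) hVne hVs
    (fun v hv => hnonU U' hU'U v (hUV U' hU'U v hv))
    (fun v hv => by
      rw [card_filter_adj]
      have h1 := hnonU U' hU'U v hv
      have h2 : κ * U'.card ≤ μ * u := by gcongr
      push_cast
      linarith)
  set U₁ := U' \ 𝒜.flatten.toFinset with hU₁
  have hU₁U : U₁ ⊆ U := Finset.sdiff_subset.trans hU'U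
  have hU₁c : u - 2 * ℓ - 2 * ℓ * (K * s) ≤ U₁.card := by
    have := card_sub_length_le U' 𝒜.flatten
    rw [h𝒜5] at this
    push_cast at this
    linarith
  have hXV : ∀ v ∈ X, v ∈ R ∪ U := fun v hv => hXYV v (List.mem_append_left _ hv)
  have hYV : ∀ v ∈ Y, v ∈ R ∪ U := fun v hv => hXYV v (List.mem_append_right _ hv)
  have h𝒜V : ∀ v ∈ 𝒜.flatten, v ∈ R ∪ U := fun v hv => hUV U' hU'U v (h𝒜4 v hv)
  obtain ⟨mid₁, Cs₁, hmid₁, hCs₁n, hCs₁W, hCs₁l, hchain₁⟩ := hlink α G u (θ * u)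
    ((le_max_left _ _).trans (hn1r.trans hru)) hu0 (by positivity) 𝒜 X [] U₁
    (Nat.cast_le.2 (Finset.card_le_card hU₁U)) (by
      rw [h𝒜1]
      push_cast
      rw [hm] at hbud'
      push_cast at hbud'
      linarith)
    (fun v hv => hnonU U₁ hU₁U v (hUV U₁ hU₁U v hv))
    (fun v hv => hnonU U₁ hU₁U v (by
      simp only [List.append_nil, List.mem_append] at hv
      exact hv.elim (hXV v) (h𝒜V v)))
    hX trivial (fun A hA => ⟨(h𝒜2 A hA).2, by rw [(h𝒜2 A hA).1]; omega⟩)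
  rw [List.append_nil] at hchain₁
  -- near cover
  set U₂ := U₁ \ Cs₁.flatten.toFinset with hU₂
  have hU₂U : U₂ ⊆ U := Finset.sdiff_subset.trans hU₁U
  have hU₂c : u - μ / 2 * u ≤ U₂.card := by
    have := card_sub_length_le U₁ Cs₁.flatten
    rw [hCs₁l, h𝒜1] at this
    rw [hm] at hbud'
    push_cast at this hbud'
    linarith
  obtain ⟨S, hS, hStiled, hSc⟩ := hcover α G U₂ (by
      have h1 : μ / 2 * u ≤ 1 / 2 * u := by gcongr; linarith
      have h2 := le_max_left n₂ 1
      linarith) (fun v hv => by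
      refine (hnonU U₂ hU₂U v (hUV U₂ hU₂U v hv)).trans ?_
      have h1 : (1 / (ℓ + 1) - μ / 2) * (u - μ / 2 * u) ≤ (1 / (ℓ + 1) - μ / 2) * U₂.card :=
        mul_le_mul_of_nonneg_left hU₂c (by linarith)
      have h2 : 1 / ((ℓ : ℝ) + 1) * (μ / 2 * u) ≤ 1 * (μ / 2 * u) := by
        gcongr
        rw [div_le_one (by positivity)]
        linarith
      have h3 : 0 ≤ μ / 2 * (μ / 2 * u) := by positivity
      push_cast
      rw [hθ]
      linarith)
  obtain ⟨Qs, hQs, hQsn, hQsS⟩ := hStiled.exists_powChains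
  have hQsmem : ∀ v, v ∈ Qs.flatten ↔ v ∈ S := fun v => by rw [← hQsS, List.mem_toFinset]
  have hQsl : (t : ℝ) * Qs.length ≤ n := by
    have h1 : Qs.flatten.length = Qs.length * ((ℓ + 1) * t) := by
      rw [List.length_flatten, List.map_congr_left fun Q hQ => (hQs Q hQ).2]
      simp
    have h2 : Qs.flatten.length ≤ (R ∪ U).card := by
      rw [← List.toFinset_card_of_nodup hQsn, hQsS]
      exact Finset.card_le_card ((hS.trans hU₂U).trans Finset.subset_union_right)
    have h3 : t * Qs.length ≤ (R ∪ U).card := by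
      rw [h1] at h2
      refine le_trans ?_ h2
      rw [mul_comm]
      exact Nat.mul_le_mul_left _ (Nat.le_mul_of_pos_left t (by omega))
    rw [hn]
    exact_mod_cast h3
  -- link through the reservoir
  set R' := R \ (X ++ Y).toFinset with hR'
  have hR'R : R' ⊆ R := Finset.sdiff_subset
  have hR'c : r - 2 * ℓ ≤ R'.card := by
    have := card_sub_length_le R (X ++ Y)
    rw [List.length_append, hXl, hYl] at this
    push_cast at this
    linarith
  have hnonR : ∀ v ∈ R ∪ U, ((nonNbrs G R' v).card : ℝ) ≤ θ * r :=
    fun v hv => (nonNbrs_card_mono hR'R v).trans (hdegR v hv)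
  have hmidmem : ∀ v, v ∈ mid₁.flatten ↔ v ∈ 𝒜.flatten ∨ v ∈ Cs₁.flatten := fun v => by
    rw [hmid₁.flatten.mem_iff, List.flatten_append, List.mem_append]
  have hSV : ∀ v ∈ Qs.flatten, v ∈ R ∪ U :=
    fun v hv => Finset.mem_union_right _ (hU₂U (hS ((hQsmem v).1 hv)))
  obtain ⟨mid₂, Cs₂, hmid₂, hCs₂n, hCs₂W, -, hchain₂⟩ := hlink α G r (θ * r)
    ((le_max_left _ _).trans hn1r) (by linarith) (by positivity) Qs (X ++ mid₁.flatten) Y R'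
    (Nat.cast_le.2 (Finset.card_le_card hR'R)) (by
      have h1 : (ℓ + 1) * (θ * r) = r - (ℓ + 1) * μ * r := by rw [← mul_assoc, hθℓ]; ring
      have h2 : 2 * μ * r ≤ (ℓ + 1) * μ * r := by gcongr
      have h3 : 16 * q * (m * Qs.length) ≤ 16 * q * (μ / 8 * r) := by
        calc 16 * (q : ℝ) * (m * Qs.length) = 16 * q * m * Qs.length := by ring
          _ ≤ μ * t * Qs.length := by gcongr
          _ = μ * (t * Qs.length) := by ring
          _ ≤ μ * n := by gcongr
          _ ≤ μ * (2 * q * r) := by gcongr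
          _ = _ := by ring
      have h4 := le_of_mul_le_mul_left h3 (by positivity)
      have h5 : 2 * q * (8 * (m + 2 * ℓ)) ≤ 2 * q * (μ * r) :=
        hb2.trans (by
          have : μ * n ≤ μ * (2 * q * r) := by gcongr
          linarith)
      have h6 := le_of_mul_le_mul_left h5 (by positivity)
      have h7 : 0 ≤ μ * r := by positivity
      rw [mul_add, h1]
      linarith)
    (fun v hv => hnonR v (Finset.mem_union_left _ (hR'R hv)))
    (fun v hv => hnonR v (by
      simp only [List.mem_append, hmidmem] at hv
      rcases hv with ((hv | hv | hv) | hv) | hv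
      exacts [hXV v hv, h𝒜V v hv, hUV U₁ hU₁U v (hCs₁W v hv), hYV v hv, hSV v hv]))
    hchain₁ hY (fun Q hQ => ⟨(hQs Q hQ).1, by
      rw [(hQs Q hQ).2]
      exact (Nat.le_succ ℓ).trans (Nat.le_mul_of_pos_right _ ht0)⟩)
  -- absorb the leftover
  set F := 𝒜.flatten ++ Cs₁.flatten ++ Qs.flatten ++ Cs₂.flatten with hF
  set B := ((R ∪ U) \ ((X ++ Y).toFinset ∪ F.toFinset)).toList with hB
  have hsegs : (mid₁ ++ mid₂).Perm (𝒜 ++ (Cs₁ ++ Qs ++ Cs₂)) := by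
    have := hmid₁.append hmid₂
    simpa using this
  have hsegsF : (mid₁ ++ mid₂).flatten.Perm F := by
    have := hsegs.flatten
    simpa [hF] using this
  have hBs : B.length ≤ s := by
    rw [hB, Finset.length_toList]
    have h1 : (R ∪ U) \ ((X ++ Y).toFinset ∪ F.toFinset) ⊆ R ∪ (U₂ \ S) := by
      intro v hv
      simp only [Finset.mem_sdiff, Finset.mem_union, List.mem_toFinset, hF, List.mem_append,
        hQsmem, not_or, hU₂, hU₁, hU'] at hv ⊢
      tauto
    have h2 : (((R ∪ U) \ ((X ++ Y).toFinset ∪ F.toFinset)).card : ℝ) ≤ r + a / 2 * u := by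
      have h3 : (U₂.card : ℝ) ≤ u := Nat.cast_le.2 (Finset.card_le_card hU₂U)
      have h4 : (((R ∪ U) \ ((X ++ Y).toFinset ∪ F.toFinset)).card : ℝ) ≤
          R.card + (U₂ \ S).card := by
        exact_mod_cast (Finset.card_le_card h1).trans (Finset.card_union_le _ _)
      have h5 : a / 2 * (U₂.card : ℝ) ≤ a / 2 * u := by gcongr
      linarith
    have h6 : 2 * r ≤ a * n := by
      calc 2 * r ≤ a * q * r := by gcongr
        _ = a * (q * r) := by ring
        _ ≤ a * n := by gcongr
    have h7 : a / 2 * u ≤ a / 2 * n := by gcongr; linarith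
    exact_mod_cast h2.trans (by linarith : r + a / 2 * u ≤ s)
  obtain ⟨L, hL, hLchain⟩ := exists_absorb (P := X) (S := Y) B (mid₁ ++ mid₂) 𝒜 _ hsegs
    (fun A hA => (h𝒜2 A hA).1)
    (fun v hv => hBs.trans (h𝒜6 v (by
      rw [hB, Finset.mem_toList] at hv
      exact (Finset.mem_sdiff.1 hv).1)))
    (by simpa using hchain₂)
  have hLF : L.Perm (F ++ B) := hL.trans (hsegsF.append_right B)
  have hFmem : ∀ v ∈ F, v ∈ R ∪ U ∧ v ∉ X ++ Y := by
    intro v hv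
    have h1 : ∀ v ∈ U', v ∈ R ∪ U ∧ v ∉ X ++ Y := fun v hv =>
      ⟨hUV U' hU'U v hv, fun h => (Finset.mem_sdiff.1 hv).2 (List.mem_toFinset.2 h)⟩
    simp only [hF, List.mem_append] at hv
    rcases hv with ((hv | hv) | hv) | hv
    · exact h1 v (h𝒜4 v hv)
    · exact h1 v (Finset.mem_sdiff.1 (hCs₁W v hv)).1
    · exact h1 v (Finset.mem_sdiff.1 (Finset.mem_sdiff.1 (hS ((hQsmem v).1 hv))).1).1
    · have h2 := Finset.mem_sdiff.1 (hCs₂W v hv)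
      exact ⟨Finset.mem_union_left _ h2.1, fun h => h2.2 (List.mem_toFinset.2 h)⟩
  have hFn : F.Nodup := by
    rw [hF, List.nodup_append, List.nodup_append, List.nodup_append]
    refine ⟨⟨⟨h𝒜3, hCs₁n, ?_⟩, hQsn, ?_⟩, hCs₂n, ?_⟩
    · rintro v hv _ hw rfl
      exact (Finset.mem_sdiff.1 (hCs₁W v hw)).2 (List.mem_toFinset.2 hv)
    · rintro v hv _ hw rfl
      have h1 := Finset.mem_sdiff.1 (hS ((hQsmem v).1 hw))
      rcases List.mem_append.1 hv with hv | hv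
      · exact (Finset.mem_sdiff.1 h1.1).2 (List.mem_toFinset.2 hv)
      · exact h1.2 (List.mem_toFinset.2 hv)
    · rintro v hv _ hw rfl
      refine Finset.disjoint_left.1 hRU (hR'R (hCs₂W v hw)) ?_
      simp only [List.mem_append] at hv
      rcases hv with (hv | hv) | hv
      exacts [hU'U (h𝒜4 v hv), hU₁U (hCs₁W v hv), hU₂U (hS ((hQsmem v).1 hv))]
  have hBmem : ∀ v, v ∈ B ↔ v ∈ R ∪ U ∧ v ∉ X ++ Y ∧ v ∉ F := fun v => by
    simp only [hB, Finset.mem_toList, Finset.mem_sdiff, Finset.mem_union, List.mem_toFinset, not_or]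
  have hperm : (X ++ L ++ Y).Perm (X ++ Y ++ (F ++ B)) := by
    rw [List.append_assoc, List.append_assoc]
    exact (List.perm_append_comm.trans (hLF.append_left Y)).append_left X
  refine ⟨L, hperm.nodup_iff.2 ?_, ?_, hLchain⟩
  · rw [List.nodup_append, List.nodup_append (l₁ := F)]
    refine ⟨hXYn, ⟨hFn, Finset.nodup_toList _, ?_⟩, ?_⟩
    · rintro v hv _ hw rfl
      exact ((hBmem v).1 hw).2.2 hv
    · rintro v hv _ hw rfl
      rcases List.mem_append.1 hw with hw | hw
      exacts [(hFmem v hw).2 hv, ((hBmem v).1 hw).2.1 hv]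
  · ext v
    rw [List.mem_toFinset, hperm.mem_iff, List.mem_append, List.mem_append (s := F), hBmem]
    constructor
    · rintro (hv | hv | hv)
      exacts [hXYV v hv, (hFmem v hv).1, hv.1]
    · intro hv
      tauto

end Block

section LocalLemma

theorem sum_biUnion_le_sum {ι β : Type*} [DecidableEq β] (s : Finset ι) (t : ι → Finset β)
    {f : β → ℝ} (hf : ∀ b, 0 ≤ f b) : ∑ b ∈ s.biUnion t, f b ≤ ∑ i ∈ s, ∑ b ∈ t i, f b := by
  classical
  induction s using Finset.induction_on with
  | empty => simp
  | insert i s hi ih =>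
    rw [Finset.biUnion_insert, Finset.sum_insert hi]
    have h1 := Finset.sum_union_inter (s₁ := t i) (s₂ := s.biUnion t) (f := f)
    have h2 := Finset.sum_nonneg fun b (_ : b ∈ t i ∩ s.biUnion t) => hf b
    linarith

variable {α : Type*} [Fintype α]

/-- The proportion of permutations extending a given partial injection of size `#κ`. -/
noncomputable def partialWeight (κ : Finset (α × α)) : ℝ :=
  ((Fintype.card α).descFactorial κ.card : ℝ)⁻¹

theorem partialWeight_nonneg (κ : Finset (α × α)) : 0 ≤ partialWeight κ := by
  unfold partialWeight
  positivity

variable [DecidableEq α]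

/-- The permutation `σ` extends the partial map with graph `τ`. -/
def Extends (σ : Equiv.Perm α) (τ : Finset (α × α)) : Prop := ∀ e ∈ τ, σ e.1 = e.2

/-- The domains or the images of two partial maps meet. -/
def Touches (κ τ : Finset (α × α)) : Prop := ∃ e ∈ κ, ∃ f ∈ τ, e.1 = f.1 ∨ e.2 = f.2

open Classical in
/-- The permutations extending `τ` and extending no member of `𝓜`. -/
noncomputable def extAvoid (τ : Finset (α × α)) (𝓜 : Finset (Finset (α × α))) :
    Finset (Equiv.Perm α) :=
  Finset.univ.filter fun σ => Extends σ τ ∧ ∀ κ ∈ 𝓜, ¬ Extends σ κ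

theorem mem_extAvoid {τ : Finset (α × α)} {𝓜 : Finset (Finset (α × α))} {σ : Equiv.Perm α} :
    σ ∈ extAvoid τ 𝓜 ↔ Extends σ τ ∧ ∀ κ ∈ 𝓜, ¬ Extends σ κ := by
  simp [extAvoid]

theorem card_extAvoid_insert_mul_le {τ : Finset (α × α)} {𝓜 : Finset (Finset (α × α))} {e : α × α}
    (he : e ∉ τ) (h𝓜 : ∀ κ ∈ 𝓜, ¬ Touches κ {e}) :
    (Fintype.card α - τ.card) * (extAvoid (insert e τ) 𝓜).card ≤ (extAvoid τ 𝓜).card := by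
  set W : Finset α := Finset.univ \ τ.image Prod.snd with hW
  have hWc : Fintype.card α - τ.card ≤ W.card := by
    rw [hW, Finset.card_sdiff_of_subset (Finset.subset_univ _), Finset.card_univ]
    exact Nat.sub_le_sub_left Finset.card_image_le _
  refine (Nat.mul_le_mul_right _ hWc).trans ?_
  rw [← Finset.card_product]
  refine Finset.card_le_card_of_injOn (fun z => z.2.trans (Equiv.swap e.2 z.1)) ?_ ?_
  · rintro ⟨b, σ⟩ hz
    simp only [Finset.coe_product, Set.mem_prod, Finset.mem_coe, mem_extAvoid] at hz ⊢
    obtain ⟨hb, hσ, hav⟩ := hz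
    have hσe : σ e.1 = e.2 := hσ e (Finset.mem_insert_self _ _)
    have hbτ : ∀ f ∈ τ, f.2 ≠ b := fun f hf h =>
      (Finset.mem_sdiff.1 hb).2 (Finset.mem_image.2 ⟨f, hf, h⟩)
    refine ⟨fun f hf => ?_, fun κ hκ hext => ?_⟩
    · have h1 : σ f.1 = f.2 := hσ f (Finset.mem_insert_of_mem hf)
      have h2 : f.2 ≠ e.2 := by
        intro h
        have h3 : f.1 = e.1 := σ.injective (by rw [h1, hσe, h])
        exact he (Prod.ext h3 h ▸ hf)
      simp only [Equiv.trans_apply, h1]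
      exact Equiv.swap_apply_of_ne_of_ne h2 (hbτ f hf)
    · refine hav κ hκ fun c hc => ?_
      have h1 := hext c hc
      simp only [Equiv.trans_apply] at h1
      have h2 : c.1 ≠ e.1 := fun h => h𝓜 κ hκ ⟨c, hc, e, Finset.mem_singleton_self _, Or.inl h⟩
      have h3 : c.2 ≠ e.2 := fun h => h𝓜 κ hκ ⟨c, hc, e, Finset.mem_singleton_self _, Or.inr h⟩
      have h4 : σ c.1 ≠ e.2 := fun h => h2 (σ.injective (h.trans hσe.symm))
      have h5 : σ c.1 ≠ b := by
        intro h
        rw [h, Equiv.swap_apply_right] at h1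
        exact h3 h1.symm
      rwa [Equiv.swap_apply_of_ne_of_ne h4 h5] at h1
  · rintro ⟨b, σ⟩ hz ⟨b', σ'⟩ hz' h
    simp only [Finset.coe_product, Set.mem_prod, Finset.mem_coe, mem_extAvoid] at hz hz'
    have h1 : σ e.1 = e.2 := hz.2.1 e (Finset.mem_insert_self _ _)
    have h2 : σ' e.1 = e.2 := hz'.2.1 e (Finset.mem_insert_self _ _)
    have h3 := congrArg (fun π : Equiv.Perm α => π e.1) h
    simp only [Equiv.trans_apply, h1, h2, Equiv.swap_apply_left] at h3
    subst h3
    refine Prod.ext rfl (Equiv.ext fun a => ?_)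
    have h4 := congrArg (fun π : Equiv.Perm α => π a) h
    simpa using h4

/-- Extending a partial map disjoint from all members of `𝓜` is negatively correlated with
avoiding `𝓜`. -/
theorem card_extAvoid_le_of_not_touches (τ : Finset (α × α)) {𝓜 : Finset (Finset (α × α))}
    (h𝓜 : ∀ κ ∈ 𝓜, ¬ Touches κ τ) :
    ((extAvoid τ 𝓜).card : ℝ) ≤ partialWeight τ * (extAvoid ∅ 𝓜).card := by
  have key : ∀ τ : Finset (α × α), (∀ κ ∈ 𝓜, ¬ Touches κ τ) →
      (Fintype.card α).descFactorial τ.card * (extAvoid τ 𝓜).card ≤ (extAvoid ∅ 𝓜).card := by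
    intro τ
    induction τ using Finset.induction_on with
    | empty => simp
    | insert e τ he ih =>
      intro h
      rw [Finset.card_insert_of_notMem he, Nat.descFactorial_succ]
      have h1 := card_extAvoid_insert_mul_le (τ := τ) (𝓜 := 𝓜) he fun κ hκ ht => h κ hκ (by
        obtain ⟨c, hc, f, hf, hcf⟩ := ht
        exact ⟨c, hc, f, by rw [Finset.mem_singleton.1 hf]; exact Finset.mem_insert_self _ _, hcf⟩)
      have h2 := ih fun κ hκ ht => h κ hκ (by
        obtain ⟨c, hc, f, hf, hcf⟩ := ht
        exact ⟨c, hc, f, Finset.mem_insert_of_mem hf, hcf⟩)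
      calc _ = (Fintype.card α).descFactorial τ.card *
            ((Fintype.card α - τ.card) * (extAvoid (insert e τ) 𝓜).card) := by ring
        _ ≤ _ := (Nat.mul_le_mul_left _ h1).trans h2
  by_cases hne : (extAvoid τ 𝓜).Nonempty
  · obtain ⟨σ, hσ⟩ := hne
    have hσ := (mem_extAvoid.1 hσ).1
    have hcard : τ.card ≤ Fintype.card α := by
      refine Finset.card_le_card_of_injOn Prod.fst (fun _ _ => Finset.mem_coe.2 (Finset.mem_univ _))
        fun e he f hf h => Prod.ext h ?_
      rw [← hσ e he, ← hσ f hf, h]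
    have hpos : (0 : ℝ) < (Fintype.card α).descFactorial τ.card := by
      exact_mod_cast Nat.descFactorial_pos.2 hcard
    rw [partialWeight, inv_mul_eq_div, le_div_iff₀' hpos]
    exact_mod_cast key τ h𝓜
  · rw [Finset.not_nonempty_iff_eq_empty.1 hne]
    simp only [Finset.card_empty, Nat.cast_zero]
    exact mul_nonneg (partialWeight_nonneg _) (Nat.cast_nonneg _)

theorem extAvoid_anti (τ : Finset (α × α)) {𝓜 𝓜' : Finset (Finset (α × α))} (h : 𝓜' ⊆ 𝓜) :
    extAvoid τ 𝓜 ⊆ extAvoid τ 𝓜' := fun _ hσ =>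
  mem_extAvoid.2 ⟨(mem_extAvoid.1 hσ).1, fun κ hκ => (mem_extAvoid.1 hσ).2 κ (h hκ)⟩

open Classical in
theorem card_extAvoid_le_add_sum (𝓜 𝓜' : Finset (Finset (α × α))) :
    (extAvoid ∅ 𝓜').card ≤ (extAvoid ∅ 𝓜).card + ∑ κ ∈ 𝓜 \ 𝓜', (extAvoid κ 𝓜').card := by
  have hsub : extAvoid ∅ 𝓜' ⊆ extAvoid ∅ 𝓜 ∪ (𝓜 \ 𝓜').biUnion fun κ => extAvoid κ 𝓜' := by
    intro σ hσ
    rw [Finset.mem_union, Finset.mem_biUnion]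
    rw [mem_extAvoid] at hσ
    by_cases hav : ∀ κ ∈ 𝓜, ¬ Extends σ κ
    · exact Or.inl (mem_extAvoid.2 ⟨hσ.1, hav⟩)
    · push Not at hav
      obtain ⟨κ, hκ, hext⟩ := hav
      exact Or.inr ⟨κ, Finset.mem_sdiff.2 ⟨hκ, fun h' => hσ.2 κ h' hext⟩,
        mem_extAvoid.2 ⟨hext, hσ.2⟩⟩
  exact (Finset.card_le_card hsub).trans ((Finset.card_union_le _ _).trans
    (Nat.add_le_add_left Finset.card_biUnion_le _))

open Classical in
/-- If the members of `𝓜` outside `𝓜'` have small total weight, then avoiding `𝓜` is not much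
less likely than avoiding `𝓜'`. -/
theorem card_extAvoid_le_two_mul {𝓜 𝓜' : Finset (Finset (α × α))}
    (hle : ∀ κ ∈ 𝓜 \ 𝓜', ((extAvoid κ 𝓜').card : ℝ) ≤
      2 * partialWeight κ * (extAvoid ∅ 𝓜').card)
    (hsum : ∑ κ ∈ 𝓜 \ 𝓜', partialWeight κ ≤ 1 / 4) :
    ((extAvoid ∅ 𝓜').card : ℝ) ≤ 2 * (extAvoid ∅ 𝓜).card := by
  have h1 : ((extAvoid ∅ 𝓜').card : ℝ) ≤
      (extAvoid ∅ 𝓜).card + ∑ κ ∈ 𝓜 \ 𝓜', ((extAvoid κ 𝓜').card : ℝ) := by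
    exact_mod_cast card_extAvoid_le_add_sum 𝓜 𝓜'
  have h2 : ∑ κ ∈ 𝓜 \ 𝓜', ((extAvoid κ 𝓜').card : ℝ) ≤
      2 * (1 / 4) * (extAvoid ∅ 𝓜').card := by
    refine (Finset.sum_le_sum hle).trans ?_
    rw [← Finset.sum_mul, ← Finset.mul_sum]
    gcongr
  linarith

open Classical in
theorem sum_touches_le {𝓛 : Finset (Finset (α × α))} {δ : ℝ}
    (hδ : ∀ e : α × α, ∑ κ ∈ 𝓛.filter (Touches · {e}), partialWeight κ ≤ δ)
    (τ : Finset (α × α)) : ∑ κ ∈ 𝓛.filter (Touches · τ), partialWeight κ ≤ τ.card * δ := by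
  have hsub : 𝓛.filter (Touches · τ) ⊆ τ.biUnion fun e => 𝓛.filter (Touches · {e}) := by
    intro κ hκ
    obtain ⟨hκ, c, hc, e, he, h⟩ := Finset.mem_filter.1 hκ
    exact Finset.mem_biUnion.2 ⟨e, he, Finset.mem_filter.2
      ⟨hκ, c, hc, e, Finset.mem_singleton_self _, h⟩⟩
  calc _ ≤ ∑ κ ∈ τ.biUnion fun e => 𝓛.filter (Touches · {e}), partialWeight κ :=
        Finset.sum_le_sum_of_subset_of_nonneg hsub fun κ _ _ => partialWeight_nonneg κ
    _ ≤ ∑ e ∈ τ, ∑ κ ∈ 𝓛.filter (Touches · {e}), partialWeight κ :=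
        sum_biUnion_le_sum _ _ partialWeight_nonneg
    _ ≤ ∑ e ∈ τ, δ := Finset.sum_le_sum fun e _ => hδ e
    _ = _ := by rw [Finset.sum_const, nsmul_eq_mul]

open Classical in
/-- The lopsided local lemma for random permutations. -/
theorem card_extAvoid_le_of_mem {𝓛 : Finset (Finset (α × α))} {δ : ℝ} {D : ℕ}
    (hD : ∀ κ ∈ 𝓛, κ.card ≤ D) (hδ0 : 0 ≤ δ) (hDδ : D * δ ≤ 1 / 4)
    (hδ : ∀ e : α × α, ∑ κ ∈ 𝓛.filter (Touches · {e}), partialWeight κ ≤ δ)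
    {𝓜 : Finset (Finset (α × α))} (h𝓜 : 𝓜 ⊆ 𝓛) {κ : Finset (α × α)} (hκ : κ ∈ 𝓛) :
    ((extAvoid κ 𝓜).card : ℝ) ≤ 2 * partialWeight κ * (extAvoid ∅ 𝓜).card := by
  induction hN : 𝓜.card using Nat.strong_induction_on generalizing 𝓜 κ with
  | _ N ih =>
  set 𝓜' := 𝓜.filter fun κ' => ¬ Touches κ' κ with h𝓜'
  have hsub : 𝓜' ⊆ 𝓜 := Finset.filter_subset _ _
  have h1 : ((extAvoid κ 𝓜).card : ℝ) ≤ partialWeight κ * (extAvoid ∅ 𝓜').card :=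
    (Nat.cast_le.2 (Finset.card_le_card (extAvoid_anti κ hsub))).trans
      (card_extAvoid_le_of_not_touches κ fun κ' hκ' => (Finset.mem_filter.1 hκ').2)
  have h2 : ((extAvoid ∅ 𝓜').card : ℝ) ≤ 2 * (extAvoid ∅ 𝓜).card := by
    refine card_extAvoid_le_two_mul (fun κ' hκ' => ?_) ?_
    · obtain ⟨hκ'1, hκ'2⟩ := Finset.mem_sdiff.1 hκ'
      exact ih _ (hN ▸ Finset.card_lt_card ⟨hsub, fun h => hκ'2 (h hκ'1)⟩) (hsub.trans h𝓜)
        (h𝓜 hκ'1) rfl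
    · have h3 : 𝓜 \ 𝓜' ⊆ 𝓛.filter (Touches · κ) := by
        intro κ' hκ'
        simp only [h𝓜', Finset.mem_sdiff, Finset.mem_filter, not_and, not_not] at hκ' ⊢
        exact ⟨h𝓜 hκ'.1, hκ'.2 hκ'.1⟩
      calc _ ≤ ∑ κ' ∈ 𝓛.filter (Touches · κ), partialWeight κ' :=
            Finset.sum_le_sum_of_subset_of_nonneg h3 fun κ _ _ => partialWeight_nonneg κ
        _ ≤ κ.card * δ := sum_touches_le hδ κ
        _ ≤ D * δ := by gcongr; exact hD κ hκ
        _ ≤ _ := hDδ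
  calc _ ≤ _ := h1
    _ ≤ partialWeight κ * (2 * (extAvoid ∅ 𝓜).card) := by
        gcongr
        exact partialWeight_nonneg κ
    _ = _ := by ring

open Classical in
/-- Conditioned on avoiding a sparse family of partial maps, a random permutation is spread. -/
theorem card_extAvoid_le {𝓛 : Finset (Finset (α × α))} {δ : ℝ} {D : ℕ}
    (hD : ∀ κ ∈ 𝓛, κ.card ≤ D) (hδ0 : 0 ≤ δ) (hδ1 : δ ≤ 1 / 4) (hDδ : D * δ ≤ 1 / 4)
    (hδ : ∀ e : α × α, ∑ κ ∈ 𝓛.filter (Touches · {e}), partialWeight κ ≤ δ)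
    (τ : Finset (α × α)) :
    ((extAvoid τ 𝓛).card : ℝ) ≤ 2 ^ τ.card * partialWeight τ * (extAvoid ∅ 𝓛).card := by
  have key : ∀ τ : Finset (α × α), ((extAvoid ∅ (𝓛.filter fun κ => ¬ Touches κ τ)).card : ℝ) ≤
      2 ^ τ.card * (extAvoid ∅ 𝓛).card := by
    intro τ
    induction τ using Finset.induction_on with
    | empty =>
      have : 𝓛.filter (fun κ => ¬ Touches κ ∅) = 𝓛 :=
        Finset.filter_true_of_mem fun κ _ => by simp [Touches]
      rw [this]
      simp
    | insert e τ he ih =>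
      rw [Finset.card_insert_of_notMem he, pow_succ', mul_assoc]
      refine le_trans (card_extAvoid_le_two_mul (𝓜 := 𝓛.filter fun κ => ¬ Touches κ τ) ?_ ?_)
        (mul_le_mul_of_nonneg_left ih zero_le_two)
      · exact fun κ hκ => card_extAvoid_le_of_mem hD hδ0 hDδ hδ (Finset.filter_subset _ _)
          (Finset.mem_filter.1 (Finset.mem_sdiff.1 hκ).1).1
      · refine le_trans (Finset.sum_le_sum_of_subset_of_nonneg ?_
          fun κ _ _ => partialWeight_nonneg κ) ((hδ e).trans hδ1)
        intro κ hκ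
        simp only [Finset.mem_sdiff, Finset.mem_filter, not_and, not_not] at hκ ⊢
        obtain ⟨⟨hκ1, hκ2⟩, hκ3⟩ := hκ
        obtain ⟨c, hc, f, hf, hcf⟩ := hκ3 hκ1
        rcases Finset.mem_insert.1 hf with rfl | hf
        · exact ⟨hκ1, c, hc, f, Finset.mem_singleton_self _, hcf⟩
        · exact absurd ⟨c, hc, f, hf, hcf⟩ hκ2
  calc ((extAvoid τ 𝓛).card : ℝ)
      ≤ partialWeight τ * (extAvoid ∅ (𝓛.filter fun κ => ¬ Touches κ τ)).card :=
        (Nat.cast_le.2 (Finset.card_le_card (extAvoid_anti τ (Finset.filter_subset _ _)))).trans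
          (card_extAvoid_le_of_not_touches τ fun κ hκ => (Finset.mem_filter.1 hκ).2)
    _ ≤ partialWeight τ * (2 ^ τ.card * (extAvoid ∅ 𝓛).card) := by
        gcongr
        · exact partialWeight_nonneg τ
        · exact key τ
    _ = _ := by ring

open Classical in
theorem extAvoid_nonempty {𝓛 : Finset (Finset (α × α))} {δ : ℝ} {D : ℕ}
    (hne : ∀ κ ∈ 𝓛, κ.Nonempty)
    (hD : ∀ κ ∈ 𝓛, κ.card ≤ D) (hδ0 : 0 ≤ δ) (hδ1 : δ ≤ 1 / 4) (hDδ : D * δ ≤ 1 / 4)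
    (hδ : ∀ e : α × α, ∑ κ ∈ 𝓛.filter (Touches · {e}), partialWeight κ ≤ δ) :
    (extAvoid ∅ 𝓛).Nonempty := by
  have key : ∀ 𝓜 ⊆ 𝓛, (0 : ℝ) < (extAvoid ∅ 𝓜).card := by
    intro 𝓜
    induction 𝓜 using Finset.induction_on with
    | empty =>
      intro _
      exact Nat.cast_pos.2 (Finset.card_pos.2 ⟨1, mem_extAvoid.2 (by simp [Extends])⟩)
    | insert κ 𝓜 hκ ih =>
      intro hsub
      have h0 := ih ((Finset.subset_insert _ _).trans hsub)
      have hsd : insert κ 𝓜 \ 𝓜 = {κ} := Finset.insert_sdiff_cancel hκ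
      have hκ𝓛 := hsub (Finset.mem_insert_self _ _)
      have h1 := card_extAvoid_le_two_mul (𝓜 := insert κ 𝓜) (𝓜' := 𝓜)
        (fun κ' hκ' => card_extAvoid_le_of_mem hD hδ0 hDδ hδ
          ((Finset.subset_insert _ _).trans hsub) (hsub (Finset.mem_sdiff.1 hκ').1)) (by
        rw [hsd, Finset.sum_singleton]
        obtain ⟨e, he⟩ := hne κ hκ𝓛
        refine le_trans ?_ ((hδ e).trans hδ1)
        exact Finset.single_le_sum (f := partialWeight) (fun κ _ => partialWeight_nonneg κ)
          (Finset.mem_filter.2 ⟨hκ𝓛, e, he, e, Finset.mem_singleton_self _, Or.inl rfl⟩))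
      linarith
  exact Finset.card_pos.1 (Nat.cast_pos.1 (key 𝓛 subset_rfl))

end LocalLemma

section BadEvents

variable {α : Type*} [DecidableEq α]

/-- The graph of `f` restricted to `X`. -/
def graphOn (f : α → α) (X : Finset α) : Finset (α × α) := X.image fun a => (a, f a)

theorem mem_graphOn {f : α → α} {X : Finset α} {a b : α} :
    (a, b) ∈ graphOn f X ↔ a ∈ X ∧ f a = b := by
  simp only [graphOn, Finset.mem_image, Prod.mk.injEq]
  constructor
  · rintro ⟨c, hc, rfl, rfl⟩
    exact ⟨hc, rfl⟩
  · rintro ⟨ha, rfl⟩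
    exact ⟨a, ha, rfl, rfl⟩

theorem card_graphOn (f : α → α) (X : Finset α) : (graphOn f X).card = X.card :=
  Finset.card_image_of_injective _ fun _ _ h => (Prod.ext_iff.1 h).1

variable [Fintype α]

open Classical in
/-- A Chernoff bound for random functions prescribed outside `T`. -/
theorem card_many_hits_le {B : Finset α} {β ν : ℝ} (hβ1 : β ≤ 1) (hν0 : 0 ≤ ν)
    (hν1 : ν ≤ 1) (hB : (B.card : ℝ) ≤ β * Fintype.card α) (T : Finset α) (g : α → α) :
    ((Finset.univ.filter fun f : α → α => (∀ i ∉ T, f i = g i) ∧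
      (β + ν) * T.card ≤ ((T.filter fun y => f y ∈ B).card : ℝ)).card : ℝ) ≤
      (Fintype.card α : ℝ) ^ T.card * Real.exp (-(ν ^ 2 / 4) * T.card) := by
  set n : ℝ := (Fintype.card α : ℝ) with hn
  have hn0 : 0 ≤ n := Nat.cast_nonneg _
  set θ := ν / 2 with hθ
  set t : α → Finset α := fun i => if i ∈ T then Finset.univ else {g i} with ht
  set h : α → α → ℝ := fun i j => if i ∈ T ∧ j ∈ B then Real.exp θ else 1 with hh
  have hprod : ∀ f : α → α, ∏ i, h i (f i) = Real.exp (θ * (T.filter fun y => f y ∈ B).card) := by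
    intro f
    have h1 : ∏ i, h i (f i) = ∏ i ∈ T.filter fun y => f y ∈ B, Real.exp θ := by
      rw [hh, Finset.prod_ite, Finset.prod_const_one, mul_one]
      refine Finset.prod_congr ?_ fun _ _ => rfl
      ext y
      simp
    rw [h1, Finset.prod_const, ← Real.exp_nat_mul, mul_comm]
  have hsum : ∀ i, ∑ j ∈ t i, h i j = if i ∈ T then n + (Real.exp θ - 1) * B.card else 1 := by
    intro i
    by_cases hi : i ∈ T
    · simp only [ht, hh, hi, if_true, true_and]
      rw [Finset.sum_ite, Finset.sum_const, Finset.sum_const, Finset.filter_mem_eq_inter,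
        Finset.univ_inter]
      have h2 : ((Finset.univ.filter fun x => x ∉ B).card : ℝ) = n - B.card := by
        rw [hn, ← Finset.compl_filter, Finset.card_compl, Finset.filter_mem_eq_inter,
          Finset.univ_inter, Nat.cast_sub (Finset.card_le_univ B)]
      rw [nsmul_eq_mul, nsmul_eq_mul, h2]
      ring
    · simp [ht, hh, hi]
  have hexp : Real.exp θ - 1 ≤ θ + θ ^ 2 := by
    have h1 := (abs_le.1 (Real.abs_exp_sub_one_sub_id_le (x := θ)
      (abs_le.2 ⟨by linarith, by linarith⟩))).2
    linarith
  have hfac : n + (Real.exp θ - 1) * B.card ≤ n * Real.exp ((θ + θ ^ 2) * β) := by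
    have h1 : (Real.exp θ - 1) * B.card ≤ (θ + θ ^ 2) * (β * n) := by
      gcongr
    have h2 := Real.add_one_le_exp ((θ + θ ^ 2) * β)
    calc _ ≤ n * ((θ + θ ^ 2) * β + 1) := by linarith
      _ ≤ _ := by gcongr
  have hfac0 : 0 ≤ n + (Real.exp θ - 1) * B.card := by
    have : 0 ≤ Real.exp θ - 1 := by linarith [Real.add_one_le_exp θ, show 0 ≤ θ by positivity]
    positivity
  have htotal : ∑ f ∈ Fintype.piFinset t, Real.exp (θ * (T.filter fun y => f y ∈ B).card) ≤
      n ^ T.card * Real.exp ((θ + θ ^ 2) * β * T.card) := by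
    rw [← Finset.sum_congr rfl fun f _ => hprod f, ← Finset.prod_univ_sum,
      Finset.prod_congr rfl fun i _ => hsum i, Finset.prod_ite, Finset.prod_const_one, mul_one,
      Finset.prod_const, Finset.filter_mem_eq_inter, Finset.univ_inter]
    refine (pow_le_pow_left₀ hfac0 hfac _).trans_eq ?_
    rw [mul_pow, ← Real.exp_nat_mul]
    ring_nf
  set F := Finset.univ.filter fun f : α → α => (∀ i ∉ T, f i = g i) ∧
      (β + ν) * T.card ≤ ((T.filter fun y => f y ∈ B).card : ℝ) with hF
  have hFt : F ⊆ Fintype.piFinset t := by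
    intro f hf
    rw [Fintype.mem_piFinset]
    intro i
    by_cases hi : i ∈ T
    · simp [ht, hi]
    · simpa [ht, hi] using (Finset.mem_filter.1 hf).2.1 i hi
  have hmarkov : F.card * Real.exp (θ * ((β + ν) * T.card)) ≤
      n ^ T.card * Real.exp ((θ + θ ^ 2) * β * T.card) := by
    refine le_trans ?_ htotal
    rw [← nsmul_eq_mul, ← Finset.sum_const]
    refine (Finset.sum_le_sum fun f hf => ?_).trans
      (Finset.sum_le_sum_of_subset_of_nonneg hFt fun _ _ _ => (Real.exp_pos _).le)
    rw [Real.exp_le_exp]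
    exact mul_le_mul_of_nonneg_left (Finset.mem_filter.1 hf).2.2 (by positivity)
  rw [← le_div_iff₀ (Real.exp_pos _), mul_div_assoc, ← Real.exp_sub] at hmarkov
  refine hmarkov.trans ?_
  gcongr
  have h1 : θ ^ 2 * β ≤ θ ^ 2 * 1 := by gcongr
  have h2 : (θ + θ ^ 2) * β * T.card - θ * ((β + ν) * T.card) =
    (θ ^ 2 * β - θ * ν) * T.card := by ring
  rw [h2]
  gcongr
  rw [hθ] at h1 ⊢
  linarith

open Classical in
/-- The partial maps with domain `insert i.1 i.2` which send `i.1` to a vertex with at least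
`c * #i.2 - 1` non-neighbours in the image of the other points of `i.2`. -/
noncomputable def badMaps (G : SimpleGraph α) (c : ℝ) (i : α × Finset α) :
    Finset (Finset (α × α)) :=
  (Finset.univ.filter fun f : α → α => c * i.2.card ≤
    (((i.2.erase i.1).filter fun y => ¬ G.Adj (f i.1) (f y)).card : ℝ) + 1).image
      fun f => graphOn f (insert i.1 i.2)

theorem card_of_mem_badMaps {G : SimpleGraph α} {c : ℝ} {i : α × Finset α} {κ : Finset (α × α)}
    (hκ : κ ∈ badMaps G c i) : κ.card = (insert i.1 i.2).card := by
  obtain ⟨f, -, rfl⟩ := Finset.mem_image.1 hκ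
  exact card_graphOn f _

open Classical in
theorem card_badMaps_pinned_le {G : SimpleGraph α} {β ν : ℝ} (hβ0 : 0 ≤ β) (hβ1 : β ≤ 1)
    (hν0 : 0 ≤ ν) (hν1 : ν ≤ 1)
    (hG : ∀ v, ((Finset.univ.filter fun w => ¬ G.Adj v w).card : ℝ) ≤ β * Fintype.card α)
    {x x' : α} {S : Finset α} (hS : 2 ≤ ν * S.card) (e v : α) :
    (((badMaps G (β + 2 * ν) (x, S)).filter fun κ => (x', e) ∈ κ ∧ (x, v) ∈ κ).card : ℝ) ≤
      (Fintype.card α : ℝ) ^ ((S.erase x).erase x').card *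
        Real.exp (-(ν ^ 2 / 4) * (S.card - 2)) := by
  set T := (S.erase x).erase x' with hT
  set g : α → α := fun i => if i = x' then e else if i = x then v else i with hg
  have hTS : T ⊆ S := (Finset.erase_subset _ _).trans (Finset.erase_subset _ _)
  have hT1 : (T.card : ℝ) ≤ S.card := Nat.cast_le.2 (Finset.card_le_card hTS)
  have hT2 : (S.card : ℝ) - 2 ≤ T.card := by
    have h1 := Finset.pred_card_le_card_erase (s := S.erase x) (a := x')
    have h2 := Finset.pred_card_le_card_erase (s := S) (a := x)
    have h3 : S.card ≤ T.card + 2 := by rw [hT]; omega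
    have : (S.card : ℝ) ≤ T.card + 2 := by exact_mod_cast h3
    linarith
  have hcount := card_many_hits_le hβ1 hν0 hν1 (hG v) T g
  set F := Finset.univ.filter fun f : α → α => (∀ i ∉ T, f i = g i) ∧ (β + ν) * T.card ≤
    ((T.filter fun y => f y ∈ Finset.univ.filter fun w => ¬ G.Adj v w).card : ℝ) with hF
  have hsub : ((badMaps G (β + 2 * ν) (x, S)).filter fun κ => (x', e) ∈ κ ∧ (x, v) ∈ κ) ⊆
      F.image fun f => graphOn f (insert x S) := by
    intro κ hκ
    obtain ⟨hκ, hκe, hκv⟩ := Finset.mem_filter.1 hκ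
    obtain ⟨f, hf, rfl⟩ := Finset.mem_image.1 hκ
    have hf := (Finset.mem_filter.1 hf).2
    have hfe : f x' = e := (mem_graphOn.1 hκe).2
    have hfv : f x = v := (mem_graphOn.1 hκv).2
    refine Finset.mem_image.2 ⟨fun i => if i ∈ T then f i else g i, ?_, ?_⟩
    · rw [hF, Finset.mem_filter]
      refine ⟨Finset.mem_univ _, fun i hi => if_neg hi, ?_⟩
      have h1 : (T.filter fun y => (if y ∈ T then f y else g y) ∈
          Finset.univ.filter fun w => ¬ G.Adj v w) = T.filter fun y => ¬ G.Adj v (f y) :=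
        Finset.filter_congr fun y hy => by simp [hy]
      have h2 : ((S.erase x).filter fun y => ¬ G.Adj v (f y)).card ≤
          (T.filter fun y => ¬ G.Adj v (f y)).card + 1 := by
        have h3 : (S.erase x).filter (fun y => ¬ G.Adj v (f y)) ⊆
            insert x' (T.filter fun y => ¬ G.Adj v (f y)) := by
          intro y hy
          simp only [hT, Finset.mem_insert, Finset.mem_filter, Finset.mem_erase] at hy ⊢
          tauto
        exact (Finset.card_le_card h3).trans (Finset.card_insert_le _ _)
      have h2' : (((S.erase x).filter fun y => ¬ G.Adj v (f y)).card : ℝ) ≤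
          (T.filter fun y => ¬ G.Adj v (f y)).card + 1 := by exact_mod_cast h2
      simp only [hfv] at hf
      rw [h1]
      have h4 : (β + ν) * T.card ≤ (β + ν) * S.card := by gcongr
      linarith
    · refine Finset.image_congr fun i hi => ?_
      rw [Finset.mem_coe, Finset.mem_insert] at hi
      by_cases hiT : i ∈ T
      · simp [hiT]
      · simp only [hiT, if_false, Prod.mk.injEq, true_and, hg]
        split_ifs with h1 h2
        · rw [h1, hfe]
        · rw [h2, hfv]
        · exact absurd (Finset.mem_erase.2 ⟨h1, Finset.mem_erase.2 ⟨h2, hi.resolve_left h2⟩⟩) hiT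
  calc _ ≤ (F.card : ℝ) :=
        Nat.cast_le.2 ((Finset.card_le_card hsub).trans Finset.card_image_le)
    _ ≤ _ := hcount
    _ ≤ _ := by
        refine mul_le_mul_of_nonneg_left (Real.exp_le_exp.2 ?_) (by positivity)
        have := mul_le_mul_of_nonneg_left hT2 (show 0 ≤ ν ^ 2 / 4 by positivity)
        linarith

open Classical in
theorem card_badMaps_mem_le {G : SimpleGraph α} {β ν : ℝ} (hβ0 : 0 ≤ β) (hβ1 : β ≤ 1)
    (hν0 : 0 ≤ ν) (hν1 : ν ≤ 1)
    (hG : ∀ v, ((Finset.univ.filter fun w => ¬ G.Adj v w).card : ℝ) ≤ β * Fintype.card α)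
    {x x' : α} {S : Finset α} (hx' : x' ∈ insert x S) (hS : 2 ≤ ν * S.card) (e : α) :
    (((badMaps G (β + 2 * ν) (x, S)).filter fun κ => (x', e) ∈ κ).card : ℝ) ≤
      (Fintype.card α : ℝ) ^ ((insert x S).card - 1) *
        Real.exp (-(ν ^ 2 / 4) * (S.card - 2)) := by
  have hins : (insert x S).card = (S.erase x).card + 1 := by
    rw [← Finset.card_insert_of_notMem (Finset.notMem_erase x S)]
    congr 1
    ext y
    simp only [Finset.mem_insert, Finset.mem_erase]
    tauto
  have key := card_badMaps_pinned_le (x := x) (x' := x') hβ0 hβ1 hν0 hν1 hG hS e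
  by_cases hxx : x' = x
  · subst hxx
    refine le_trans (le_of_eq ?_) ((key e).trans (le_of_eq ?_))
    · simp only [and_self]
    · rw [hins, Finset.erase_eq_of_notMem (Finset.notMem_erase _ _), Nat.add_sub_cancel]
  · have hx'S : x' ∈ S.erase x := Finset.mem_erase.2 ⟨hxx, Finset.mem_of_mem_insert_of_ne hx' hxx⟩
    have hsub : ((badMaps G (β + 2 * ν) (x, S)).filter fun κ => (x', e) ∈ κ) ⊆
        Finset.univ.biUnion fun v =>
          (badMaps G (β + 2 * ν) (x, S)).filter fun κ => (x', e) ∈ κ ∧ (x, v) ∈ κ := by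
      intro κ hκ
      obtain ⟨hκ, hκe⟩ := Finset.mem_filter.1 hκ
      obtain ⟨f, hf, rfl⟩ := Finset.mem_image.1 hκ
      exact Finset.mem_biUnion.2 ⟨f x, Finset.mem_univ _, Finset.mem_filter.2 ⟨hκ, hκe,
        mem_graphOn.2 ⟨Finset.mem_insert_self _ _, rfl⟩⟩⟩
    have h1 := (Finset.card_le_card hsub).trans Finset.card_biUnion_le
    have h2 : (S.erase x).card = ((S.erase x).erase x').card + 1 :=
      (Finset.card_erase_add_one hx'S).symm
    calc _ ≤ ∑ v, (((badMaps G (β + 2 * ν) (x, S)).filter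
            fun κ => (x', e) ∈ κ ∧ (x, v) ∈ κ).card : ℝ) := by exact_mod_cast h1
      _ ≤ ∑ _v : α, _ := Finset.sum_le_sum fun v _ => key v
      _ = _ := by
          rw [Finset.sum_const, Finset.card_univ, nsmul_eq_mul, hins, Nat.add_sub_cancel, h2,
            pow_succ]
          ring

theorem inv_descFactorial_le {n m : ℕ} (h : 2 * m ^ 2 ≤ n) (hn : 0 < n) :
    ((n.descFactorial m : ℝ))⁻¹ ≤ 2 / (n : ℝ) ^ m := by
  have hn0 : (0 : ℝ) < n := Nat.cast_pos.2 hn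
  have hmn : m ≤ n := by nlinarith
  have h1 : (n : ℝ) ^ m / 2 ≤ n.descFactorial m := by
    have h2 : ((n - m : ℕ) : ℝ) ^ m ≤ n.descFactorial m := by
      exact_mod_cast (Nat.pow_le_pow_left (by omega) m).trans (Nat.pow_sub_le_descFactorial n m)
    have h' : 2 * (m : ℝ) ^ 2 ≤ n := by exact_mod_cast h
    have h3 : (1 / 2 : ℝ) ≤ (1 + -(m / n)) ^ m := by
      refine le_trans ?_ (one_add_mul_le_pow ?_ m)
      · have : (m : ℝ) * (m / n) ≤ 1 / 2 := by
          rw [← mul_div_assoc, div_le_iff₀ hn0]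
          linarith
        linarith
      · have : (m : ℝ) / n ≤ 1 := by
          rw [div_le_one hn0]
          exact_mod_cast hmn
        linarith
    calc (n : ℝ) ^ m / 2 = n ^ m * (1 / 2) := by ring
      _ ≤ n ^ m * (1 + -(m / n)) ^ m := by gcongr
      _ = ((n - m : ℕ) : ℝ) ^ m := by
          rw [← mul_pow, Nat.cast_sub hmn]
          congr 1
          field_simp
          ring
      _ ≤ _ := h2
  calc _ ≤ ((n : ℝ) ^ m / 2)⁻¹ := by gcongr
    _ = _ := by rw [inv_div]

open Classical in
theorem sum_badMaps_touches_le {G : SimpleGraph α} {β ν : ℝ} (hβ0 : 0 ≤ β) (hβ1 : β ≤ 1)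
    (hν0 : 0 ≤ ν) (hν1 : ν ≤ 1)
    (hG : ∀ v, ((Finset.univ.filter fun w => ¬ G.Adj v w).card : ℝ) ≤ β * Fintype.card α)
    {i : α × Finset α} (hS : 2 ≤ ν * i.2.card)
    (hn : 2 * (insert i.1 i.2).card ^ 2 ≤ Fintype.card α) (e : α × α) :
    ∑ κ ∈ (badMaps G (β + 2 * ν) i).filter (Touches · {e}), partialWeight κ ≤
      ((insert i.1 i.2).card / Fintype.card α + if e.1 ∈ insert i.1 i.2 then 1 else 0) *
        (2 * Real.exp (-(ν ^ 2 / 4) * (i.2.card - 2))) := by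
  obtain ⟨x, S⟩ := i
  obtain ⟨a, b⟩ := e
  dsimp only at hS hn ⊢
  set X := insert x S with hX
  set η := Real.exp (-(ν ^ 2 / 4) * (S.card - 2)) with hη
  have hη0 : 0 < η := Real.exp_pos _
  have hX0 : 0 < X.card := Finset.card_pos.2 ⟨x, Finset.mem_insert_self _ _⟩
  have hn0 : 0 < Fintype.card α := lt_of_lt_of_le (by positivity) hn
  set n := Fintype.card α with hndef
  have hnR : (0 : ℝ) < n := Nat.cast_pos.2 hn0
  have hw : ∀ κ ∈ badMaps G (β + 2 * ν) (x, S), partialWeight κ ≤ 2 / (n : ℝ) ^ X.card := by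
    intro κ hκ
    rw [partialWeight, card_of_mem_badMaps hκ]
    exact inv_descFactorial_le hn hn0
  have hpin : ∀ x' ∈ X, ∀ c, ∑ κ ∈ (badMaps G (β + 2 * ν) (x, S)).filter fun κ => (x', c) ∈ κ,
      partialWeight κ ≤ 2 * η / n := by
    intro x' hx' c
    calc _ ≤ ∑ κ ∈ (badMaps G (β + 2 * ν) (x, S)).filter fun κ => (x', c) ∈ κ,
          2 / (n : ℝ) ^ X.card := Finset.sum_le_sum fun κ hκ => hw κ (Finset.mem_filter.1 hκ).1
      _ ≤ ((n : ℝ) ^ (X.card - 1) * η) * (2 / (n : ℝ) ^ X.card) := by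
          rw [Finset.sum_const, nsmul_eq_mul]
          gcongr
          exact card_badMaps_mem_le hβ0 hβ1 hν0 hν1 hG hx' hS c
      _ = _ := by
          obtain ⟨m, hm⟩ := Nat.exists_eq_add_of_lt hX0
          rw [hm]
          simp only [zero_add, Nat.add_sub_cancel, pow_succ]
          field_simp
  have hsub : (badMaps G (β + 2 * ν) (x, S)).filter (Touches · {(a, b)}) ⊆
      (X.biUnion fun x' => (badMaps G (β + 2 * ν) (x, S)).filter fun κ => (x', b) ∈ κ) ∪
      (if a ∈ X then Finset.univ else ∅).biUnion
        fun c => (badMaps G (β + 2 * ν) (x, S)).filter fun κ => (a, c) ∈ κ := by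
    intro κ hκ
    obtain ⟨hκ', ⟨p, q⟩, hpq, f, hf, h⟩ := Finset.mem_filter.1 hκ
    rw [Finset.mem_singleton.1 hf] at h
    have hp : p ∈ X := by
      obtain ⟨g, -, rfl⟩ := Finset.mem_image.1 hκ'
      exact (mem_graphOn.1 hpq).1
    simp only [Finset.mem_union, Finset.mem_biUnion, Finset.mem_filter]
    rcases h with h | h <;> dsimp only at h <;> subst h
    · exact Or.inr ⟨q, by simp [hp], hκ', hpq⟩
    · exact Or.inl ⟨p, hp, hκ', hpq⟩
  calc _ ≤ _ := Finset.sum_le_sum_of_subset_of_nonneg hsub fun κ _ _ => partialWeight_nonneg κ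
    _ ≤ ∑ x' ∈ X, 2 * η / n + ∑ c ∈ (if a ∈ X then Finset.univ else ∅ : Finset α), 2 * η / n := by
        refine le_trans ?_ (add_le_add
          ((sum_biUnion_le_sum X _ partialWeight_nonneg).trans
            (Finset.sum_le_sum fun x' hx' => hpin x' hx' b))
          ((sum_biUnion_le_sum (if a ∈ X then Finset.univ else ∅) _ partialWeight_nonneg).trans
            (Finset.sum_le_sum fun c hc => hpin a ?_ c)))
        · rw [← Finset.sum_union_inter]
          exact le_add_of_nonneg_right (Finset.sum_nonneg fun κ _ => partialWeight_nonneg κ)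
        · by_contra ha
          simp [ha] at hc
    _ = _ := by
        rw [Finset.sum_const, Finset.sum_const, nsmul_eq_mul, nsmul_eq_mul]
        split_ifs with ha
        · rw [Finset.card_univ, ← hndef]
          field_simp
        · simp only [Finset.card_empty]
          push_cast
          ring

end BadEvents

section GoodPermutations

variable {α : Type*} [DecidableEq α] [Fintype α]

open Classical in
/-- Many random permutations map each set of a locally sparse family to a set in which all
relevant vertices have few non-neighbours, and these permutations are spread. -/
theorem exists_spread_good_perms {G : SimpleGraph α} {β ν s₀ : ℝ} (hβ0 : 0 ≤ β) (hβ1 : β ≤ 1)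
    (hν0 : 0 ≤ ν) (hν1 : ν ≤ 1)
    (hG : ∀ v, ((Finset.univ.filter fun w => ¬ G.Adj v w).card : ℝ) ≤ β * Fintype.card α)
    {I : Finset (α × Finset α)} {A M : ℕ} (hs₀ : 2 ≤ ν * s₀) (hI : ∀ i ∈ I, s₀ ≤ i.2.card)
    (hM : ∀ i ∈ I, i.2.card ≤ M)
    (hA : ∀ a, (I.filter fun i => a ∈ insert i.1 i.2).card ≤ A)
    (hn : 2 * (M + 1) ^ 2 ≤ Fintype.card α)
    (hη : (M + 1) * (2 * A * (M + 2) * Real.exp (-(ν ^ 2 / 4) * (s₀ - 2))) ≤ 1 / 4) :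
    ∃ Ω : Finset (Equiv.Perm α), Ω.Nonempty ∧
      (∀ σ ∈ Ω, ∀ i ∈ I, (((i.2.erase i.1).filter fun y => ¬ G.Adj (σ i.1) (σ y)).card : ℝ) + 1 ≤
        (β + 2 * ν) * i.2.card) ∧
      ∀ τ : Finset (α × α), ((Ω.filter fun σ => Extends σ τ).card : ℝ) ≤
        2 ^ τ.card * partialWeight τ * Ω.card := by
  set 𝓛 := I.biUnion fun i => badMaps G (β + 2 * ν) i with h𝓛
  set η := Real.exp (-(ν ^ 2 / 4) * (s₀ - 2)) with hηdef
  have hη0 : 0 < η := Real.exp_pos _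
  set δ : ℝ := 2 * A * (M + 2) * η with hδdef
  have hδ0 : 0 ≤ δ := by positivity
  have hXM : ∀ i ∈ I, (insert i.1 i.2).card ≤ M + 1 := fun i hi =>
    (Finset.card_insert_le _ _).trans (Nat.succ_le_succ (hM i hi))
  have hn0 : 0 < Fintype.card α := lt_of_lt_of_le (by positivity) hn
  have hnR : (0 : ℝ) < Fintype.card α := Nat.cast_pos.2 hn0
  have hD : ∀ κ ∈ 𝓛, κ.card ≤ M + 1 := by
    intro κ hκ
    obtain ⟨i, hi, hκ⟩ := Finset.mem_biUnion.1 hκ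
    rw [card_of_mem_badMaps hκ]
    exact hXM i hi
  have hIA : I.card ≤ A * Fintype.card α := by
    have hsub : I ⊆ Finset.univ.biUnion fun a => I.filter fun i => a ∈ insert i.1 i.2 :=
      fun i hi => Finset.mem_biUnion.2 ⟨i.1, Finset.mem_univ _,
        Finset.mem_filter.2 ⟨hi, Finset.mem_insert_self _ _⟩⟩
    refine (Finset.card_le_card hsub).trans ((Finset.card_biUnion_le_card_mul _ _ A
      fun a _ => hA a).trans ?_)
    rw [Finset.card_univ, mul_comm]
  have hδ : ∀ e : α × α, ∑ κ ∈ 𝓛.filter (Touches · {e}), partialWeight κ ≤ δ := by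
    intro e
    rw [h𝓛, Finset.filter_biUnion]
    refine (sum_biUnion_le_sum _ _ partialWeight_nonneg).trans ?_
    calc _ ≤ ∑ i ∈ I, ((M + 1) / (Fintype.card α : ℝ) +
          if e.1 ∈ insert i.1 i.2 then 1 else 0) * (2 * η) := by
          refine Finset.sum_le_sum fun i hi => ?_
          have h1 : ν * s₀ ≤ ν * i.2.card := mul_le_mul_of_nonneg_left (hI i hi) hν0
          have h2 : 2 * (insert i.1 i.2).card ^ 2 ≤ Fintype.card α :=
            le_trans (by gcongr; exact hXM i hi) hn
          refine (sum_badMaps_touches_le hβ0 hβ1 hν0 hν1 hG (hs₀.trans h1) h2 e).trans ?_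
          have h3 : ((insert i.1 i.2).card : ℝ) ≤ M + 1 := by exact_mod_cast hXM i hi
          have h4 : Real.exp (-(ν ^ 2 / 4) * (i.2.card - 2)) ≤ η := by
            rw [hηdef, Real.exp_le_exp]
            have := mul_le_mul_of_nonneg_left (hI i hi) (show 0 ≤ ν ^ 2 / 4 by positivity)
            linarith
          have h5 : (0 : ℝ) ≤ if e.1 ∈ insert i.1 i.2 then 1 else 0 := by split_ifs <;> norm_num
          gcongr
      _ = (I.card * ((M + 1) / Fintype.card α) +
          (I.filter fun i => e.1 ∈ insert i.1 i.2).card) * (2 * η) := by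
          rw [← Finset.sum_mul, Finset.sum_add_distrib, Finset.sum_const, nsmul_eq_mul,
            Finset.sum_boole]
      _ ≤ ((A * Fintype.card α) * ((M + 1) / Fintype.card α) + A) * (2 * η) := by
          have h6 : (I.card : ℝ) ≤ A * Fintype.card α := by exact_mod_cast hIA
          have h7 : ((I.filter fun i => e.1 ∈ insert i.1 i.2).card : ℝ) ≤ A :=
            Nat.cast_le.2 (hA e.1)
          gcongr
      _ = δ := by
          rw [hδdef]
          field_simp
          ring
  have hDδ : ((M + 1 : ℕ) : ℝ) * δ ≤ 1 / 4 := by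
    push_cast
    exact hη
  have hδ1 : δ ≤ 1 / 4 := by
    refine le_trans (le_mul_of_one_le_left hδ0 ?_) hDδ
    exact_mod_cast Nat.succ_pos M
  have hne : ∀ κ ∈ 𝓛, κ.Nonempty := by
    intro κ hκ
    obtain ⟨i, hi, hκ⟩ := Finset.mem_biUnion.1 hκ
    rw [← Finset.card_pos, card_of_mem_badMaps hκ]
    exact Finset.card_pos.2 ⟨i.1, Finset.mem_insert_self _ _⟩
  refine ⟨extAvoid ∅ 𝓛, extAvoid_nonempty hne hD hδ0 hδ1 hDδ hδ, fun σ hσ i hi => ?_, fun τ => ?_⟩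
  · by_contra! hlt
    refine (mem_extAvoid.1 hσ).2 (graphOn σ (insert i.1 i.2)) (Finset.mem_biUnion.2 ⟨i, hi,
      Finset.mem_image_of_mem _ (Finset.mem_filter.2 ⟨Finset.mem_univ _, hlt.le⟩)⟩) fun e he => ?_
    exact (mem_graphOn.1 he).2
  · convert card_extAvoid_le hD hδ0 hδ1 hDδ hδ τ using 3
    ext σ
    simp only [Finset.mem_filter, mem_extAvoid]
    exact ⟨fun h => ⟨h.2, h.1.2⟩, fun h => ⟨⟨by simp [Extends], h.2⟩, h.1⟩⟩

theorem inv_descFactorial_le_three_pow {n s : ℕ} (h : s ≤ n) :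
    ((n.descFactorial s : ℝ))⁻¹ ≤ (3 / n) ^ s := by
  rcases Nat.eq_zero_or_pos s with rfl | hs
  · simp
  have hn : (0 : ℝ) < n := Nat.cast_pos.2 (hs.trans_le h)
  have hs0 : (0 : ℝ) < s := Nat.cast_pos.2 hs
  have h1 : n ^ s * s.factorial ≤ s ^ s * n.descFactorial s := by
    rw [← Nat.descFactorial_self, Nat.descFactorial_eq_prod_range, Nat.descFactorial_eq_prod_range]
    have hpow : ∀ m : ℕ, m ^ s = ∏ _i ∈ Finset.range s, m := fun m => by simp
    rw [hpow n, hpow s, ← Finset.prod_mul_distrib, ← Finset.prod_mul_distrib]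
    refine Finset.prod_le_prod' fun i hi => ?_
    rw [Nat.mul_sub, Nat.mul_sub, mul_comm s n]
    exact Nat.sub_le_sub_left (Nat.mul_le_mul_right i h) _
  have h1' : (n : ℝ) ^ s * s.factorial ≤ s ^ s * n.descFactorial s := by exact_mod_cast h1
  have hf : (0 : ℝ) < s.factorial := Nat.cast_pos.2 s.factorial_pos
  have h2 : (s : ℝ) ^ s ≤ 3 ^ s * s.factorial := by
    have h3 := Real.pow_div_factorial_le_exp (s : ℝ) hs0.le s
    rw [div_le_iff₀ hf] at h3
    refine h3.trans (mul_le_mul_of_nonneg_right ?_ hf.le)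
    rw [← mul_one (s : ℝ), Real.exp_nat_mul]
    exact pow_le_pow_left₀ (Real.exp_pos _).le Real.exp_one_lt_three.le s
  have hd : (0 : ℝ) < n.descFactorial s := Nat.cast_pos.2 (Nat.descFactorial_pos.2 h)
  have h4 : (n : ℝ) ^ s ≤ 3 ^ s * n.descFactorial s := by
    refine le_of_mul_le_mul_right ?_ hf
    calc _ ≤ _ := h1'
      _ ≤ 3 ^ s * s.factorial * n.descFactorial s := by gcongr
      _ = _ := by ring
  rw [div_pow, inv_eq_one_div, div_le_div_iff₀ hd (by positivity), one_mul]
  exact h4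

open Classical in
/-- Rearranging a spread random permutation inside bounded blocks keeps it spread. -/
theorem spread_of_blocks {Ω : Finset (Equiv.Perm α)}
    (hΩ : ∀ τ : Finset (α × α), ((Ω.filter fun σ => Extends σ τ).card : ℝ) ≤
        2 ^ τ.card * partialWeight τ * Ω.card)
    {blk : α → ℕ} {L : ℕ} (hL : ∀ j, (Finset.univ.filter fun a => blk a = j).card ≤ L)
    (ψ : Equiv.Perm α → α → α) (hψ : ∀ σ ∈ Ω, ∀ a, blk (σ.symm (ψ σ a)) = blk a)
    (X : Finset α) (g : α → α) :
    ((Ω.filter fun σ => ∀ x ∈ X, ψ σ (g x) = x).card : ℝ) ≤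
      (6 * L / Fintype.card α) ^ X.card * Ω.card := by
  set t : α → Finset α := fun x =>
    if x ∈ X then Finset.univ.filter fun a => blk a = blk (g x) else {x} with ht
  set τ : (α → α) → Finset (α × α) := fun h => X.image fun x => (h x, x) with hτ
  have hτc : ∀ h, (τ h).card = X.card := fun h =>
    Finset.card_image_of_injective _ fun _ _ h => (Prod.ext_iff.1 h).2
  have hsub : (Ω.filter fun σ => ∀ x ∈ X, ψ σ (g x) = x) ⊆
      (Fintype.piFinset t).biUnion fun h => Ω.filter fun σ => Extends σ (τ h) := by
    intro σ hσ
    obtain ⟨hσ, hX⟩ := Finset.mem_filter.1 hσ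
    refine Finset.mem_biUnion.2 ⟨fun x => if x ∈ X then σ.symm x else x, ?_, ?_⟩
    · rw [Fintype.mem_piFinset]
      intro x
      by_cases hx : x ∈ X
      · have := hψ σ hσ (g x)
        rw [hX x hx] at this
        simpa [ht, hx] using this
      · simp [ht, hx]
    · refine Finset.mem_filter.2 ⟨hσ, fun e he => ?_⟩
      obtain ⟨x, hx, rfl⟩ := Finset.mem_image.1 he
      simp [hx]
  have hpi : (Fintype.piFinset t).card ≤ L ^ X.card := by
    rw [Fintype.card_piFinset, ← Finset.prod_const, ← Finset.prod_subset (Finset.subset_univ X)]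
    · refine Finset.prod_le_prod' fun x hx => ?_
      simp only [ht, hx, if_true]
      exact hL _
    · intro x _ hx
      simp [ht, hx]
  have hw : ∀ h, partialWeight (τ h) ≤ (3 / Fintype.card α) ^ X.card := fun h => by
    rw [partialWeight, hτc]
    exact inv_descFactorial_le_three_pow (Finset.card_le_univ X)
  calc _ ≤ ∑ h ∈ Fintype.piFinset t, ((Ω.filter fun σ => Extends σ (τ h)).card : ℝ) := by
        exact_mod_cast (Finset.card_le_card hsub).trans Finset.card_biUnion_le
    _ ≤ ∑ h ∈ Fintype.piFinset t, 2 ^ X.card * (3 / (Fintype.card α : ℝ)) ^ X.card * Ω.card := by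
        refine Finset.sum_le_sum fun h _ => (hΩ (τ h)).trans ?_
        rw [hτc]
        gcongr
        exact hw h
    _ = (Fintype.piFinset t).card *
        (2 ^ X.card * (3 / (Fintype.card α : ℝ)) ^ X.card * Ω.card) := by
        rw [Finset.sum_const, nsmul_eq_mul]
    _ ≤ (L : ℝ) ^ X.card * (2 ^ X.card * (3 / (Fintype.card α : ℝ)) ^ X.card * Ω.card) := by
        gcongr
        exact_mod_cast hpi
    _ = _ := by
        rw [← mul_assoc, ← mul_assoc, ← mul_pow, ← mul_pow]
        congr 2
        ring

end GoodPermutations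

section CyclicChains

open Classical

lemma nonNbrs_union_card_le {α : Type*} (G : SimpleGraph α) (R U : Finset α) (v : α) :
    ((nonNbrs G (R ∪ U) v).card : ℝ) ≤ (nonNbrs G R v).card + (nonNbrs G U v).card := by
  rw [nonNbrs, Finset.filter_union]
  exact_mod_cast Finset.card_union_le _ _

/-- A dense set contains a chain of length `ℓ` extending a given chain and avoiding a short
list. -/
lemma exists_chain_avoiding {α : Type} {G : SimpleGraph α} {ℓ : ℕ} {μ : ℝ} (hμ : 0 ≤ μ)
    {W : Finset α} (hW : 4 * (ℓ + 1) * (ℓ + 1) ≤ W.card) {X A : List α} (hA : A.length ≤ ℓ)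
    (hX : ∀ v ∈ X, ((nonNbrs G W v).card : ℝ) ≤ (1 / (ℓ + 1) - μ) * W.card)
    (hWD : ∀ v ∈ W, ((nonNbrs G W v).card : ℝ) ≤ (1 / (ℓ + 1) - μ) * W.card)
    (hXc : PowChain G ℓ X) :
    ∃ z : List α, z.length = ℓ ∧ z.Nodup ∧ (∀ x ∈ z, x ∈ W) ∧ (∀ x ∈ z, x ∉ A) ∧
      PowChain G ℓ (X ++ z) := by
  have hW0 : 0 < W.card := lt_of_lt_of_le (by positivity) hW
  have hWR : (4 : ℝ) * (ℓ + 1) * (ℓ + 1) ≤ W.card := by exact_mod_cast hW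
  have hWR0 : (0 : ℝ) < W.card := by exact_mod_cast hW0
  obtain ⟨v₀, hv₀⟩ := Finset.card_pos.1 hW0
  have hD : (0 : ℝ) ≤ (1 / (ℓ + 1) - μ) * W.card := (Nat.cast_nonneg _).trans (hWD v₀ hv₀)
  set W' := W \ A.toFinset with hW'
  have hsub : W' ⊆ W := Finset.sdiff_subset
  have hcard := card_sub_length_le W A
  have hAR : (A.length : ℝ) ≤ ℓ := by exact_mod_cast hA
  obtain ⟨z, h1, h2, h3, h4, -⟩ := exists_chain_in_family_card (G := G) (ℓ := ℓ)
    (κ := 1 / (2 * (ℓ + 1))) hWR0 (by positivity) hD ℓ (W := W')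
    (I := ({()} : Finset Unit)) (A := fun _ => W') (X := X)
    (by exact_mod_cast Finset.card_le_card hsub) (by simp) (by simp)
    (by
      intro _ _
      have e1 : (ℓ : ℝ) * ((1 / (ℓ + 1) - μ) * W.card) =
          W.card - 1 / (ℓ + 1) * W.card - ℓ * (μ * W.card) := by
        field_simp
        ring
      have e2 : (1 : ℝ) / (2 * (ℓ + 1)) * W.card = 1 / 2 * (1 / (ℓ + 1) * W.card) := by
        field_simp
      have e3 : (4 : ℝ) * (ℓ + 1) ≤ 1 / (ℓ + 1) * W.card := by
        rw [one_div, ← div_eq_inv_mul, le_div_iff₀ (by positivity)]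
        exact hWR
      have e4 : 0 ≤ (ℓ : ℝ) * (μ * W.card) := by positivity
      rw [e1, e2]
      linarith)
    (fun v hv => (nonNbrs_card_mono hsub v).trans (hWD v (hsub hv)))
    (fun v hv => (nonNbrs_card_mono hsub v).trans (hX v hv)) hXc
  exact ⟨z, h1, h2, fun x hx => hsub (h3 x hx),
    fun x hx => by simpa using (Finset.mem_sdiff.1 (h3 x hx)).2, h4⟩

/-- Blocks in a cyclic order are spanned by chains which can be concatenated. -/
theorem exists_cyclic_chains {ℓ : ℕ} (hℓ : 1 ≤ ℓ) {μ : ℝ} (hμ : 0 < μ) :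
    ∃ q : ℕ, 2 ≤ q ∧ ∃ b₀ : ℕ, ∀ (α : Type) (G : SimpleGraph α) (B : ℕ) (prev : ℕ → ℕ)
      (R U : ℕ → Finset α), (∀ j < B, prev j < B) → (∀ j < B, Disjoint (R j) (U j)) →
      (∀ j < B, b₀ ≤ (R j ∪ U j).card) → (∀ j < B, q * (R j).card ≤ (R j ∪ U j).card) →
      (∀ j < B, (R j ∪ U j).card ≤ 2 * q * (R j).card) →
      (∀ j < B, ∀ v, (v ∈ R j ∪ U j ∨ v ∈ R (prev j) ∪ U (prev j)) →
        ((nonNbrs G (R j) v).card : ℝ) ≤ (1 / (ℓ + 1) - μ) * (R j).card ∧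
        ((nonNbrs G (U j) v).card : ℝ) ≤ (1 / (ℓ + 1) - μ) * (U j).card) →
      ∃ D : ℕ → List α, ∀ j < B, (D j).Nodup ∧ (D j).toFinset = R j ∪ U j ∧
        PowChain G ℓ (D j) ∧ PowChain G ℓ (D (prev j) ++ (D j).take ℓ) := by
  obtain ⟨q, hq, b₀, hT⟩ := exists_spanning_chain hℓ hμ
  refine ⟨q, hq, max b₀ (4 * (ℓ + 1) * (ℓ + 1)), fun α G B prev R U hprev hdis hb h1 h2 hdeg => ?_⟩
  have hV : ∀ j < B, ∀ v, (v ∈ R j ∪ U j ∨ v ∈ R (prev j) ∪ U (prev j)) →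
      ((nonNbrs G (R j ∪ U j) v).card : ℝ) ≤ (1 / (ℓ + 1) - μ) * (R j ∪ U j).card := by
    intro j hj v hv
    obtain ⟨g1, g2⟩ := hdeg j hj v hv
    refine (nonNbrs_union_card_le G _ _ v).trans ((add_le_add g1 g2).trans ?_)
    rw [← mul_add, Finset.card_union_of_disjoint (hdis j hj)]
    push_cast
    exact le_rfl
  have ha : ∀ j, ∃ a : List α, j < B → a.length = ℓ ∧ a.Nodup ∧ (∀ x ∈ a, x ∈ R j ∪ U j) ∧
      PowChain G ℓ a := by
    intro j
    by_cases hj : j < B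
    · obtain ⟨z, z1, z2, z3, -, z5⟩ := exists_chain_avoiding (G := G) hμ.le
        ((le_max_right _ _).trans (hb j hj)) (X := []) (A := []) (by simp) (by simp)
        (fun v hv => hV j hj v (Or.inl hv)) trivial
      exact ⟨z, fun _ => ⟨z1, z2, z3, z5⟩⟩
    · exact ⟨[], fun h => absurd h hj⟩
  choose a ha using ha
  have hD : ∀ j, ∃ D : List α, j < B → ∃ M c : List α, D = c ++ M ++ a j ∧ D.Nodup ∧
      D.toFinset = R j ∪ U j ∧ PowChain G ℓ D ∧ c.length = ℓ ∧
      PowChain G ℓ (a (prev j) ++ c) := by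
    intro j
    by_cases hj : j < B
    · obtain ⟨a1, a2, a3, a4⟩ := ha j hj
      obtain ⟨p1, p2, p3, p4⟩ := ha _ (hprev j hj)
      obtain ⟨c, c1, c2, c3, c4, c5⟩ := exists_chain_avoiding (G := G) hμ.le
        ((le_max_right _ _).trans (hb j hj)) (X := a (prev j)) (A := a j) a1.le
        (fun v hv => hV j hj v (Or.inr (p3 v hv)))
        (fun v hv => hV j hj v (Or.inl hv)) p4
      obtain ⟨M, M1, M2, M3⟩ := hT α G (R j) (U j) c (a j) (hdis j hj)
        ((le_max_left _ _).trans (hb j hj)) (h1 j hj) (h2 j hj)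
        (fun v hv => (hdeg j hj v (Or.inl hv)).1) (fun v hv => (hdeg j hj v (Or.inl hv)).2) c1 a1
        (List.nodup_append.2 ⟨c2, a2, fun x hx y hy h => c4 x hx (h ▸ hy)⟩)
        (fun v hv => (List.mem_append.1 hv).elim (c3 v) (a3 v)) c5.right_of_append a4
      exact ⟨_, fun _ => ⟨M, c, rfl, M1, M2, M3, c1, c5⟩⟩
    · exact ⟨[], fun h => absurd h hj⟩
  choose D hD using hD
  refine ⟨D, fun j hj => ?_⟩
  obtain ⟨M, c, d1, d2, d3, d4, d5, d6⟩ := hD j hj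
  obtain ⟨M', c', e1, -, -, e4, -, -⟩ := hD _ (hprev j hj)
  refine ⟨d2, d3, d4, ?_⟩
  have : (D j).take ℓ = c := by
    rw [d1, List.append_assoc, List.take_left' d5]
  rw [this, e1]
  rw [e1] at e4
  exact PowChain.glue (ha _ (hprev j hj)).1.ge d6 e4

end CyclicChains

section Layout

/-- The index of the block of `x` when `{0, …, n - 1}` is cut into `n / b` intervals of length at
least `b`. -/
def blockIndex (b n x : ℕ) : ℕ := min (x / b) (n / b - 1)

/-- The length of the `j`th block. -/
def blockLen (b n j : ℕ) : ℕ := if j + 1 = n / b then b + n % b else b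

/-- The block preceding the `j`th block in the cyclic order. -/
def prevBlock (b n j : ℕ) : ℕ := if j = 0 then n / b - 1 else j - 1

lemma blockLen_ge (b n j : ℕ) : b ≤ blockLen b n j := by
  unfold blockLen; split <;> omega

lemma blockLen_le {b : ℕ} (hb : 0 < b) (n j : ℕ) : blockLen b n j ≤ 2 * b := by
  have := Nat.mod_lt n hb
  unfold blockLen; split <;> omega

lemma block_end_le {b n j : ℕ} (hj : j < n / b) : j * b + blockLen b n j ≤ n := by
  have h := Nat.div_add_mod n b
  unfold blockLen
  split_ifs with h1
  · rw [← h1] at h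
    rw [mul_comm, add_mul, one_mul] at h
    omega
  · have : (j + 1) * b ≤ n / b * b := Nat.mul_le_mul_right _ hj
    rw [add_mul, one_mul] at this
    rw [mul_comm b] at h
    omega

lemma blockIndex_lt {b n : ℕ} (hb : 0 < b) (hbn : b ≤ n) (x : ℕ) : blockIndex b n x < n / b := by
  have := Nat.div_pos hbn hb
  unfold blockIndex
  omega

lemma blockIndex_mul_le (b n x : ℕ) : blockIndex b n x * b ≤ x :=
  (Nat.mul_le_mul_right _ (min_le_left _ _)).trans (Nat.div_mul_le_self x b)

lemma lt_blockIndex_mul_add {b n x : ℕ} (hb : 0 < b) (hbn : b ≤ n) (hx : x < n) :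
    x < blockIndex b n x * b + blockLen b n (blockIndex b n x) := by
  have hB := Nat.div_pos hbn hb
  rcases lt_or_ge (x / b) (n / b - 1) with h | h
  · have : blockIndex b n x = x / b := min_eq_left h.le
    rw [this, blockLen, if_neg (by omega), mul_comm]
    have := Nat.div_add_mod x b
    have := Nat.mod_lt x hb
    omega
  · have : blockIndex b n x = n / b - 1 := min_eq_right h
    rw [this, blockLen, if_pos (by omega)]
    have h1 := Nat.div_add_mod n b
    have h2 : (n / b - 1) * b + b = b * (n / b) := by
      rw [← Nat.succ_mul, Nat.succ_eq_add_one, Nat.sub_add_cancel hB, mul_comm]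
    omega

lemma blockIndex_eq {b n j x : ℕ} (hb : 0 < b) (hj : j < n / b) (h1 : j * b ≤ x)
    (h2 : x < j * b + blockLen b n j) : blockIndex b n x = j := by
  have g1 : j ≤ x / b := (Nat.le_div_iff_mul_le hb).2 h1
  unfold blockLen at h2
  unfold blockIndex
  split_ifs at h2 with h
  · omega
  · have : x / b < j + 1 := (Nat.div_lt_iff_lt_mul hb).2 (by rw [add_mul, one_mul]; exact h2)
    omega

lemma prevBlock_lt {b n j : ℕ} (hj : j < n / b) : prevBlock b n j < n / b := by
  unfold prevBlock; split <;> omega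

/-- Moving forward from `x` by at most `b` steps leads to the same or to the next block. -/
lemma blockIndex_add_mod {b n x d : ℕ} (hb : 0 < b) (hbn : 2 * b ≤ n) (hx : x < n) (hd : d < b) :
    (blockIndex b n ((x + d) % n) = blockIndex b n x ∧
      (x + d) % n - blockIndex b n x * b = x - blockIndex b n x * b + d) ∨
    (prevBlock b n (blockIndex b n ((x + d) % n)) = blockIndex b n x ∧
      x - blockIndex b n x * b + d = blockLen b n (blockIndex b n x) +
        ((x + d) % n - blockIndex b n ((x + d) % n) * b) ∧
      (x + d) % n - blockIndex b n ((x + d) % n) * b < d) := by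
  have hB : 2 ≤ n / b := (Nat.le_div_iff_mul_le hb).2 hbn
  have hj := blockIndex_lt hb (by omega : b ≤ n) x
  have h1 := blockIndex_mul_le b n x
  have h2 := lt_blockIndex_mul_add hb (by omega : b ≤ n) hx
  have h3 := block_end_le hj
  set j := blockIndex b n x
  by_cases hc : x + d < j * b + blockLen b n j
  · left
    rw [Nat.mod_eq_of_lt (by omega)]
    exact ⟨blockIndex_eq hb hj (by omega) hc, by omega⟩
  · right
    by_cases hjB : j + 1 = n / b
    · have h4 : j * b + blockLen b n j = n := by
        have h := Nat.div_add_mod n b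
        rw [blockLen, if_pos hjB]
        rw [← hjB, mul_comm, add_mul, one_mul] at h
        omega
      have h5 : (x + d) % n = x + d - n := by
        rw [Nat.mod_eq_sub_mod (by omega), Nat.mod_eq_of_lt (by omega)]
      have h6 : blockIndex b n ((x + d) % n) = 0 :=
        blockIndex_eq hb (by omega) (by omega) (by have := blockLen_ge b n 0; omega)
      rw [h6, h5]
      refine ⟨by rw [prevBlock, if_pos rfl]; omega, by omega, by omega⟩
    · have h4 : blockLen b n j = b := by rw [blockLen, if_neg hjB]
      have h6 : (j + 1) * b = j * b + b := by ring
      have h7 := block_end_le (show j + 1 < n / b by omega)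
      have h8 := blockLen_ge b n (j + 1)
      rw [Nat.mod_eq_of_lt (by omega)]
      have h5 : blockIndex b n (x + d) = j + 1 :=
        blockIndex_eq hb (by omega) (by omega) (by omega)
      rw [h5]
      exact ⟨by rw [prevBlock, if_neg (by omega)]; omega, by omega, by omega⟩

lemma card_fin_interval {n s t : ℕ} (ht : t ≤ n) :
    (Finset.univ.filter fun a : Fin n => s ≤ (a : ℕ) ∧ (a : ℕ) < t).card = t - s := by
  rw [← Finset.card_map Fin.valEmbedding, ← Nat.card_Ico]
  congr 1
  ext a
  simp only [Finset.mem_map, Finset.mem_filter, Finset.mem_univ, true_and, Fin.valEmbedding_apply,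
    Finset.mem_Ico]
  exact ⟨fun ⟨x, h, hx⟩ => hx ▸ h, fun h => ⟨⟨a, by omega⟩, h, rfl⟩⟩

/-- The first `1 / q` proportion of the `j`th block. -/
def blockHead (q b n j : ℕ) : Finset (Fin n) :=
  Finset.univ.filter fun a : Fin n => j * b ≤ (a : ℕ) ∧ (a : ℕ) < j * b + blockLen b n j / q

/-- The rest of the `j`th block. -/
def blockTail (q b n j : ℕ) : Finset (Fin n) :=
  Finset.univ.filter fun a : Fin n =>
    j * b + blockLen b n j / q ≤ (a : ℕ) ∧ (a : ℕ) < j * b + blockLen b n j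

variable {q b n j : ℕ}

lemma card_blockHead (hj : j < n / b) : (blockHead q b n j).card = blockLen b n j / q := by
  have h := block_end_le hj
  have := Nat.div_le_self (blockLen b n j) q
  rw [blockHead, card_fin_interval (by generalize blockLen b n j / q = h at *; omega)]
  exact Nat.add_sub_cancel_left _ _

lemma card_blockTail (hj : j < n / b) :
    (blockTail q b n j).card = blockLen b n j - blockLen b n j / q := by
  rw [blockTail, card_fin_interval (block_end_le hj)]
  omega

lemma disjoint_blockHead_blockTail : Disjoint (blockHead q b n j) (blockTail q b n j) := by
  rw [Finset.disjoint_left]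
  intro a h1 h2
  have h1 := (Finset.mem_filter.1 h1).2
  have h2 := (Finset.mem_filter.1 h2).2
  omega

lemma card_block (hj : j < n / b) :
    (blockHead q b n j ∪ blockTail q b n j).card = blockLen b n j := by
  rw [Finset.card_union_of_disjoint disjoint_blockHead_blockTail, card_blockHead hj,
    card_blockTail hj]
  have := Nat.div_le_self (blockLen b n j) q
  omega

lemma mem_block (hb : 0 < b) (hbn : b ≤ n) (hj : j < n / b) {a : Fin n} :
    a ∈ blockHead q b n j ∪ blockTail q b n j ↔ blockIndex b n a = j := by
  simp only [blockHead, blockTail, Finset.mem_union, Finset.mem_filter, Finset.mem_univ, true_and]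
  have := Nat.div_le_self (blockLen b n j) q
  generalize hlen : blockLen b n j / q = m at *
  constructor
  · rintro (h | h)
    · exact blockIndex_eq hb hj h.1 (by omega)
    · exact blockIndex_eq hb hj (by omega) h.2
  · rintro rfl
    have h1 := blockIndex_mul_le b n a
    have h2 := lt_blockIndex_mul_add hb hbn a.2
    omega

lemma card_filter_blockIndex_le (hb : 0 < b) (hbn : b ≤ n) (j : ℕ) :
    (Finset.univ.filter fun a : Fin n => blockIndex b n a = j).card ≤ 2 * b := by
  by_cases hj : j < n / b
  · refine (Finset.card_le_card (t := blockHead 1 b n j ∪ blockTail 1 b n j) fun a ha =>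
      (mem_block hb hbn hj).2 (Finset.mem_filter.1 ha).2).trans ?_
    rw [card_block hj]
    exact blockLen_le hb n j
  · rw [Finset.filter_false_of_mem fun a _ h => hj (by rw [← h]; exact blockIndex_lt hb hbn a)]
    simp

open Classical in
/-- The pairs of a position and a part of a block in which it should have large degree. -/
noncomputable def blockPairs (q b n : ℕ) : Finset (Fin n × Finset (Fin n)) :=
  Finset.univ.filter fun i => ∃ j < n / b,
    (blockIndex b n i.1 = j ∨ blockIndex b n i.1 = prevBlock b n j) ∧
    (i.2 = blockHead q b n j ∨ i.2 = blockTail q b n j)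

lemma mem_blockPairs {i : Fin n × Finset (Fin n)} : i ∈ blockPairs q b n ↔ ∃ j < n / b,
    (blockIndex b n i.1 = j ∨ blockIndex b n i.1 = prevBlock b n j) ∧
    (i.2 = blockHead q b n j ∨ i.2 = blockTail q b n j) := by
  simp [blockPairs]

lemma le_card_of_mem_blockPairs (hq : 2 ≤ q) {i : Fin n × Finset (Fin n)}
    (hi : i ∈ blockPairs q b n) : b / q ≤ i.2.card := by
  obtain ⟨j, hj, -, h⟩ := mem_blockPairs.1 hi
  have h1 := blockLen_ge b n j
  have h2 : b / q ≤ blockLen b n j / q := Nat.div_le_div_right h1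
  have h3 : blockLen b n j / q ≤ blockLen b n j / 2 := Nat.div_le_div_left hq (by norm_num)
  rcases h with h | h <;> rw [h]
  · rwa [card_blockHead hj]
  · rw [card_blockTail hj]
    omega

lemma card_le_of_mem_blockPairs (hb : 0 < b) {i : Fin n × Finset (Fin n)}
    (hi : i ∈ blockPairs q b n) : i.2.card ≤ 2 * b := by
  obtain ⟨j, hj, -, h⟩ := mem_blockPairs.1 hi
  have h1 := blockLen_le hb n j
  have h2 := Nat.div_le_self (blockLen b n j) q
  rcases h with h | h <;> rw [h]
  · rw [card_blockHead hj]
    exact h2.trans h1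
  · rw [card_blockTail hj]
    exact (Nat.sub_le _ _).trans h1

open Classical in
lemma card_blockPairs_filter_le (hb : 0 < b) (hbn : b ≤ n) (a : Fin n) :
    ((blockPairs q b n).filter fun i => a ∈ insert i.1 i.2).card ≤ 8 * b + 4 := by
  set j := blockIndex b n a with hj
  set j' := if j + 1 = n / b then 0 else j + 1 with hj'
  set F := Finset.univ.filter fun x : Fin n => blockIndex b n x = j
  set F' := Finset.univ.filter fun x : Fin n => blockIndex b n x = prevBlock b n j
  have hF : F.card ≤ 2 * b := card_filter_blockIndex_le hb hbn _
  have hF' : F'.card ≤ 2 * b := card_filter_blockIndex_le hb hbn _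
  have hsub : ((blockPairs q b n).filter fun i => a ∈ insert i.1 i.2) ⊆
      ({a} ×ˢ {blockHead q b n j, blockTail q b n j, blockHead q b n j', blockTail q b n j'}) ∪
        ((F ∪ F') ×ˢ {blockHead q b n j, blockTail q b n j}) := by
    rintro ⟨x, S⟩ hi
    obtain ⟨hi, hins⟩ := Finset.mem_filter.1 hi
    obtain ⟨k, hk, hx, hS⟩ := mem_blockPairs.1 hi
    simp only [Finset.mem_union, Finset.mem_product, Finset.mem_singleton, Finset.mem_insert]
      at hx hS hins ⊢
    rcases hins with rfl | ha
    · left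
      refine ⟨rfl, ?_⟩
      have hk' : k = j ∨ k = j' := by
        rcases hx with h | h
        · exact Or.inl (h.symm.trans hj.symm)
        · right
          rw [← hj] at h
          rw [hj']
          unfold prevBlock at h
          split_ifs at h ⊢ <;> omega
      rcases hk' with rfl | rfl <;> tauto
    · right
      have hkj : j = k := (mem_block (q := q) hb hbn hk).1
        (Finset.mem_union.2 (hS.imp (fun h => by rwa [← h]) (fun h => by rwa [← h])))
      rw [← hkj] at hx hS
      refine ⟨hx.imp (fun h => ?_) (fun h => ?_), hS⟩ <;> simp [F, F', h]
  refine (Finset.card_le_card hsub).trans ((Finset.card_union_le _ _).trans ?_)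
  rw [Finset.card_product, Finset.card_product, Finset.card_singleton, one_mul]
  have h1 := Finset.card_le_four (a := blockHead q b n j) (b := blockTail q b n j)
    (c := blockHead q b n j') (d := blockTail q b n j')
  have h2 := Finset.card_le_two (a := blockHead q b n j) (b := blockTail q b n j)
  have h3 := Finset.card_union_le F F'
  have h4 := Nat.mul_le_mul (h3.trans (add_le_add hF hF')) h2
  omega

end Layout

section BlockOrder

open Classical

lemma nonNbrs_image_card_le {α β : Type*} [DecidableEq β] {G : SimpleGraph α} (σ : β ≃ α)
    (S : Finset β) (x : β) : ((nonNbrs G (S.image σ) (σ x)).card : ℝ) ≤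
      (((S.erase x).filter fun y => ¬ G.Adj (σ x) (σ y)).card : ℝ) + 1 := by
  have h : nonNbrs G (S.image σ) (σ x) ⊆
      (insert x ((S.erase x).filter fun y => ¬ G.Adj (σ x) (σ y))).image σ := by
    intro v hv
    obtain ⟨hv, hadj⟩ := Finset.mem_filter.1 hv
    obtain ⟨y, hy, rfl⟩ := Finset.mem_image.1 hv
    refine Finset.mem_image_of_mem _ (Finset.mem_insert.2 ?_)
    by_cases hxy : y = x
    · exact Or.inl hxy
    · exact Or.inr (Finset.mem_filter.2 ⟨Finset.mem_erase.2 ⟨hxy, hy⟩, hadj⟩)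
  exact_mod_cast (Finset.card_le_card h).trans
    (Finset.card_image_le.trans (Finset.card_insert_le _ _))

/-- A permutation all of whose blocks are dense can be reordered within the blocks to the `ℓ`th
power of a Hamilton cycle. -/
theorem exists_block_order {ℓ : ℕ} (hℓ : 1 ≤ ℓ) {μ : ℝ} (hμ : 0 < μ) :
    ∃ q : ℕ, 2 ≤ q ∧ ∃ b₀ : ℕ, ∀ b n : ℕ, b₀ ≤ b → 2 * b ≤ n →
      ∀ (α : Type) (G : SimpleGraph α) (σ : Fin n ≃ α),
      (∀ i ∈ blockPairs q b n,
        (((i.2.erase i.1).filter fun y => ¬ G.Adj (σ i.1) (σ y)).card : ℝ) + 1 ≤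
          (1 / (ℓ + 1) - μ) * i.2.card) →
      ∃ ψ : Fin n ≃ α, (∀ x, blockIndex b n (σ.symm (ψ x)) = blockIndex b n x) ∧
        ∀ x y : Fin n, ∀ d, 1 ≤ d → d ≤ ℓ → (y : ℕ) = (x + d) % n → G.Adj (ψ x) (ψ y) := by
  obtain ⟨q, hq, b₀, hC⟩ := exists_cyclic_chains hℓ hμ
  refine ⟨q, hq, max b₀ (max q (ℓ + 1)), fun b n hb hbn α G σ hσ => ?_⟩
  have hb₀ : b₀ ≤ b := (le_max_left _ _).trans hb
  have hqb : q ≤ b := (le_max_left _ _).trans ((le_max_right _ _).trans hb)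
  have hℓb : ℓ < b := (le_max_right _ _).trans ((le_max_right _ _).trans hb)
  have hb1 : 0 < b := by omega
  have hbn' : b ≤ n := by omega
  set R : ℕ → Finset α := fun j => (blockHead q b n j).image σ with hR
  set U : ℕ → Finset α := fun j => (blockTail q b n j).image σ with hU
  have hRU : ∀ j, R j ∪ U j = (blockHead q b n j ∪ blockTail q b n j).image σ := fun j =>
    (Finset.image_union _ _).symm
  have hmem : ∀ j < n / b, ∀ v, v ∈ R j ∪ U j ↔ blockIndex b n (σ.symm v) = j := by
    intro j hj v
    rw [hRU, ← mem_block (q := q) hb1 hbn' hj, Finset.mem_image]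
    exact ⟨fun ⟨a, ha, h⟩ => by rwa [← h, Equiv.symm_apply_apply],
      fun h => ⟨_, h, Equiv.apply_symm_apply _ _⟩⟩
  have hcard : ∀ j < n / b, (R j ∪ U j).card = blockLen b n j := fun j hj => by
    rw [hRU, Finset.card_image_of_injective _ σ.injective, card_block hj]
  have hcardR : ∀ j < n / b, (R j).card = blockLen b n j / q := fun j hj => by
    rw [Finset.card_image_of_injective _ σ.injective, card_blockHead hj]
  obtain ⟨D, hD⟩ := hC α G (n / b) (prevBlock b n) R U (fun j hj => prevBlock_lt hj)
    (fun j _ => (Finset.disjoint_image σ.injective).2 disjoint_blockHead_blockTail)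
    (fun j hj => by rw [hcard j hj]; exact hb₀.trans (blockLen_ge b n j))
    (fun j hj => by rw [hcard j hj, hcardR j hj]; exact Nat.mul_div_le _ _)
    (fun j hj => by
      rw [hcard j hj, hcardR j hj]
      have h1 : 1 ≤ blockLen b n j / q :=
        (Nat.le_div_iff_mul_le (by omega)).2 (by have := blockLen_ge b n j; omega)
      have h2 := Nat.lt_mul_div_succ (blockLen b n j) (show 0 < q by omega)
      have h3 : q * (blockLen b n j / q + 1) ≤ q * (2 * (blockLen b n j / q)) :=
        Nat.mul_le_mul_left _ (by omega)
      rw [mul_comm 2 q, mul_assoc]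
      exact h2.le.trans h3)
    (fun j hj v hv => by
      have hx : blockIndex b n (σ.symm v) = j ∨ blockIndex b n (σ.symm v) = prevBlock b n j :=
        hv.imp (hmem j hj v).1 (hmem _ (prevBlock_lt hj) v).1
      have h1 := nonNbrs_image_card_le (G := G) σ (blockHead q b n j) (σ.symm v)
      have h2 := nonNbrs_image_card_le (G := G) σ (blockTail q b n j) (σ.symm v)
      have g1 := hσ (σ.symm v, blockHead q b n j) (mem_blockPairs.2 ⟨j, hj, hx, Or.inl rfl⟩)
      have g2 := hσ (σ.symm v, blockTail q b n j) (mem_blockPairs.2 ⟨j, hj, hx, Or.inr rfl⟩)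
      simp only [Equiv.apply_symm_apply] at h1 h2 g1 g2
      simp only [hR, hU, Finset.card_image_of_injective _ σ.injective]
      exact ⟨h1.trans g1, h2.trans g2⟩)
  have hlen : ∀ j < n / b, (D j).length = blockLen b n j := fun j hj => by
    obtain ⟨h1, h2, -⟩ := hD j hj
    rw [← List.toFinset_card_of_nodup h1, h2, hcard j hj]
  have hj : ∀ x, blockIndex b n x < n / b := blockIndex_lt hb1 hbn'
  have hpos : ∀ x : Fin n, (x : ℕ) - blockIndex b n x * b < (D (blockIndex b n x)).length := by
    intro x
    rw [hlen _ (hj x)]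
    have h1 := blockIndex_mul_le b n x
    have h2 := lt_blockIndex_mul_add hb1 hbn' x.2
    omega
  set ψ : Fin n → α := fun x => (D (blockIndex b n x))[(x : ℕ) - blockIndex b n x * b]'(hpos x)
    with hψ
  have hblk : ∀ x, blockIndex b n (σ.symm (ψ x)) = blockIndex b n x := fun x => by
    rw [← hmem _ (hj x), ← (hD _ (hj x)).2.1, List.mem_toFinset]
    exact List.getElem_mem _
  have hinj : Function.Injective ψ := by
    intro x y hxy
    have h := hblk x
    rw [hxy, hblk y] at h
    have h1 := blockIndex_mul_le b n x
    have h2 := blockIndex_mul_le b n y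
    have h3 : (D (blockIndex b n x))[(x : ℕ) - blockIndex b n x * b]'(hpos x) =
        (D (blockIndex b n x))[(y : ℕ) - blockIndex b n x * b]'(by
          have := hpos y; simp only [h] at this; exact this) := by
      simp only [hψ, h] at hxy
      exact hxy
    rw [(hD _ (hj x)).1.getElem_inj_iff] at h3
    rw [h] at h2
    exact Fin.ext (by omega)
  have hsurj : Function.Surjective ψ := by
    have := Finite.surjective_of_injective (σ.symm.injective.comp hinj)
    exact (Function.Surjective.of_comp_iff' σ.symm.bijective ψ).1 this
  refine ⟨Equiv.ofBijective ψ ⟨hinj, hsurj⟩, hblk, fun x y d hd1 hd hy => ?_⟩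
  change G.Adj (ψ x) (ψ y)
  have hx := hpos x
  have hy' := hpos y
  rcases blockIndex_add_mod hb1 hbn x.2 (hd.trans_lt hℓb) with ⟨h1, h2⟩ | ⟨h1, h2, h3⟩
  · rw [← hy] at h1 h2
    have hc := powChain_iff_getElem.1 (hD _ (hj x)).2.2.1
    simp only [hψ, h1, h2]
    simp only [h1, h2] at hy'
    exact hc _ _ (by omega) hy' (by omega)
  · rw [← hy] at h1 h2 h3
    have hc := powChain_iff_getElem.1 (hD _ (hj y)).2.2.2
    rw [← hlen _ (hj x)] at h2
    have hbl := hlen _ (hj y)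
    have hbg := blockLen_ge b n (blockIndex b n y)
    have := hc ((x : ℕ) - blockIndex b n x * b) ((x : ℕ) - blockIndex b n x * b + d) (by omega)
      (by rw [h1, List.length_append, List.length_take]; omega) (by omega)
    simp only [h1] at this
    rw [List.getElem_append_left hx, List.getElem_append_right (by omega),
      List.getElem_take] at this
    simp only [h2, Nat.add_sub_cancel_left] at this
    exact this

end BlockOrder

section SpreadOrders

lemma exists_block_scale {ν : ℝ} (hν : 0 < ν) {q : ℕ} (hq : 0 < q) (b₀ : ℕ) :
    ∃ t : ℕ, 1 ≤ t ∧ b₀ ≤ q * t ∧ 2 ≤ ν * t ∧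
      (2 * (q * t : ℝ) + 1) * (2 * (8 * (q * t : ℝ) + 4) * (2 * (q * t : ℝ) + 2) *
        Real.exp (-(ν ^ 2 / 4) * (t - 2))) ≤ 1 / 4 := by
  set c : ℝ := ν ^ 2 / 4 with hc
  have hc0 : 0 < c := by positivity
  have hqR : (0 : ℝ) < q := by exact_mod_cast hq
  have hlim : Filter.Tendsto (fun t : ℕ => (c * (t : ℝ)) ^ 3 * Real.exp (-(c * (t : ℝ))))
      Filter.atTop (nhds 0) :=
    (Real.tendsto_pow_mul_exp_neg_atTop_nhds_zero 3).comp
      (tendsto_natCast_atTop_atTop.const_mul_atTop hc0)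
  have hsmall := hlim.eventually (gt_mem_nhds
    (show 0 < c ^ 3 * Real.exp (-(2 * c)) / (4 * (288 * (q : ℝ) ^ 3)) by positivity))
  have hνt := (tendsto_natCast_atTop_atTop (R := ℝ)).eventually_ge_atTop (2 / ν)
  obtain ⟨t, h1, h2, h3⟩ :=
    (hsmall.and (hνt.and (Filter.eventually_ge_atTop (max 1 b₀)))).exists
  have ht1 : 1 ≤ t := (le_max_left _ _).trans h3
  refine ⟨t, ht1, (le_max_right 1 b₀).trans (h3.trans (Nat.le_mul_of_pos_left t hq)), ?_, ?_⟩
  · rw [div_le_iff₀ hν] at h2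
    linarith
  have hb : (1 : ℝ) ≤ q * t := by exact_mod_cast Nat.mul_pos hq ht1
  have hexp : Real.exp (-c * (t - 2)) = Real.exp (-(c * t)) * Real.exp (2 * c) := by
    rw [← Real.exp_add]
    congr 1
    ring
  have hpoly : (2 * (q * t : ℝ) + 1) * (2 * (8 * (q * t : ℝ) + 4) * (2 * (q * t : ℝ) + 2)) ≤
      288 * (q * t : ℝ) ^ 3 := by
    calc (2 * (q * t : ℝ) + 1) * (2 * (8 * (q * t : ℝ) + 4) * (2 * (q * t : ℝ) + 2))
        ≤ (3 * (q * t : ℝ)) * (2 * (12 * (q * t : ℝ)) * (4 * (q * t : ℝ))) := by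
          gcongr <;> linarith
      _ = 288 * (q * t : ℝ) ^ 3 := by ring
  rw [← mul_assoc]
  refine (mul_le_mul_of_nonneg_right hpoly (Real.exp_pos _).le).trans ?_
  rw [lt_div_iff₀ (by positivity)] at h1
  have e2 : Real.exp (-(2 * c)) * Real.exp (2 * c) = 1 := by
    rw [← Real.exp_add, neg_add_cancel, Real.exp_zero]
  have h4 := mul_le_mul_of_nonneg_right h1.le (Real.exp_pos (2 * c)).le
  rw [mul_assoc (c ^ 3), e2, mul_one] at h4
  rw [hexp]
  have h5 : 4 * (288 * (q * t : ℝ) ^ 3 * (Real.exp (-(c * t)) * Real.exp (2 * c))) * c ^ 3 ≤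
      1 * c ^ 3 := by
    rw [one_mul]
    refine le_trans (le_of_eq ?_) h4
    ring
  have h6 := le_of_mul_le_mul_right h5 (by positivity)
  linarith

open Classical in
/-- A dense graph admits a spread family of vertex orders which are `ℓ`th powers of Hamilton
cycles. -/
theorem exists_spread_orders {ℓ : ℕ} (hℓ : 1 ≤ ℓ) {μ : ℝ} (hμ : 0 < μ) :
    ∃ K : ℝ, 0 ≤ K ∧ ∃ n₁ : ℕ, ∀ n : ℕ, n₁ ≤ n → ∀ G : SimpleGraph (Fin n),
      (∀ v, ((Finset.univ.filter fun w => ¬ G.Adj v w).card : ℝ) ≤ (1 / (ℓ + 1) - μ) * n) →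
      ∃ (Ω : Finset (Equiv.Perm (Fin n))) (ψ : Equiv.Perm (Fin n) → Equiv.Perm (Fin n)),
        Ω.Nonempty ∧
        (∀ σ ∈ Ω, ∀ x y : Fin n, ∀ d, 1 ≤ d → d ≤ ℓ → (y : ℕ) = (x + d) % n →
          G.Adj (ψ σ x) (ψ σ y)) ∧
        ∀ (X : Finset (Fin n)) (g : Fin n → Fin n),
          ((Ω.filter fun σ => ∀ x ∈ X, ψ σ (g x) = x).card : ℝ) ≤ (K / n) ^ X.card * Ω.card := by
  obtain ⟨q, hq, b₀, hO⟩ := exists_block_order hℓ (half_pos hμ)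
  obtain ⟨t, ht, hb₀, hνt, hη⟩ :=
    exists_block_scale (show 0 < μ / 4 by positivity) (show 0 < q by omega) b₀
  set b := q * t with hb
  have hb1 : 0 < b := Nat.mul_pos (by omega) ht
  refine ⟨6 * (2 * b : ℕ), by positivity, 2 * (2 * b + 1) ^ 2, fun n hn G hG => ?_⟩
  have hbn : 2 * b ≤ n := by nlinarith
  have hn0 : 0 < n := by omega
  have hnR : (0 : ℝ) < n := by exact_mod_cast hn0
  have hβ0 : (0 : ℝ) ≤ 1 / (ℓ + 1) - μ := by
    have := (Nat.cast_nonneg _).trans (hG ⟨0, hn0⟩)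
    exact nonneg_of_mul_nonneg_left this hnR
  have hℓ1 : (1 : ℝ) / (ℓ + 1) ≤ 1 := by
    rw [div_le_one (by positivity)]
    linarith [Nat.cast_nonneg (α := ℝ) ℓ]
  obtain ⟨Ω, hΩ, hgood, hspread⟩ := exists_spread_good_perms (G := G)
    (β := 1 / (ℓ + 1) - μ) (ν := μ / 4) (s₀ := t) hβ0 (by linarith) (by positivity) (by linarith)
    (by simpa using hG) (I := blockPairs q b n) (A := 8 * b + 4) (M := 2 * b) hνt
    (fun i hi => by
      have := le_card_of_mem_blockPairs hq hi
      rw [hb, Nat.mul_div_cancel_left _ (by omega)] at this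
      exact_mod_cast this)
    (fun i hi => card_le_of_mem_blockPairs hb1 hi)
    (fun a => by convert card_blockPairs_filter_le (q := q) hb1 (by omega) a)
    (by simpa using hn)
    (by
      rw [hb]
      push_cast
      exact hη)
  have hψ : ∀ σ : Equiv.Perm (Fin n), ∃ ψ : Equiv.Perm (Fin n), σ ∈ Ω →
      (∀ x, blockIndex b n (σ.symm (ψ x)) = blockIndex b n x) ∧
        ∀ x y : Fin n, ∀ d, 1 ≤ d → d ≤ ℓ → (y : ℕ) = (x + d) % n → G.Adj (ψ x) (ψ y) := by
    intro σ
    by_cases hσ : σ ∈ Ω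
    · obtain ⟨ψ, h⟩ := hO b n hb₀ hbn (Fin n) G σ (fun i hi => by
        have h1 := hgood σ hσ i hi
        have h2 : (1 : ℝ) / (ℓ + 1) - μ / 2 = 1 / (ℓ + 1) - μ + 2 * (μ / 4) := by ring
        rw [h2]
        convert h1)
      exact ⟨ψ, fun _ => h⟩
    · exact ⟨σ, fun h => absurd h hσ⟩
  choose ψ hψ using hψ
  refine ⟨Ω, ψ, hΩ, fun σ hσ => (hψ σ hσ).2, fun X g => ?_⟩
  have := spread_of_blocks hspread (blk := fun a : Fin n => blockIndex b n a) (L := 2 * b)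
    (fun j => by convert card_filter_blockIndex_le hb1 (by omega : b ≤ n) j)
    (fun σ => ψ σ) (fun σ hσ a => (hψ σ hσ).1 a) X g
  rw [Fintype.card_fin] at this
  convert this

end SpreadOrders

section Assembly

/-- The residue classes modulo `n` are represented by `0, …, n - 1`. -/
def zmodEquivFin (n : ℕ) [NeZero n] : ZMod n ≃ Fin n where
  toFun z := ⟨z.val, z.val_lt⟩
  invFun a := ((a : ℕ) : ZMod n)
  left_inv z := ZMod.natCast_zmod_val z
  right_inv a := Fin.ext (ZMod.val_natCast_of_lt a.2)

/-- The graph whose edges are the pairs in `G`. -/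
def pairGraph {α : Type*} [DecidableEq α] (G : Finset (Finset α)) : SimpleGraph α where
  Adj u v := u ≠ v ∧ {u, v} ∈ G
  symm := ⟨fun u v h => ⟨h.1.symm, by rw [Finset.pair_comm]; exact h.2⟩⟩
  loopless := ⟨fun _ h => h.1 rfl⟩

open Classical in
lemma card_not_adj_pairGraph_le {n : ℕ} {G : Finset (Finset (Fin n))} {c : ℝ} (hG : IsHG 2 n G)
    (hdeg : MinDegGE G 1 ((1 - c) * n)) (v : Fin n) :
    ((Finset.univ.filter fun w => ¬ (pairGraph G).Adj v w).card : ℝ) ≤ c * n := by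
  have h1 := hdeg {v} (Finset.card_singleton v)
  have hsub : G.filter (fun e => {v} ⊆ e) ⊆
      (Finset.univ.filter fun w => (pairGraph G).Adj v w).image fun w => {v, w} := by
    intro e he
    obtain ⟨he, hv⟩ := Finset.mem_filter.1 he
    obtain ⟨x, y, hxy, rfl⟩ := Finset.card_eq_two.1 (hG e he)
    rw [Finset.singleton_subset_iff, Finset.mem_insert, Finset.mem_singleton] at hv
    rw [Finset.mem_image]
    rcases hv with rfl | rfl
    · exact ⟨y, Finset.mem_filter.2 ⟨Finset.mem_univ _, hxy, he⟩, rfl⟩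
    · rw [Finset.pair_comm] at he ⊢
      exact ⟨x, Finset.mem_filter.2 ⟨Finset.mem_univ _, hxy.symm, he⟩, rfl⟩
  have h2 : ((G.filter fun e => {v} ⊆ e).card : ℝ) ≤
      (Finset.univ.filter fun w => (pairGraph G).Adj v w).card := by
    exact_mod_cast (Finset.card_le_card hsub).trans Finset.card_image_le
  have h3 : ((Finset.univ.filter fun w => (pairGraph G).Adj v w).card : ℝ) +
      (Finset.univ.filter fun w => ¬ (pairGraph G).Adj v w).card = n := by
    have := Finset.card_filter_add_card_filter_not (s := (Finset.univ : Finset (Fin n)))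
      (fun w => (pairGraph G).Adj v w)
    rw [Finset.card_univ, Fintype.card_fin] at this
    exact_mod_cast this
  linarith

lemma hasPowHamCycle_of_powEdges_subset {ℓ n : ℕ} [NeZero n] {E : Finset (Finset (Fin n))}
    (φ : ZMod n ≃ Fin n) (h : powEdges ℓ φ ⊆ E) : HasPowHamCycle ℓ n E := by
  refine ⟨fun i => φ (i : ZMod n), fun i => by simp, fun i hi j hj hij => ?_, fun v => ?_,
    fun i j hj1 hj => h ?_⟩
  · have := congrArg ZMod.val (φ.injective hij)
    rwa [ZMod.val_natCast_of_lt hi, ZMod.val_natCast_of_lt hj] at this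
  · exact ⟨(φ.symm v).val, ZMod.val_lt _, by simp⟩
  · refine Finset.mem_image.2 ⟨((i : ZMod n), ⟨j - 1, by omega⟩), Finset.mem_univ _, ?_⟩
    simp only [Nat.sub_add_cancel hj1, Nat.cast_add]

lemma powEdges_subset_of_adj {ℓ n : ℕ} [NeZero n] {G : Finset (Finset (Fin n))}
    {ψ : Equiv.Perm (Fin n)}
    (hψ : ∀ x y : Fin n, ∀ d, 1 ≤ d → d ≤ ℓ → (y : ℕ) = (x + d) % n →
      (pairGraph G).Adj (ψ x) (ψ y)) : powEdges ℓ ((zmodEquivFin n).trans ψ) ⊆ G := by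
  intro e he
  obtain ⟨⟨a, d⟩, -, rfl⟩ := Finset.mem_image.1 he
  refine (hψ (zmodEquivFin n a) (zmodEquivFin n (a + ((d : ℕ) + 1 : ℕ))) (d + 1) (by omega)
    (by have := d.2; omega) ?_).2
  change (a + (((d : ℕ) + 1 : ℕ) : ZMod n)).val = (a.val + (d + 1)) % n
  rw [ZMod.val_add, ZMod.val_natCast, Nat.add_mod_mod]

end Assembly

/-- **Powers of Hamilton cycles — minimum degree.**
If `ℓ ≥ 2`, `μ > 0`, `p = ω(n^{-1/ℓ})` and `G` is an `n`-vertex graph with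
`δ(G) ≥ (1 - 1/(ℓ+1) + μ) n`, then `G_p` contains the `ℓ`-th power of a
Hamilton cycle with high probability. -/
theorem power_hamilton_cycles_minimum_degree
    (ℓ : ℕ) (hℓ : 2 ≤ ℓ) (μ : ℝ) (hμ : 0 < μ)
    (p : ℕ → ℝ) (hp : ∀ n, 0 ≤ p n ∧ p n ≤ 1)
    (hω : Filter.Tendsto (fun n : ℕ => p n * (n : ℝ) ^ ((1 : ℝ) / (ℓ : ℝ)))
      Filter.atTop Filter.atTop) :
    ∀ ε : ℝ, 0 < ε → ∃ n₀ : ℕ, ∀ n, n₀ ≤ n →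
      ∀ G : Finset (Finset (Fin n)), IsHG 2 n G →
        MinDegGE G 1 ((1 - 1 / ((ℓ : ℝ) + 1) + μ) * (n : ℝ)) →
        1 - ε ≤ sparsProb G (p n) (fun E => HasPowHamCycle ℓ n E) := by
  classical
  intro ε hε
  obtain ⟨K, hK, n₁, hO⟩ := exists_spread_orders (show 1 ≤ ℓ by omega) hμ
  obtain ⟨C₀, n₂, hS⟩ := sparsProb_powEdges_ge hℓ hK hε
  obtain ⟨n₃, hn₃⟩ := Filter.eventually_atTop.1 (hω.eventually_ge_atTop (max C₀ 1))
  refine ⟨max (max n₁ n₂) (max n₃ 1), fun n hn G hG hdeg => ?_⟩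
  simp only [max_le_iff] at hn
  obtain ⟨⟨hn1, hn2⟩, hn3, hn0⟩ := hn
  have : NeZero n := ⟨by omega⟩
  have hpn := max_le_iff.1 (hn₃ n hn3)
  have hp0 : 0 < p n := by
    rcases (hp n).1.eq_or_lt with h | h
    · rw [← h, zero_mul] at hpn
      linarith [hpn.2]
    · exact h
  obtain ⟨Ω, ψ, ⟨σ₀, hσ₀⟩, hadj, hspread⟩ := hO n hn1 (pairGraph G)
    (fun v => by
      convert card_not_adj_pairGraph_le (c := 1 / (ℓ + 1) - μ) hG
        (by convert hdeg using 2; ring) v)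
  have hΩ : (0 : ℝ) < Ω.card := by exact_mod_cast Finset.card_pos.2 ⟨σ₀, hσ₀⟩
  refine (hS n hn2 (p n) hp0 (hp n).2 hpn.1 (Fin n) {σ // σ ∈ Ω} (fun _ => (Ω.card : ℝ)⁻¹)
    (fun σ => (zmodEquivFin n).trans (ψ σ)) (fun _ => by positivity) ?_ (fun X g => ?_) G
    (fun σ => powEdges_subset_of_adj (hadj σ σ.2))).trans
    (sparsProb_mono G (hp n).1 (hp n).2 fun E _ ⟨σ, h⟩ => hasPowHamCycle_of_powEdges_subset _ h)
  · simp [hΩ.ne']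
  · have h := hspread X fun x => zmodEquivFin n (g x)
    rw [← Finset.mul_sum, inv_mul_le_iff₀ hΩ, mul_comm]
    refine le_trans (le_of_eq ?_) h
    rw [Finset.card_filter, Nat.cast_sum, ← Finset.sum_coe_sort Ω]
    refine Finset.sum_congr rfl fun σ _ => ?_
    push_cast
    congr
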